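/- The bounded-degree uniform attachment random graph G_n(m,d) with d > 2m obeys the first-order convergence law: for every first-order sentence φ in the language of graphs, the limit lim_{n→∞} P(G_n ⊨ φ) exists. -/

import Mathlib

open MeasureTheory ProbabilityTheory Filter Topology
open scoped ENNReal

/-- The degree of a vertex in a simple graph on `ℕ` (the number of its neighbours). -/
noncomputable def graphDeg (g : SimpleGraph ℕ) (v : ℕ) : ℕ := (g.neighborSet v).ncard

/-- The complete graph on the vertex set `[m] = {1,…,m}`, viewed as a simple graph on `ℕ`. -/
def initGraph (m : ℕ) : SimpleGraph ℕ :=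
  SimpleGraph.fromRel (fun a b => a ∈ Finset.Icc 1 m ∧ b ∈ Finset.Icc 1 m)

/-- The graph obtained from `g` by joining the (new) vertex `v` to every vertex of `S`. -/
def attachStep (g : SimpleGraph ℕ) (v : ℕ) (S : Finset ℕ) : SimpleGraph ℕ :=
  g ⊔ SimpleGraph.fromRel (fun a b => a = v ∧ b ∈ S)

/-- The set of vertices of `[n] = {1,…,n}` whose degree in `g` is strictly less than `d`. -/
noncomputable def lowDegSet (d : ℕ) (g : SimpleGraph ℕ) (n : ℕ) : Finset ℕ :=
  (Finset.Icc 1 n).filter (fun v => graphDeg g v < d)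

/-- `IsUAProcess m d μ G` says that `(G n)_{n ≥ m}` (as random graphs on `ℕ`, with `G n`
supported on the vertex set `[n] = {1,…,n}`) is the bounded-degree uniform attachment
process: `G m` is the complete graph on `[m]`, and `G (n+1)` is obtained from `G n` by
joining the new vertex `n+1` to a uniformly chosen `m`-element subset of the set of
vertices of `G n` of degree less than `d`, conditionally on `G n` and independently of
the past (note that `G n` determines the whole past of the process). -/
def IsUAProcess (m d : ℕ) {Ω : Type*} [MeasurableSpace Ω] (μ : Measure Ω)
    (G : ℕ → Ω → SimpleGraph ℕ) : Prop :=
  (∀ n g, MeasurableSet {ω | G n ω = g}) ∧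
  (∀ ω, G m ω = initGraph m) ∧
  (∀ n, m ≤ n → ∀ g : SimpleGraph ℕ, ∀ S : Finset ℕ,
    S ⊆ lowDegSet d g n → S.card = m →
    μ ({ω | G (n + 1) ω = attachStep g (n + 1) S} ∩ {ω | G n ω = g})
      = μ {ω | G n ω = g} / (((lowDegSet d g n).card.choose m : ℝ≥0∞)))

set_option linter.unusedSectionVars false

namespace UA

/-- One step of the chain, acting on real functions of the graph. -/
noncomputable def step (m d n : ℕ) (f : SimpleGraph ℕ → ℝ) (g : SimpleGraph ℕ) : ℝ :=
  (∑ S ∈ (lowDegSet d g n).powersetCard m, f (attachStep g (n + 1) S)) /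
    ((lowDegSet d g n).card.choose m : ℝ)

/-- Expectation of `f` after `k` steps of the chain started at time `n0`. -/
noncomputable def iter (m d n0 : ℕ) : ℕ → (SimpleGraph ℕ → ℝ) → SimpleGraph ℕ → ℝ
  | 0, f => f
  | k + 1, f => iter m d n0 k (step m d (n0 + k) f)

/-- Deterministic properties of the graphs produced by the process. -/
structure Good (m d n : ℕ) (g : SimpleGraph ℕ) : Prop where
  le_n : m + 1 ≤ n
  mem_of_adj : ∀ a b, g.Adj a b → a ∈ Finset.Icc 1 n
  le_deg : ∀ v ∈ Finset.Icc 1 n, m ≤ graphDeg g v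
  deg_le : ∀ v ∈ Finset.Icc 1 n, graphDeg g v ≤ d
  sum_deg : ∑ v ∈ Finset.Icc 1 n, graphDeg g v + m * (m + 1) ≤ 2 * m * n

variable {m d n : ℕ} {g : SimpleGraph ℕ}

theorem attach_adj (g : SimpleGraph ℕ) (v : ℕ) (S : Finset ℕ) (a b : ℕ) :
    (attachStep g v S).Adj a b ↔ g.Adj a b ∨ (a ≠ b ∧ ((a = v ∧ b ∈ S) ∨ (b = v ∧ a ∈ S))) := by
  simp [attachStep, SimpleGraph.fromRel_adj]

theorem Good.mem_of_adj' (hg : Good m d n g) {a b : ℕ} (h : g.Adj a b) : b ∈ Finset.Icc 1 n :=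
  hg.mem_of_adj b a h.symm

theorem Good.finite_nbr (hg : Good m d n g) (v : ℕ) : (g.neighborSet v).Finite :=
  (Finset.finite_toSet (Finset.Icc 1 n)).subset fun _ hw => hg.mem_of_adj' hw

theorem lowDegSet_subset (d : ℕ) (g : SimpleGraph ℕ) (n : ℕ) :
    lowDegSet d g n ⊆ Finset.Icc 1 n := Finset.filter_subset _ _

theorem mem_lowDegSet {v : ℕ} : v ∈ lowDegSet d g n ↔ v ∈ Finset.Icc 1 n ∧ graphDeg g v < d := by
  simp [lowDegSet]

theorem Good.not_adj_succ (hg : Good m d n g) (a : ℕ) : ¬ g.Adj a (n + 1) := fun h => by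
  have := hg.mem_of_adj' h
  simp at this

theorem Good.not_adj_succ' (hg : Good m d n g) (a : ℕ) : ¬ g.Adj (n + 1) a := fun h =>
  hg.not_adj_succ a h.symm

theorem attach_adj_old (g : SimpleGraph ℕ) {S : Finset ℕ}
    {a b : ℕ} (ha : a ≠ n + 1) (hb : b ≠ n + 1) :
    (attachStep g (n + 1) S).Adj a b ↔ g.Adj a b := by
  simp [attach_adj, ha, hb]

theorem attach_adj_new (hg : Good m d n g) {S : Finset ℕ} (hS : S ⊆ Finset.Icc 1 n) (a : ℕ) :
    (attachStep g (n + 1) S).Adj (n + 1) a ↔ a ∈ S := by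
  rw [attach_adj]
  constructor
  · rintro (h | ⟨-, h | h⟩)
    · exact absurd h (hg.not_adj_succ' a)
    · exact h.2
    · have := hS h.2
      simp at this
  · intro h
    have := hS h
    right
    refine ⟨?_, Or.inl ⟨rfl, h⟩⟩
    rintro rfl
    simp at this

theorem deg_attach_new (hg : Good m d n g) {S : Finset ℕ} (hS : S ⊆ Finset.Icc 1 n) :
    graphDeg (attachStep g (n + 1) S) (n + 1) = S.card := by
  have : (attachStep g (n + 1) S).neighborSet (n + 1) = (S : Set ℕ) := by
    ext a
    simp [attach_adj_new hg hS]
  rw [graphDeg, this, Set.ncard_coe_finset]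

theorem deg_attach_old (hg : Good m d n g) {S : Finset ℕ} {v : ℕ} (hv : v ≠ n + 1) :
    graphDeg (attachStep g (n + 1) S) v = graphDeg g v + if v ∈ S then 1 else 0 := by
  by_cases h : v ∈ S
  · have : (attachStep g (n + 1) S).neighborSet v = insert (n + 1) (g.neighborSet v) := by
      ext a
      simp only [SimpleGraph.mem_neighborSet, attach_adj, Set.mem_insert_iff]
      grind
    rw [graphDeg, this, Set.ncard_insert_of_notMem _ (hg.finite_nbr v), if_pos h, graphDeg]
    exact hg.not_adj_succ v
  · have : (attachStep g (n + 1) S).neighborSet v = g.neighborSet v := by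
      ext a
      simp only [SimpleGraph.mem_neighborSet, attach_adj]
      grind
    rw [graphDeg, this, if_neg h, graphDeg, add_zero]

theorem Good.attach (hg : Good m d n g) (hd : m ≤ d) {S : Finset ℕ} (hS : S ⊆ lowDegSet d g n)
    (hc : S.card = m) : Good m d (n + 1) (attachStep g (n + 1) S) := by
  have hS' := hS.trans (lowDegSet_subset d g n)
  have hne : ∀ v ∈ Finset.Icc 1 n, v ≠ n + 1 := fun v hv => by simp at hv; omega
  have hI : Finset.Icc 1 (n + 1) = insert (n + 1) (Finset.Icc 1 n) := by
    ext; simp; omega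
  refine ⟨by have := hg.le_n; omega, ?_, ?_, ?_, ?_⟩
  · intro a b h
    rw [attach_adj] at h
    rcases h with h | ⟨-, h | h⟩
    · have := hg.mem_of_adj _ _ h
      simp at this ⊢; omega
    · simp [h.1]
    · have := hS' h.2
      simp at this ⊢; omega
  · intro v hv
    rw [hI, Finset.mem_insert] at hv
    rcases hv with rfl | hv
    · rw [deg_attach_new hg hS', hc]
    · rw [deg_attach_old hg (hne v hv)]
      have := hg.le_deg v hv
      omega
  · intro v hv
    rw [hI, Finset.mem_insert] at hv
    rcases hv with rfl | hv
    · rw [deg_attach_new hg hS', hc]; exact hd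
    · rw [deg_attach_old hg (hne v hv)]
      split_ifs with h
      · have := (mem_lowDegSet.1 (hS h)).2
        omega
      · exact hg.deg_le v hv
  · rw [hI, Finset.sum_insert (by simp), deg_attach_new hg hS', hc,
      Finset.sum_congr rfl fun v hv => deg_attach_old hg (hne v hv), Finset.sum_add_distrib,
      Finset.sum_ite_mem, Finset.inter_eq_right.2 hS']
    simp only [Finset.sum_const, smul_eq_mul, mul_one, hc]
    have := hg.sum_deg
    nlinarith

theorem Good.card_low (hg : Good m d n g) (hd : 2 * m < d) :
    n + m * (m + 1) ≤ (m + 1) * (lowDegSet d g n).card := by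
  have h1 : ∑ v ∈ Finset.Icc 1 n, (2 * m + 1) ≤
      ∑ v ∈ Finset.Icc 1 n, (graphDeg g v + if graphDeg g v < d then (m + 1) else 0) := by
    refine Finset.sum_le_sum fun v hv => ?_
    have := hg.le_deg v hv
    split_ifs <;> omega
  simp only [Finset.sum_add_distrib, ← Finset.sum_filter, Finset.sum_const, smul_eq_mul, Nat.card_Icc] at h1
  have := hg.sum_deg
  rw [lowDegSet]
  simp only [Nat.add_sub_cancel] at h1
  nlinarith

theorem card_low_le (d : ℕ) (g : SimpleGraph ℕ) (n : ℕ) : (lowDegSet d g n).card ≤ n := by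
  simpa using Finset.card_le_card (lowDegSet_subset d g n)

theorem Good.m_le_card_low (hg : Good m d n g) (hd : 2 * m < d) :
    m ≤ (lowDegSet d g n).card := by
  have := hg.card_low hd
  by_contra h
  push Not at h
  nlinarith

theorem Good.choose_pos (hg : Good m d n g) (hd : 2 * m < d) :
    (0 : ℝ) < ((lowDegSet d g n).card.choose m : ℝ) := by
  exact_mod_cast Nat.choose_pos (hg.m_le_card_low hd)

/-! ### The operators -/

theorem step_mono (hg : Good m d n g) (hd : 2 * m < d) {f f' : SimpleGraph ℕ → ℝ}
    (h : ∀ S ⊆ lowDegSet d g n, S.card = m →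
      f (attachStep g (n + 1) S) ≤ f' (attachStep g (n + 1) S)) :
    step m d n f g ≤ step m d n f' g := by
  unfold step
  have := hg.choose_pos hd
  gcongr with S hS
  rw [Finset.mem_powersetCard] at hS
  exact h S hS.1 hS.2

theorem step_const (hg : Good m d n g) (hd : 2 * m < d) (c : ℝ) :
    step m d n (fun _ => c) g = c := by
  have := hg.choose_pos hd
  simp only [step, Finset.sum_const, Finset.card_powersetCard, nsmul_eq_mul]
  field_simp

theorem step_add (f f' : SimpleGraph ℕ → ℝ) :
    step m d n (fun g => f g + f' g) g = step m d n f g + step m d n f' g := by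
  simp only [step, Finset.sum_add_distrib, add_div]

theorem step_sub (f f' : SimpleGraph ℕ → ℝ) :
    step m d n (fun g => f g - f' g) g = step m d n f g - step m d n f' g := by
  simp only [step, Finset.sum_sub_distrib, sub_div]

theorem step_mul (c : ℝ) (f : SimpleGraph ℕ → ℝ) :
    step m d n (fun g => c * f g) g = c * step m d n f g := by
  simp only [step, ← Finset.mul_sum, mul_div_assoc]

theorem step_sum {ι : Type*} (s : Finset ι) (f : ι → SimpleGraph ℕ → ℝ) :
    step m d n (fun g => ∑ i ∈ s, f i g) g = ∑ i ∈ s, step m d n (f i) g := by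
  simp only [step, ← Finset.sum_div]
  rw [Finset.sum_comm]

theorem iter_succ (n0 k : ℕ) (f : SimpleGraph ℕ → ℝ) :
    iter m d n0 (k + 1) f = iter m d n0 k (step m d (n0 + k) f) := rfl

theorem iter_mono (hd : 2 * m < d) {n0 : ℕ} (hg : Good m d n0 g) {k : ℕ} :
    ∀ {f f' : SimpleGraph ℕ → ℝ}, (∀ g', Good m d (n0 + k) g' → f g' ≤ f' g') →
    iter m d n0 k f g ≤ iter m d n0 k f' g := by
  induction k with
  | zero => intro f f' h; exact h g hg
  | succ k ih =>
    intro f f' h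
    exact ih fun g' hg' => step_mono hg' hd fun S h1 h2 => h _ (hg'.attach (by omega) h1 h2)

theorem iter_congr (hd : 2 * m < d) {n0 : ℕ} (hg : Good m d n0 g) {k : ℕ}
    {f f' : SimpleGraph ℕ → ℝ} (h : ∀ g', Good m d (n0 + k) g' → f g' = f' g') :
    iter m d n0 k f g = iter m d n0 k f' g :=
  le_antisymm (iter_mono hd hg fun g' hg' => (h g' hg').le)
    (iter_mono hd hg fun g' hg' => (h g' hg').ge)

theorem iter_const (hd : 2 * m < d) {n0 : ℕ} (hg : Good m d n0 g) (k : ℕ) (c : ℝ) :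
    iter m d n0 k (fun _ => c) g = c := by
  induction k with
  | zero => rfl
  | succ k ih =>
    rw [iter_succ, iter_congr hd hg (f' := fun _ => c) fun g' hg' => step_const hg' hd c, ih]

theorem iter_add {n0 : ℕ} (k : ℕ) : ∀ (f f' : SimpleGraph ℕ → ℝ),
    iter m d n0 k (fun g => f g + f' g) g = iter m d n0 k f g + iter m d n0 k f' g := by
  induction k with
  | zero => intro f f'; rfl
  | succ k ih =>
    intro f f'
    simp only [iter_succ]
    rw [← ih]
    congr 1
    funext g
    exact step_add f f'

theorem iter_mul {n0 : ℕ} (k : ℕ) (c : ℝ) : ∀ (f : SimpleGraph ℕ → ℝ),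
    iter m d n0 k (fun g => c * f g) g = c * iter m d n0 k f g := by
  induction k with
  | zero => intro f; rfl
  | succ k ih =>
    intro f
    simp only [iter_succ]
    rw [← ih]
    congr 1
    funext g
    exact step_mul c f

theorem iter_sub {n0 : ℕ} (k : ℕ) (f f' : SimpleGraph ℕ → ℝ) :
    iter m d n0 k (fun g => f g - f' g) g = iter m d n0 k f g - iter m d n0 k f' g := by
  have h := iter_add (m := m) (d := d) (n0 := n0) (g := g) k f (fun g => (-1) * f' g)
  rw [iter_mul] at h
  simp only [neg_mul, one_mul, ← sub_eq_add_neg] at h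
  exact h

theorem iter_sum {n0 : ℕ} (k : ℕ) {ι : Type*} (s : Finset ι) : ∀ (f : ι → SimpleGraph ℕ → ℝ),
    iter m d n0 k (fun g => ∑ i ∈ s, f i g) g = ∑ i ∈ s, iter m d n0 k (f i) g := by
  induction k with
  | zero => intro f; rfl
  | succ k ih =>
    intro f
    simp only [iter_succ]
    rw [← ih]
    congr 1
    funext g
    exact step_sum s f

theorem iter_nonneg (hd : 2 * m < d) {n0 : ℕ} (hg : Good m d n0 g) {k : ℕ}
    {f : SimpleGraph ℕ → ℝ} (h : ∀ g', Good m d (n0 + k) g' → 0 ≤ f g') :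
    0 ≤ iter m d n0 k f g := by
  rw [← iter_const hd hg k 0]
  exact iter_mono hd hg h

theorem iter_abs_le (hd : 2 * m < d) {n0 : ℕ} (hg : Good m d n0 g) {k : ℕ}
    {f : SimpleGraph ℕ → ℝ} :
    |iter m d n0 k f g| ≤ iter m d n0 k (fun g => |f g|) g := by
  rw [abs_le]
  constructor
  · have h := iter_mul (m := m) (d := d) (n0 := n0) (g := g) k (-1) (fun g => |f g|)
    simp only [neg_mul, one_mul] at h
    rw [← h]
    exact iter_mono hd hg fun g' _ => neg_abs_le _
  · exact iter_mono hd hg fun g' _ => le_abs_self _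

/-- The semigroup property. -/
theorem iter_iter (n0 k : ℕ) : ∀ (l : ℕ) (f : SimpleGraph ℕ → ℝ),
    iter m d n0 (k + l) f = iter m d n0 k (iter m d (n0 + k) l f) := by
  intro l
  induction l with
  | zero => intro f; rfl
  | succ l ih =>
    intro f
    rw [← add_assoc, iter_succ, ih, iter_succ, add_assoc]

end UA

namespace UA

section Patterns

variable {V : Type*} (H : SimpleGraph V)

/-- `f` is an induced embedding of `H[K]` into `g[1..n]` with prescribed degrees `D` (and takes
the value `0` outside of `K`). -/
structure IsEmb (K : Finset V) (D : V → ℕ) (g : SimpleGraph ℕ) (n : ℕ) (f : V → ℕ) : Prop where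
  mem : ∀ v ∈ K, f v ∈ Finset.Icc 1 n
  off : ∀ v ∉ K, f v = 0
  inj : Set.InjOn f K
  adj : ∀ u ∈ K, ∀ v ∈ K, (H.Adj u v ↔ g.Adj (f u) (f v))
  deg : ∀ v ∈ K, graphDeg g (f v) = D v

open Classical in
/-- The finite set of embeddings of a pattern. -/
noncomputable def emb [Fintype V] (K : Finset V) (D : V → ℕ) (g : SimpleGraph ℕ) (n : ℕ) :
    Finset (V → ℕ) :=
  (Fintype.piFinset fun _ : V => Finset.range (n + 1)).filter (IsEmb H K D g n)

/-- The number of embeddings of a pattern. -/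
noncomputable def cnt [Fintype V] (K : Finset V) (D : V → ℕ) (g : SimpleGraph ℕ) (n : ℕ) : ℕ :=
  (emb H K D g n).card

/-- The vertices of the pattern which are mapped to `S`. -/
def hitSet [DecidableEq V] (K : Finset V) (f : V → ℕ) (S : Finset ℕ) : Finset V :=
  K.filter (f · ∈ S)

/-- Lower the prescribed degrees by one on `U`. -/
def lower [DecidableEq V] (D : V → ℕ) (U : Finset V) (v : V) : ℕ :=
  D v - if v ∈ U then 1 else 0

/-- The number of unsaturated vertices of the pattern. -/
def unsat (d : ℕ) (K : Finset V) (D : V → ℕ) : ℕ := (K.filter (D · < d)).card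

open Classical in
/-- The neighbours of `h` in `K`. -/
noncomputable def nbrs (K : Finset V) (h : V) : Finset V := K.filter (H.Adj h)

/-- The probability that exactly `j` prescribed elements of a set of `σ` elements are hit. -/
noncomputable def pr (m L σ j : ℕ) : ℝ :=
  if j ≤ m then ((L - σ).choose (m - j) : ℝ) / (L.choose m : ℝ) else 0

variable {H} {K : Finset V}

theorem mem_nbrs {h v : V} : v ∈ nbrs H K h ↔ v ∈ K ∧ H.Adj h v := by
  simp [nbrs]

variable [Fintype V] {D : V → ℕ} {m d n : ℕ} {g : SimpleGraph ℕ}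

theorem mem_emb {f : V → ℕ} : f ∈ emb H K D g n ↔ IsEmb H K D g n f := by
  classical
  simp only [emb, Finset.mem_filter, Fintype.mem_piFinset, Finset.mem_range, and_iff_right_iff_imp]
  intro h v
  by_cases hv : v ∈ K
  · have := h.mem v hv
    simp at this; omega
  · rw [h.off v hv]; omega

variable [DecidableEq V]

theorem isEmb_attach_old (hg : Good m d n g) {S : Finset ℕ}
    (f : V → ℕ) (hm : 1 ≤ m) :
    (IsEmb H K D (attachStep g (n + 1) S) (n + 1) f ∧ ¬ ∃ h ∈ K, f h = n + 1) ↔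
      IsEmb H K (lower D (hitSet K f S)) g n f := by
  constructor
  · rintro ⟨h, hno⟩
    push Not at hno
    refine ⟨?_, h.off, h.inj, ?_, ?_⟩
    · intro v hv
      have h1 := h.mem v hv
      have h2 := hno v hv
      simp at h1 ⊢; omega
    · intro u hu v hv
      rw [h.adj u hu v hv, attach_adj_old _ (hno u hu) (hno v hv)]
    · intro v hv
      have := h.deg v hv
      rw [deg_attach_old hg (hno v hv)] at this
      rw [lower, ← this, hitSet]
      simp [hv]
  · intro h
    have hno : ∀ v ∈ K, f v ≠ n + 1 := fun v hv => by
      have h1 := h.mem v hv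
      simp at h1; omega
    refine ⟨⟨?_, h.off, h.inj, ?_, ?_⟩, by push Not; exact hno⟩
    · intro v hv
      have h1 := h.mem v hv
      simp at h1 ⊢; omega
    · intro u hu v hv
      rw [h.adj u hu v hv, attach_adj_old _ (hno u hu) (hno v hv)]
    · intro v hv
      have h1 := h.deg v hv
      have h2 := hg.le_deg _ (h.mem v hv)
      rw [deg_attach_old hg (hno v hv)]
      simp only [lower, hitSet, Finset.mem_filter, hv, true_and] at h1
      split_ifs at h1 ⊢ <;> omega

theorem isEmb_attach_new (hg : Good m d n g) {S : Finset ℕ} (hS : S ⊆ Finset.Icc 1 n)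
    (hc : S.card = m) (hm : 1 ≤ m) {h : V} (hh : h ∈ K) (f : V → ℕ) (hfh : f h = 0) :
    IsEmb H K D (attachStep g (n + 1) S) (n + 1) (Function.update f h (n + 1)) ↔
      (D h = m ∧ IsEmb H (K.erase h) (lower D (nbrs H K h)) g n f ∧
        hitSet (K.erase h) f S = nbrs H K h) := by
  have hup : ∀ v, v ≠ h → Function.update f h (n + 1) v = f v := fun v hv => by simp [hv]
  have hup' : Function.update f h (n + 1) h = n + 1 := by simp
  constructor
  · intro E
    have hno : ∀ v ∈ K.erase h, f v ≠ n + 1 := by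
      intro v hv e
      rw [Finset.mem_erase] at hv
      refine hv.1 (E.inj (by exact_mod_cast hv.2) (by exact_mod_cast hh) ?_)
      rw [hup v hv.1, hup', e]
    have hN : hitSet (K.erase h) f S = nbrs H K h := by
      ext v
      simp only [hitSet, Finset.mem_filter, Finset.mem_erase, mem_nbrs]
      constructor
      · rintro ⟨hv, h1⟩
        rw [E.adj h hh v hv.2, hup', hup v hv.1, attach_adj_new hg hS]
        exact ⟨hv.2, h1⟩
      · rintro ⟨hv, h1⟩
        have hne := h1.ne'
        rw [E.adj h hh v hv, hup', hup v hne, attach_adj_new hg hS] at h1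
        exact ⟨⟨hne, hv⟩, h1⟩
    refine ⟨?_, ⟨?_, ?_, ?_, ?_, ?_⟩, hN⟩
    · have := E.deg h hh
      rw [hup', deg_attach_new hg hS, hc] at this
      exact this.symm
    · intro v hv
      have h0 := hno v hv
      rw [Finset.mem_erase] at hv
      have h1 := E.mem v hv.2
      rw [hup v hv.1] at h1
      simp at h1 ⊢; omega
    · intro v hv
      by_cases e : v = h
      · rw [e, hfh]
      · have := E.off v (fun h' => hv (Finset.mem_erase.2 ⟨e, h'⟩))
        rwa [hup v e] at this
    · intro u hu v hv e
      rw [Finset.mem_coe, Finset.mem_erase] at hu hv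
      refine E.inj (by exact_mod_cast hu.2) (by exact_mod_cast hv.2) ?_
      rwa [hup u hu.1, hup v hv.1]
    · intro u hu v hv
      have h1 := hno u hu
      have h2 := hno v hv
      rw [Finset.mem_erase] at hu hv
      rw [E.adj u hu.2 v hv.2, hup u hu.1, hup v hv.1, attach_adj_old _ h1 h2]
    · intro v hv
      have h1 := hno v hv
      have hv' := hv
      rw [Finset.mem_erase] at hv'
      have := E.deg v hv'.2
      rw [hup v hv'.1, deg_attach_old hg h1] at this
      rw [lower, ← this, ← hN, hitSet]
      simp [hv'.1, hv'.2]
  · rintro ⟨hD, E, hN⟩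
    have hno : ∀ v ∈ K.erase h, f v ≠ n + 1 := fun v hv => by
      have h1 := E.mem v hv
      simp at h1; omega
    have hadj : ∀ v ∈ K, v ≠ h → (H.Adj h v ↔ f v ∈ S) := by
      intro v hv hne
      have : v ∈ hitSet (K.erase h) f S ↔ v ∈ nbrs H K h := by rw [hN]
      simp only [hitSet, mem_nbrs, Finset.mem_filter, Finset.mem_erase, hv, true_and,
        and_true] at this
      exact ⟨fun h1 => (this.2 h1).2, fun h1 => this.1 ⟨hne, h1⟩⟩
    refine ⟨?_, ?_, ?_, ?_, ?_⟩
    · intro v hv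
      by_cases e : v = h
      · rw [e, hup']; simp
      · have h1 := E.mem v (Finset.mem_erase.2 ⟨e, hv⟩)
        rw [hup v e]
        simp at h1 ⊢; omega
    · intro v hv
      have e : v ≠ h := fun e => hv (e ▸ hh)
      rw [hup v e]
      exact E.off v fun h' => hv (Finset.mem_of_mem_erase h')
    · intro u hu v hv e
      rw [Finset.mem_coe] at hu hv
      by_cases e1 : u = h <;> by_cases e2 : v = h
      · rw [e1, e2]
      · rw [e1, hup', hup v e2] at e
        exact absurd e.symm (hno v (Finset.mem_erase.2 ⟨e2, hv⟩))
      · rw [e2, hup', hup u e1] at e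
        exact absurd e (hno u (Finset.mem_erase.2 ⟨e1, hu⟩))
      · rw [hup u e1, hup v e2] at e
        exact E.inj (by exact_mod_cast Finset.mem_erase.2 ⟨e1, hu⟩)
          (by exact_mod_cast Finset.mem_erase.2 ⟨e2, hv⟩) e
    · intro u hu v hv
      by_cases e1 : u = h <;> by_cases e2 : v = h
      · rw [e1, e2]; simp
      · rw [e1, hup', hup v e2, attach_adj_new hg hS, hadj v hv e2]
      · rw [e2, hup', hup u e1, SimpleGraph.adj_comm, SimpleGraph.adj_comm (attachStep _ _ _),
          attach_adj_new hg hS, hadj u hu e1]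
      · have h1 := Finset.mem_erase.2 ⟨e1, hu⟩
        have h2 := Finset.mem_erase.2 ⟨e2, hv⟩
        rw [hup u e1, hup v e2, attach_adj_old _ (hno u h1) (hno v h2), E.adj u h1 v h2]
    · intro v hv
      by_cases e : v = h
      · rw [e, hup', deg_attach_new hg hS, hc, hD]
      · have hv' := Finset.mem_erase.2 ⟨e, hv⟩
        have h1 := E.deg v hv'
        have h2 := hg.le_deg _ (E.mem v hv')
        rw [hup v e, deg_attach_old hg (hno v hv')]
        rw [← hN] at h1
        simp only [lower, hitSet, Finset.mem_filter, hv', true_and] at h1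
        split_ifs at h1 ⊢ <;> omega

theorem cnt_attach (hg : Good m d n g) {S : Finset ℕ} (hS : S ⊆ Finset.Icc 1 n)
    (hc : S.card = m) (hm : 1 ≤ m) :
    cnt H K D (attachStep g (n + 1) S) (n + 1) =
      ∑ U ∈ K.powerset, ((emb H K (lower D U) g n).filter (hitSet K · S = U)).card +
      ∑ h ∈ K.filter (D · = m),
        ((emb H (K.erase h) (lower D (nbrs H K h)) g n).filter
          (hitSet (K.erase h) · S = nbrs H K h)).card := by
  classical
  rw [cnt, ← Finset.card_filter_add_card_filter_not (fun f => ¬ ∃ h ∈ K, f h = n + 1)]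
  congr 1
  · rw [Finset.card_eq_sum_card_fiberwise (f := fun f => hitSet K f S) (t := K.powerset)]
    · refine Finset.sum_congr rfl fun U _ => congrArg Finset.card ?_
      ext f
      simp only [Finset.mem_filter, mem_emb, isEmb_attach_old hg f hm]
      constructor
      · rintro ⟨h1, h2⟩; rw [h2] at h1; exact ⟨h1, h2⟩
      · rintro ⟨h1, h2⟩; rw [← h2] at h1; exact ⟨h1, h2⟩
    · intro f _
      simp only [Finset.coe_powerset, Set.mem_preimage, Set.mem_powerset_iff, hitSet,
        Finset.coe_subset]
      exact Finset.filter_subset _ _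
  · have hEq : (emb H K D (attachStep g (n + 1) S) (n + 1)).filter
        (fun f => ¬ ¬ ∃ h ∈ K, f h = n + 1) =
        K.biUnion fun h => (emb H K D (attachStep g (n + 1) S) (n + 1)).filter
          (fun f => f h = n + 1) := by
      ext f
      simp only [not_not, Finset.mem_filter, Finset.mem_biUnion]
      constructor
      · rintro ⟨h1, h, h2, h3⟩; exact ⟨h, h2, h1, h3⟩
      · rintro ⟨h, h2, h1, h3⟩; exact ⟨h1, h, h2, h3⟩
    rw [hEq, Finset.card_biUnion, Finset.sum_filter]
    · refine Finset.sum_congr rfl fun h hh => ?_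
      split_ifs with hD
      · refine Finset.card_bij' (fun f _ => Function.update f h 0)
          (fun f _ => Function.update f h (n + 1)) ?_ ?_ ?_ ?_
        · intro f hf
          simp only [Finset.mem_filter, mem_emb] at hf ⊢
          have := isEmb_attach_new (H := H) (D := D) hg hS hc hm hh (Function.update f h 0) (by simp)
          rw [Function.update_idem, ← hf.2, Function.update_eq_self, hf.2] at this
          exact (this.1 hf.1).2
        · intro f hf
          simp only [Finset.mem_filter, mem_emb] at hf ⊢
          refine ⟨(isEmb_attach_new (H := H) (D := D) hg hS hc hm hh f
            (hf.1.off h (by simp))).2 ⟨hD, hf⟩, by simp⟩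
        · intro f hf
          simp only [Finset.mem_filter] at hf
          simp only [Function.update_idem]
          rw [← hf.2, Function.update_eq_self]
        · intro f hf
          simp only [Finset.mem_filter, mem_emb] at hf
          simp only [Function.update_idem]
          rw [← hf.1.off h (by simp), Function.update_eq_self]
      · rw [Finset.card_eq_zero, Finset.filter_eq_empty_iff]
        intro f hf e
        rw [mem_emb] at hf
        have := hf.deg h hh
        rw [e, deg_attach_new hg hS, hc] at this
        exact hD this.symm
    · intro a ha b hb hab
      simp only [Function.onFun]
      rw [Finset.disjoint_left]
      intro f h1 h2
      simp only [Finset.mem_filter, mem_emb] at h1 h2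
      exact hab (h1.1.inj ha hb (h1.2.trans h2.2.symm))

theorem card_hitting (f : V → ℕ) (hf : IsEmb H K D g n f) {U : Finset V} (hU : U ⊆ K)
    (hlow : ∀ u ∈ U, D u < d) :
    ((((lowDegSet d g n).powersetCard m).filter (fun S => hitSet K f S = U)).card : ℝ) =
      pr m (lowDegSet d g n).card (unsat d K D) U.card * ((lowDegSet d g n).card.choose m : ℝ) := by
  classical
  set L := lowDegSet d g n with hL
  have hmemL : ∀ v ∈ K, (f v ∈ L ↔ D v < d) := fun v hv => by
    rw [hL, mem_lowDegSet, hf.deg v hv]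
    exact ⟨fun h => h.2, fun h => ⟨hf.mem v hv, h⟩⟩
  have hinjU : Set.InjOn f U := hf.inj.mono (by exact_mod_cast hU)
  have hcU : (U.image f).card = U.card := Finset.card_image_of_injOn hinjU
  set A := (K.filter (D · < d)).image f with hA
  have hcA : A.card = unsat d K D :=
    Finset.card_image_of_injOn (hf.inj.mono (by
      intro x hx; exact Finset.mem_coe.2 (Finset.mem_of_mem_filter _ hx)))
  have hAL : A ⊆ L := by
    intro x hx
    simp only [hA, Finset.mem_image, Finset.mem_filter] at hx
    obtain ⟨v, ⟨hv, hv'⟩, rfl⟩ := hx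
    exact (hmemL v hv).2 hv'
  have hUA : U.image f ⊆ A := Finset.image_subset_image fun u hu =>
    Finset.mem_filter.2 ⟨hU hu, hlow u hu⟩
  have hUL := hUA.trans hAL
  have key : ∀ S ⊆ L, (hitSet K f S = U ↔ S ∩ A = U.image f) := by
    intro S hS
    constructor
    · rintro rfl
      ext x
      simp only [hA, hitSet, Finset.mem_inter, Finset.mem_image, Finset.mem_filter]
      constructor
      · rintro ⟨h1, v, ⟨h2, -⟩, rfl⟩; exact ⟨v, ⟨h2, h1⟩, rfl⟩
      · rintro ⟨v, ⟨h2, h1⟩, rfl⟩; exact ⟨h1, v, ⟨h2, (hmemL v h2).1 (hS h1)⟩, rfl⟩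
    · intro h
      ext v
      simp only [hitSet, Finset.mem_filter]
      constructor
      · rintro ⟨h2, h1⟩
        have : f v ∈ U.image f := by
          rw [← h, Finset.mem_inter]
          exact ⟨h1, Finset.mem_image_of_mem _ (Finset.mem_filter.2 ⟨h2, (hmemL v h2).1 (hS h1)⟩)⟩
        obtain ⟨u, hu, e⟩ := Finset.mem_image.1 this
        rwa [← hf.inj (hU hu) h2 e]
      · intro hv
        refine ⟨hU hv, ?_⟩
        have : f v ∈ S ∩ A := by rw [h]; exact Finset.mem_image_of_mem _ hv
        exact (Finset.mem_inter.1 this).1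
  have hfil : (L.powersetCard m).filter (fun S => hitSet K f S = U) =
      (L.powersetCard m).filter (fun S => S ∩ A = U.image f) :=
    Finset.filter_congr fun S hS => key S (Finset.mem_powersetCard.1 hS).1
  rw [hfil, pr]
  split_ifs with hj
  · have : ((L.powersetCard m).filter (fun S => S ∩ A = U.image f)).card =
        (L.card - unsat d K D).choose (m - U.card) := by
      rw [← hcA, ← Finset.card_sdiff_of_subset hAL, ← Finset.card_powersetCard]
      refine Finset.card_bij' (fun S _ => S \ U.image f) (fun T _ => T ∪ U.image f) ?_ ?_ ?_ ?_
      · intro S hS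
        simp only [Finset.mem_filter, Finset.mem_powersetCard] at hS ⊢
        constructor
        · intro x hx
          rw [Finset.mem_sdiff, ← hS.2, Finset.mem_inter] at hx
          rw [Finset.mem_sdiff]
          exact ⟨hS.1.1 hx.1, fun h => hx.2 ⟨hx.1, h⟩⟩
        · rw [Finset.card_sdiff_of_subset (hS.2 ▸ Finset.inter_subset_left), hS.1.2, hcU]
      · intro T hT
        simp only [Finset.mem_filter, Finset.mem_powersetCard] at hT ⊢
        have hdis : Disjoint T A := by
          rw [Finset.disjoint_left]
          intro x hx
          exact (Finset.mem_sdiff.1 (hT.1 hx)).2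
        refine ⟨⟨Finset.union_subset (hT.1.trans Finset.sdiff_subset) hUL, ?_⟩, ?_⟩
        · rw [Finset.card_union_of_disjoint (hdis.mono_right hUA), hT.2, hcU]
          omega
        · rw [Finset.union_inter_distrib_right, Finset.disjoint_iff_inter_eq_empty.1 hdis,
            Finset.empty_union, Finset.inter_eq_left.2 hUA]
      · intro S hS
        simp only [Finset.mem_filter] at hS
        exact Finset.sdiff_union_of_subset (hS.2 ▸ Finset.inter_subset_left)
      · intro T hT
        simp only [Finset.mem_powersetCard] at hT
        refine Finset.union_sdiff_cancel_right ?_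
        rw [Finset.disjoint_left]
        intro x hx h
        exact (Finset.mem_sdiff.1 (hT.1 hx)).2 (hUA h)
    rw [this]
    by_cases h0 : L.card.choose m = 0
    · rw [h0]
      have hLm : L.card < m := Nat.choose_eq_zero_iff.1 h0
      have : U.card ≤ unsat d K D := by rw [← hcU, ← hcA]; exact Finset.card_le_card hUA
      have h2 : unsat d K D ≤ L.card := by rw [← hcA]; exact Finset.card_le_card hAL
      rw [Nat.choose_eq_zero_of_lt (by omega)]
      simp
    · field_simp
  · rw [zero_mul]
    norm_cast
    rw [Finset.card_eq_zero, Finset.filter_eq_empty_iff]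
    intro S hS e
    have h1 : U.card ≤ S.card := by
      rw [← hcU, ← e]; exact Finset.card_le_card Finset.inter_subset_left
    rw [(Finset.mem_powersetCard.1 hS).2] at h1
    exact hj h1

theorem sum_hitting (hg : Good m d n g) (hd : 2 * m < d) {U : Finset V} (hU : U ⊆ K)
    (hlow : ∀ u ∈ U, D u < d) :
    (∑ S ∈ (lowDegSet d g n).powersetCard m,
      (((emb H K D g n).filter (hitSet K · S = U)).card : ℝ)) /
        ((lowDegSet d g n).card.choose m : ℝ) =
      cnt H K D g n * pr m (lowDegSet d g n).card (unsat d K D) U.card := by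
  classical
  have hpos := hg.choose_pos hd
  rw [div_eq_iff hpos.ne', mul_assoc, cnt]
  simp only [Finset.card_filter, Nat.cast_sum]
  rw [Finset.sum_comm]
  rw [Finset.sum_congr rfl (g := fun _ => pr m (lowDegSet d g n).card (unsat d K D) U.card *
    ((lowDegSet d g n).card.choose m : ℝ))]
  · simp
  · intro f hf
    rw [← card_hitting f (mem_emb.1 hf) hU hlow, Finset.card_filter]
    push_cast
    rfl

/-- The exact one-step equation for the number of embeddings of a pattern. -/
theorem step_cnt (hg : Good m d n g) (hm : 1 ≤ m) (hd : 2 * m < d) (hD : ∀ v ∈ K, D v ≤ d) :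
    step m d n (fun g' => (cnt H K D g' (n + 1) : ℝ)) g =
      ∑ U ∈ K.powerset, cnt H K (lower D U) g n *
        pr m (lowDegSet d g n).card (unsat d K (lower D U)) U.card +
      ∑ h ∈ K.filter (D · = m),
        cnt H (K.erase h) (lower D (nbrs H K h)) g n *
        pr m (lowDegSet d g n).card (unsat d (K.erase h) (lower D (nbrs H K h)))
          (nbrs H K h).card := by
  have hlow : ∀ U ⊆ K, ∀ u ∈ U, lower D U u < d := by
    intro U hU u hu
    have := hD u (hU hu)
    rw [lower, if_pos hu]
    omega
  have hnb : ∀ h, nbrs H K h ⊆ K.erase h := fun h v hv => by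
    rw [mem_nbrs] at hv
    exact Finset.mem_erase.2 ⟨hv.2.ne', hv.1⟩
  have h1 : ∀ U ∈ K.powerset, (cnt H K (lower D U) g n : ℝ) *
        pr m (lowDegSet d g n).card (unsat d K (lower D U)) U.card = (∑ S ∈ (lowDegSet d g n).powersetCard m,
      (((emb H K (lower D U) g n).filter (hitSet K · S = U)).card : ℝ)) /
        ((lowDegSet d g n).card.choose m : ℝ) := fun U hU =>
    (sum_hitting hg hd (Finset.mem_powerset.1 hU) (hlow U (Finset.mem_powerset.1 hU))).symm
  have h2 : ∀ h ∈ K.filter (D · = m), (cnt H (K.erase h) (lower D (nbrs H K h)) g n : ℝ) *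
        pr m (lowDegSet d g n).card (unsat d (K.erase h) (lower D (nbrs H K h)))
          (nbrs H K h).card = (∑ S ∈ (lowDegSet d g n).powersetCard m,
      (((emb H (K.erase h) (lower D (nbrs H K h)) g n).filter
        (hitSet (K.erase h) · S = nbrs H K h)).card : ℝ)) /
        ((lowDegSet d g n).card.choose m : ℝ) := fun h _ =>
    (sum_hitting hg hd (hnb h) (hlow _ ((hnb h).trans (Finset.erase_subset _ _)))).symm
  rw [Finset.sum_congr rfl h1, Finset.sum_congr rfl h2, ← Finset.sum_div, ← Finset.sum_div,
    ← add_div, step]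
  congr 1
  rw [Finset.sum_comm, Finset.sum_comm (s := K.filter (D · = m)), ← Finset.sum_add_distrib]
  refine Finset.sum_congr rfl fun S hS => ?_
  rw [Finset.mem_powersetCard] at hS
  rw [cnt_attach hg (hS.1.trans (lowDegSet_subset d g n)) hS.2 hm]
  push_cast
  rfl

end Patterns

end UA

namespace UA

/-! ### Asymptotics of hitting probabilities -/

theorem tendsto_choose_sub_div_pow (σ k : ℕ) :
    Tendsto (fun L : ℕ => ((L - σ).choose k : ℝ) / (L : ℝ) ^ k) atTop
      (𝓝 (1 / (k.factorial : ℝ))) := by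
  have h1 : Tendsto (fun L : ℕ => (L.choose k : ℝ) / ((L : ℝ) ^ k / k.factorial)) atTop (𝓝 1) := by
    have h := isEquivalent_choose k
    refine (Asymptotics.isEquivalent_iff_tendsto_one ?_).1 h
    filter_upwards [eventually_gt_atTop 0] with L hL
    have : (0 : ℝ) < L := by exact_mod_cast hL
    positivity
  have h2 : Tendsto (fun L : ℕ => ((L - σ).choose k : ℝ) / (((L - σ : ℕ) : ℝ) ^ k / k.factorial))
      atTop (𝓝 1) := h1.comp (tendsto_sub_atTop_nat σ)
  have h3 : Tendsto (fun L : ℕ => ((L - σ : ℕ) : ℝ) / L) atTop (𝓝 1) := by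
    have : Tendsto (fun L : ℕ => 1 - (σ : ℝ) / L) atTop (𝓝 (1 - 0)) :=
      tendsto_const_nhds.sub (tendsto_const_div_atTop_nhds_zero_nat _)
    rw [sub_zero] at this
    refine this.congr' ?_
    filter_upwards [eventually_gt_atTop σ] with L hL
    have : (0 : ℝ) < L := by exact_mod_cast (by omega : 0 < L)
    rw [Nat.cast_sub hL.le]
    field_simp
  have h4 := (h2.mul (h3.pow k)).mul_const (1 / (k.factorial : ℝ))
  simp only [one_pow, mul_one, one_mul] at h4
  refine h4.congr' ?_
  filter_upwards [eventually_gt_atTop σ] with L hL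
  have : (0 : ℝ) < L := by exact_mod_cast (by omega : 0 < L)
  have h5 : (0 : ℝ) < ((L - σ : ℕ) : ℝ) := by exact_mod_cast (by omega : 0 < L - σ)
  rw [div_pow]
  field_simp

theorem tendsto_pow_mul_pr (m σ j : ℕ) :
    Tendsto (fun L : ℕ => (L : ℝ) ^ j * pr m L σ j) atTop (𝓝 (m.descFactorial j : ℝ)) := by
  by_cases hj : j ≤ m
  · have h1 := tendsto_choose_sub_div_pow σ (m - j)
    have h2 := tendsto_choose_sub_div_pow 0 m
    have h3 := h1.div h2 (by positivity)
    have h4 : (1 / ((m - j).factorial : ℝ)) / (1 / (m.factorial : ℝ)) = (m.descFactorial j : ℝ) := by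
      have := Nat.factorial_mul_descFactorial hj
      have h : (((m - j).factorial : ℝ)) * (m.descFactorial j : ℝ) = (m.factorial : ℝ) := by
        exact_mod_cast this
      rw [← h]
      field_simp
    rw [h4] at h3
    refine h3.congr' ?_
    filter_upwards [eventually_ge_atTop (m + 1)] with L hL
    have h0 : (0 : ℝ) < L := by exact_mod_cast (by omega : 0 < L)
    have h5 : (0 : ℝ) < (L.choose m : ℝ) := by exact_mod_cast Nat.choose_pos (by omega)
    have h6 : (L : ℝ) ^ m = (L : ℝ) ^ j * (L : ℝ) ^ (m - j) := by
      rw [← pow_add]; congr 1; omega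
    simp only [pr, if_pos hj, Nat.sub_zero, Pi.div_apply]
    rw [h6]
    field_simp
  · simp only [pr, if_neg hj, mul_zero]
    rw [Nat.descFactorial_of_lt (by omega)]
    simp

theorem tendsto_mul_one_sub_pr (m σ : ℕ) :
    Tendsto (fun L : ℕ => (L : ℝ) * (1 - pr m L σ 0)) atTop (𝓝 (σ * m : ℝ)) := by
  induction σ with
  | zero =>
    simp only [Nat.cast_zero, zero_mul]
    refine tendsto_const_nhds.congr' ?_
    filter_upwards [eventually_ge_atTop m] with L hL
    have h5 : (0 : ℝ) < (L.choose m : ℝ) := by exact_mod_cast Nat.choose_pos (by omega)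
    simp [pr, h5.ne']
  | succ σ ih =>
    have h1 : Tendsto (fun L : ℕ => pr m L σ 0) atTop (𝓝 1) := by
      simpa using tendsto_pow_mul_pr m σ 0
    have h3 : Tendsto (fun L : ℕ => (m : ℝ) * (1 / (1 - (σ : ℝ) / L))) atTop
        (𝓝 ((m : ℝ) * (1 / (1 - 0)))) :=
      (tendsto_const_nhds.div (tendsto_const_nhds.sub
        (tendsto_const_div_atTop_nhds_zero_nat _)) (by norm_num)).const_mul _
    have h4 := ih.add (h1.mul h3)
    have e : (σ * m : ℝ) + 1 * ((m : ℝ) * (1 / (1 - 0))) = ((σ + 1 : ℕ) : ℝ) * m := by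
      push_cast; ring
    rw [e] at h4
    refine h4.congr' ?_
    filter_upwards [eventually_ge_atTop (m + σ + 1)] with L hL
    have h0 : (0 : ℝ) < L := by exact_mod_cast (by omega : 0 < L)
    have h5 : (0 : ℝ) < (L.choose m : ℝ) := by exact_mod_cast Nat.choose_pos (by omega)
    have h6 : ((L - (σ + 1)).choose m : ℝ) * ((L : ℝ) - σ) =
        ((L - σ).choose m : ℝ) * ((L : ℝ) - σ - m) := by
      have := Nat.choose_mul_succ_eq (L - (σ + 1)) m
      rw [show L - (σ + 1) + 1 = L - σ by omega] at this
      have h : (((L - (σ + 1)).choose m * (L - σ) : ℕ) : ℝ) =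
        (((L - σ).choose m * (L - σ - m) : ℕ) : ℝ) := by exact_mod_cast this
      push_cast at h
      rw [Nat.cast_sub (by omega : m ≤ L - σ), Nat.cast_sub (by omega : σ ≤ L)] at h
      exact h
    have h7 : (0 : ℝ) < (L : ℝ) - σ := by
      have : ((m + σ + 1 : ℕ) : ℝ) ≤ L := by exact_mod_cast hL
      push_cast at this
      have : (0 : ℝ) ≤ m := by positivity
      linarith
    have h8 : pr m L (σ + 1) 0 = pr m L σ 0 * (((L : ℝ) - σ - m) / (L - σ)) := by
      simp only [pr, Nat.zero_le, if_true, Nat.sub_zero]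
      field_simp
      linarith
    have h9 : 1 - (σ : ℝ) / L = (L - σ) / L := by field_simp
    rw [h8, h9]
    field_simp
    ring

/-- Pairs `(n, L)` with `n → ∞` and `L / n → ℓ`. -/
noncomputable def ratioFilter (l : ℝ) : Filter (ℕ × ℕ) :=
  comap Prod.fst atTop ⊓ comap (fun p => (p.2 : ℝ) / p.1) (𝓝 l)

theorem tendsto_fst_ratio (l : ℝ) : Tendsto (fun p : ℕ × ℕ => (p.1 : ℝ)) (ratioFilter l) atTop :=
  (tendsto_natCast_atTop_atTop.comp tendsto_comap).mono_left inf_le_left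

theorem tendsto_ratio (l : ℝ) :
    Tendsto (fun p : ℕ × ℕ => (p.2 : ℝ) / p.1) (ratioFilter l) (𝓝 l) :=
  tendsto_comap.mono_left inf_le_right

theorem tendsto_snd_ratio {l : ℝ} (hl : 0 < l) :
    Tendsto (fun p : ℕ × ℕ => p.2) (ratioFilter l) atTop := by
  rw [← tendsto_natCast_atTop_iff (R := ℝ)]
  have h := (tendsto_ratio l).pos_mul_atTop hl (tendsto_fst_ratio l)
  refine h.congr' ?_
  filter_upwards [(tendsto_fst_ratio l).eventually_gt_atTop 0] with p hp
  field_simp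

theorem tendsto_ratio_inv {l : ℝ} (hl : 0 < l) (j : ℕ) {u : ℕ → ℝ} {c : ℝ}
    (hu : Tendsto (fun L : ℕ => (L : ℝ) ^ j * u L) atTop (𝓝 c)) :
    Tendsto (fun p : ℕ × ℕ => (p.1 : ℝ) ^ j * u p.2) (ratioFilter l) (𝓝 (c / l ^ j)) := by
  have h1 := (hu.comp (tendsto_snd_ratio hl)).div ((tendsto_ratio l).pow j) (by positivity)
  refine h1.congr' ?_
  filter_upwards [(tendsto_fst_ratio l).eventually_gt_atTop 0,
    (tendsto_snd_ratio hl).eventually_gt_atTop 0] with p hp hp2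
  have : (0 : ℝ) < p.2 := by exact_mod_cast hp2
  simp only [Function.comp, Pi.div_apply, div_pow]
  field_simp

theorem bounded_ratio (j m : ℕ) {u : ℕ → ℝ} {c : ℝ}
    (hu : Tendsto (fun L : ℕ => (L : ℝ) ^ j * u L) atTop (𝓝 c)) :
    ∃ C, ∀ n L : ℕ, n ≤ (m + 1) * L → |(n : ℝ) ^ j * u L| ≤ C := by
  obtain ⟨C, hC⟩ := (Metric.isBounded_range_of_tendsto _ hu).exists_norm_le
  refine ⟨(m + 1 : ℝ) ^ j * C, fun n L h => ?_⟩
  have h1 := hC _ (Set.mem_range_self L)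
  rw [Real.norm_eq_abs, abs_mul] at h1
  rw [abs_mul, abs_of_nonneg (by positivity : (0 : ℝ) ≤ (n : ℝ) ^ j)]
  rw [abs_of_nonneg (by positivity : (0 : ℝ) ≤ (L : ℝ) ^ j)] at h1
  have h2 : (n : ℝ) ≤ (m + 1) * L := by exact_mod_cast h
  calc (n : ℝ) ^ j * |u L| ≤ ((m + 1) * L : ℝ) ^ j * |u L| := by gcongr
    _ = (m + 1 : ℝ) ^ j * ((L : ℝ) ^ j * |u L|) := by rw [mul_pow]; ring
    _ ≤ _ := by gcongr

theorem pr_nonneg (m L σ j : ℕ) : 0 ≤ pr m L σ j := by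
  unfold pr; split_ifs <;> positivity

/-! ### Recursive inequalities -/

theorem tendsto_sum_inv_add (n0 : ℕ) :
    Tendsto (fun k : ℕ => ∑ i ∈ Finset.range k, 1 / ((n0 + i + 1 : ℕ) : ℝ)) atTop atTop := by
  have h := (tendsto_atTop_add_const_right atTop (-∑ i ∈ Finset.range n0, 1 / ((i : ℝ) + 1))
    Real.tendsto_sum_range_one_div_nat_succ_atTop).comp (tendsto_add_atTop_nat n0)
  refine h.congr fun k => ?_
  simp only [Function.comp]
  rw [add_comm k n0, Finset.sum_range_add]
  push_cast
  ring

theorem tendsto_zero_of_contraction {y : ℕ → ℝ} {n0 : ℕ} {b : ℝ} (hn0 : 1 ≤ n0) (hb : 0 < b)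
    (hy : ∀ k, 0 ≤ y k)
    (h : ∀ ε > 0, ∀ᶠ k : ℕ in atTop, y (k + 1) ≤ (1 - b / (n0 + k : ℕ)) * y k + ε / (n0 + k : ℕ)) :
    Tendsto y atTop (𝓝 0) := by
  rw [Metric.tendsto_atTop]
  intro η hη
  obtain ⟨K1, hK1⟩ := eventually_atTop.1 (h (b * (η / 2)) (by positivity))
  obtain ⟨K2, hK2⟩ := exists_nat_gt b
  set K := max K1 K2
  have hz : ∀ i, y (K + i) - η / 2 ≤
      y K * Real.exp (-b * ∑ t ∈ Finset.range i, 1 / ((n0 + K - 1 + t + 1 : ℕ) : ℝ)) := by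
    intro i
    induction i with
    | zero => simp; positivity
    | succ i ih =>
      have h1 := hK1 (K + i) (le_trans (le_max_left _ _) (Nat.le_add_right _ _))
      have hn : (n0 + K - 1 + i + 1 : ℕ) = n0 + (K + i) := by omega
      set n : ℝ := ((n0 + (K + i) : ℕ) : ℝ) with hnn
      have hnb : b ≤ n := by
        refine hK2.le.trans ?_
        rw [hnn]
        exact_mod_cast (le_max_right K1 K2).trans (by omega)
      have hnpos : 0 < n := lt_of_lt_of_le hb hnb
      have h2 : y (K + i + 1) - η / 2 ≤ (1 - b / n) * (y (K + i) - η / 2) := by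
        have : b * (η / 2) / n = b / n * (η / 2) := by ring
        rw [this] at h1
        linarith
      have h3 : 0 ≤ 1 - b / n := by
        rw [sub_nonneg, div_le_one hnpos]; exact hnb
      rw [Finset.sum_range_succ, hn, ← hnn, mul_add, Real.exp_add, ← add_assoc]
      refine h2.trans ((mul_le_mul_of_nonneg_left ih h3).trans ?_)
      have h4 : 1 - b / n ≤ Real.exp (-b * (1 / n)) := by
        have := Real.add_one_le_exp (-b * (1 / n))
        have e : -b * (1 / n) = -(b / n) := by ring
        rw [e] at this ⊢
        linarith
      rw [mul_comm, mul_assoc]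
      exact mul_le_mul_of_nonneg_left (mul_le_mul_of_nonneg_left h4 (Real.exp_pos _).le) (hy K)
  have hlim : Tendsto (fun i : ℕ => y K * Real.exp (-b * ∑ t ∈ Finset.range i,
      1 / ((n0 + K - 1 + t + 1 : ℕ) : ℝ))) atTop (𝓝 0) := by
    have h1 := (tendsto_sum_inv_add (n0 + K - 1)).const_mul_atTop_of_neg (neg_lt_zero.2 hb)
    have h2 := (Real.tendsto_exp_atBot.comp h1).const_mul (y K)
    simpa using h2
  obtain ⟨I, hI⟩ := eventually_atTop.1 (hlim.eventually_lt_const (half_pos hη))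
  refine ⟨K + I, fun k hk => ?_⟩
  have h1 := hz (k - K)
  have h2 := hI (k - K) (by omega)
  rw [show K + (k - K) = k by omega] at h1
  rw [Real.dist_eq, sub_zero, abs_of_nonneg (hy k)]
  linarith

theorem tendsto_of_linear_recursion {x : ℕ → ℝ} {n0 : ℕ} {a c : ℝ} (hn0 : 1 ≤ n0) (ha : 0 < a)
    (hx : ∀ k, 0 ≤ x k)
    (h : ∀ ε > 0, ∀ᶠ k : ℕ in atTop, |x (k + 1) - (1 - a / (n0 + k : ℕ)) * x k - c / (n0 + k : ℕ)| ≤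
      ε * (1 + x k) / (n0 + k : ℕ)) :
    Tendsto x atTop (𝓝 (c / a)) := by
  have key : Tendsto (fun k => |x k - c / a|) atTop (𝓝 0) := by
    refine tendsto_zero_of_contraction hn0 (half_pos ha) (fun k => abs_nonneg _) ?_
    intro ε hε
    set ε' := min (a / 2) (ε / (1 + |c / a|)) with hε'
    have hpos : 0 < ε' := lt_min (half_pos ha) (by positivity)
    obtain ⟨K2, hK2⟩ := exists_nat_gt a
    filter_upwards [h ε' hpos, eventually_ge_atTop K2] with k hk hkK
    set n : ℝ := ((n0 + k : ℕ) : ℝ) with hn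
    have han : a ≤ n := by
      refine hK2.le.trans ?_
      rw [hn]; exact_mod_cast (by omega)
    have hnpos : 0 < n := ha.trans_le han
    have e1 : x (k + 1) - c / a = (x (k + 1) - (1 - a / n) * x k - c / n) +
        (1 - a / n) * (x k - c / a) := by
      field_simp
      ring
    have h3 : 0 ≤ 1 - a / n := by
      rw [sub_nonneg, div_le_one hnpos]; exact han
    have hxk : x k ≤ |x k - c / a| + |c / a| := by
      have := abs_add_le (x k - c / a) (c / a)
      rw [sub_add_cancel, abs_of_nonneg (hx k)] at this
      exact this
    have h4 : ε' * (1 + |c / a|) ≤ ε := by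
      have : ε' ≤ ε / (1 + |c / a|) := min_le_right _ _
      rwa [le_div_iff₀ (by positivity)] at this
    have h5 : ε' ≤ a / 2 := min_le_left _ _
    calc |x (k + 1) - c / a| ≤ ε' * (1 + x k) / n + (1 - a / n) * |x k - c / a| := by
          rw [e1]
          refine (abs_add_le _ _).trans ?_
          rw [abs_mul, abs_of_nonneg h3]
          gcongr
      _ ≤ (ε' * |x k - c / a| + ε' * (1 + |c / a|)) / n + (1 - a / n) * |x k - c / a| := by
          gcongr
          rw [← mul_add]
          exact mul_le_mul_of_nonneg_left (by linarith) hpos.le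
      _ ≤ (a / 2 * |x k - c / a| + ε) / n + (1 - a / n) * |x k - c / a| := by
          gcongr
      _ = (1 - a / 2 / n) * |x k - c / a| + ε / n := by
          field_simp
          ring
  have := (tendsto_zero_iff_abs_tendsto_zero _).2 key
  have h2 := this.add_const (c / a)
  simpa using h2

end UA

namespace UA

open Classical in
/-- Real-valued indicator of a proposition. -/
noncomputable def ind (p : Prop) : ℝ := if p then 1 else 0

theorem ind_nonneg (p : Prop) : 0 ≤ ind p := by unfold ind; split_ifs <;> norm_num

theorem ind_le_one (p : Prop) : ind p ≤ 1 := by unfold ind; split_ifs <;> norm_num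

theorem ind_of {p : Prop} (h : p) : ind p = 1 := by simp [ind, h]

theorem ind_of_not {p : Prop} (h : ¬ p) : ind p = 0 := by simp [ind, h]

theorem ind_mono {p q : Prop} (h : p → q) : ind p ≤ ind q := by
  by_cases hp : p
  · rw [ind_of hp, ind_of (h hp)]
  · rw [ind_of_not hp]; exact ind_nonneg q

theorem ind_or_le (p q : Prop) : ind (p ∨ q) ≤ ind p + ind q := by
  by_cases hp : p
  · rw [ind_of hp]; linarith [ind_nonneg q, ind_le_one (p ∨ q)]
  · rw [ind_of_not hp]; simp [hp]

/-- The event `B` has exponentially small probability along the chain started at `(n0, g0)`. -/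
def ExpSmall (m d n0 : ℕ) (g0 : SimpleGraph ℕ) (B : ℕ → SimpleGraph ℕ → Prop) : Prop :=
  ∃ C γ : ℝ, 0 < γ ∧ ∀ k : ℕ, iter m d n0 k (fun g => ind (B (n0 + k) g)) g0 ≤
    C * Real.exp (-γ * k)

variable {m d n0 : ℕ} {g0 : SimpleGraph ℕ}

theorem ExpSmall.of_eventually (hd : 2 * m < d) (hg : Good m d n0 g0)
    {B : ℕ → SimpleGraph ℕ → Prop} {C γ : ℝ} (hγ : 0 < γ)
    (h : ∀ᶠ k : ℕ in atTop, iter m d n0 k (fun g => ind (B (n0 + k) g)) g0 ≤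
      C * Real.exp (-γ * k)) : ExpSmall m d n0 g0 B := by
  obtain ⟨K, hK⟩ := eventually_atTop.1 h
  refine ⟨|C| + Real.exp (γ * K), γ, hγ, fun k => ?_⟩
  have hp := Real.exp_pos (-γ * k)
  have hp' := Real.exp_pos (γ * K)
  rcases le_or_gt K k with hk | hk
  · refine (hK k hk).trans ?_
    gcongr
    linarith [le_abs_self C]
  · have h1 : iter m d n0 k (fun g => ind (B (n0 + k) g)) g0 ≤ 1 := by
      rw [← iter_const hd hg k 1]
      exact iter_mono hd hg fun _ _ => ind_le_one _
    refine h1.trans ?_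
    have h2 : 1 ≤ Real.exp (γ * K) * Real.exp (-γ * k) := by
      rw [← Real.exp_add, Real.one_le_exp_iff]
      have : (k : ℝ) ≤ K := by exact_mod_cast hk.le
      nlinarith
    have := mul_nonneg (abs_nonneg C) hp.le
    linarith

theorem ExpSmall.mono (hd : 2 * m < d) (hg : Good m d n0 g0)
    {B B' : ℕ → SimpleGraph ℕ → Prop} (h : ExpSmall m d n0 g0 B)
    (hB : ∀ᶠ n : ℕ in atTop, ∀ g, Good m d n g → B' n g → B n g) : ExpSmall m d n0 g0 B' := by
  obtain ⟨C, γ, hγ, hC⟩ := h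
  refine ExpSmall.of_eventually hd hg hγ (C := C) ?_
  have hB' := (tendsto_add_atTop_nat n0).eventually hB
  filter_upwards [hB'] with k hk
  rw [add_comm k n0] at hk
  exact (iter_mono hd hg fun g hg' => ind_mono (hk g hg')).trans (hC k)

theorem ExpSmall.or (hd : 2 * m < d) (hg : Good m d n0 g0)
    {B B' : ℕ → SimpleGraph ℕ → Prop} (h : ExpSmall m d n0 g0 B) (h' : ExpSmall m d n0 g0 B') :
    ExpSmall m d n0 g0 (fun n g => B n g ∨ B' n g) := by
  obtain ⟨C, γ, hγ, hC⟩ := h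
  obtain ⟨C', γ', hγ', hC'⟩ := h'
  have hC0 : 0 ≤ C := by
    have := (iter_nonneg hd hg fun g' _ => ind_nonneg _).trans (hC 0)
    simpa using this
  have hC0' : 0 ≤ C' := by
    have := (iter_nonneg hd hg fun g' _ => ind_nonneg _).trans (hC' 0)
    simpa using this
  refine ⟨C + C', min γ γ', lt_min hγ hγ', fun k => ?_⟩
  refine (iter_mono hd hg fun g _ => ind_or_le _ _).trans ?_
  rw [iter_add, add_mul]
  refine add_le_add ((hC k).trans ?_) ((hC' k).trans ?_)
  · gcongr; exact min_le_left _ _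
  · gcongr; exact min_le_right _ _

theorem expSmall_false (hd : 2 * m < d) (hg : Good m d n0 g0)
    {B : ℕ → SimpleGraph ℕ → Prop} (h : ∀ n g, Good m d n g → ¬ B n g) :
    ExpSmall m d n0 g0 B := by
  refine ⟨0, 1, one_pos, fun k => ?_⟩
  rw [zero_mul, ← iter_const hd hg k 0]
  exact iter_mono hd hg fun g hg' => (ind_of_not (h _ g hg')).le

/-- Superpolynomial smallness. -/
theorem ExpSmall.tendsto (hd : 2 * m < d) (hg : Good m d n0 g0)
    {B : ℕ → SimpleGraph ℕ → Prop} (h : ExpSmall m d n0 g0 B) (s : ℕ) :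
    Tendsto (fun k : ℕ => ((n0 + k : ℕ) : ℝ) ^ s *
      iter m d n0 k (fun g => ind (B (n0 + k) g)) g0) atTop (𝓝 0) := by
  obtain ⟨C, γ, hγ, hC⟩ := h
  have h1 : Tendsto (fun x : ℝ => C * Real.exp (γ * n0) * (x ^ s * Real.exp (-γ * x))) atTop
      (𝓝 (C * Real.exp (γ * n0) * 0)) := by
    refine Tendsto.const_mul _ ?_
    have := Real.tendsto_pow_mul_exp_neg_atTop_nhds_zero s
    have h2 := (this.comp (tendsto_id.const_mul_atTop hγ)).const_mul ((γ ^ s)⁻¹)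
    rw [mul_zero] at h2
    refine h2.congr fun x => ?_
    simp only [Function.comp, id, mul_pow, neg_mul]
    field_simp
  rw [mul_zero] at h1
  have h2 := h1.comp (tendsto_natCast_atTop_atTop.comp (tendsto_add_atTop_nat n0))
  refine squeeze_zero (fun k => mul_nonneg (by positivity)
    (iter_nonneg hd hg fun _ _ => ind_nonneg _)) (fun k => ?_) h2
  refine (mul_le_mul_of_nonneg_left (hC k) (by positivity)).trans (le_of_eq ?_)
  simp only [Function.comp]
  have : Real.exp (-γ * k) = Real.exp (γ * n0) * Real.exp (-γ * ((k + n0 : ℕ) : ℝ)) := by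
    rw [← Real.exp_add]; congr 1; push_cast; ring
  rw [this, add_comm n0 k]
  ring

theorem bounded_of_affine {w : ℕ → ℝ} {r A : ℝ} (hr : 0 < r) (hr1 : r ≤ 1) {K : ℕ}
    (h : ∀ k ≥ K, w (k + 1) ≤ (1 - r) * w k + A) (k : ℕ) (hk : K ≤ k) :
    w k ≤ max (w K) (A / r) := by
  induction k, hk using Nat.le_induction with
  | base => exact le_max_left _ _
  | succ k hk ih =>
    refine (h k hk).trans ?_
    have h1 : A / r ≤ max (w K) (A / r) := le_max_right _ _
    rw [div_le_iff₀ hr] at h1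
    nlinarith

theorem step_exp_bound (hd : 2 * m < d) {n : ℕ} {g : SimpleGraph ℕ} (hg : Good m d n g)
    {Y : SimpleGraph ℕ → ℝ} {y C δ t : ℝ} (hC : 0 < C) (ht : 0 < t) (htC : t * C ≤ 1)
    (htδ : t * C ^ 2 ≤ δ / 2) (hCy : C ≤ y)
    (hbd : ∀ S ⊆ lowDegSet d g n, S.card = m → |Y (attachStep g (n + 1) S) - y| ≤ C)
    (hdr : step m d n Y g ≤ y - δ) :
    step m d n (fun g' => Real.exp (t * max (Y g') 0)) g ≤
      (1 - t * δ / 2) * Real.exp (t * max y 0) := by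
  have h1 : ∀ S ⊆ lowDegSet d g n, S.card = m →
      Real.exp (t * max (Y (attachStep g (n + 1) S)) 0) ≤
        (Real.exp (t * y) * (1 - t * y + t ^ 2 * C ^ 2)) +
          (Real.exp (t * y) * t) * Y (attachStep g (n + 1) S) := by
    intro S h1 h2
    have hb := hbd S h1 h2
    set z := Y (attachStep g (n + 1) S)
    have hz : 0 ≤ z := by have := (abs_le.1 hb).1; linarith
    rw [max_eq_left hz]
    have hx : |t * (z - y)| ≤ t * C := by
      rw [abs_mul, abs_of_pos ht]; gcongr
    have h3 := (abs_le.1 (Real.abs_exp_sub_one_sub_id_le (hx.trans htC))).2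
    have h4 : (t * (z - y)) ^ 2 ≤ t ^ 2 * C ^ 2 := by
      rw [← mul_pow, ← sq_abs]; gcongr
    have h5 : Real.exp (t * z) = Real.exp (t * y) * Real.exp (t * (z - y)) := by
      rw [← Real.exp_add]; congr 1; ring
    rw [h5]
    calc Real.exp (t * y) * Real.exp (t * (z - y))
        ≤ Real.exp (t * y) * (1 + t * (z - y) + t ^ 2 * C ^ 2) := by
          gcongr; linarith
      _ = _ := by ring
  refine (step_mono hg hd (f' := fun g' => (Real.exp (t * y) * (1 - t * y + t ^ 2 * C ^ 2)) +
    (Real.exp (t * y) * t) * Y g') h1).trans ?_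
  rw [step_add, step_const hg hd, step_mul, max_eq_left (hC.le.trans hCy)]
  have h6 := mul_le_mul_of_nonneg_left hdr (mul_pos (Real.exp_pos (t * y)) ht).le
  have h7 : t ^ 2 * C ^ 2 ≤ t * δ / 2 := by nlinarith
  have h8 := mul_le_mul_of_nonneg_left h7 (Real.exp_pos (t * y)).le
  nlinarith

/-- Drift lemma with exponential tails. -/
theorem expSmall_of_drift (hd : 2 * m < d) (hg : Good m d n0 g0)
    {Y : ℕ → SimpleGraph ℕ → ℝ} {B : ℕ → SimpleGraph ℕ → Prop} {C δ : ℝ} (hC : 0 < C) (hδ : 0 < δ)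
    (hB : ExpSmall m d n0 g0 B)
    (hup : ∀ n g, Good m d n g → Y n g ≤ C * n)
    (hbd : ∀ n g S, Good m d n g → S ⊆ lowDegSet d g n → S.card = m →
      |Y (n + 1) (attachStep g (n + 1) S) - Y n g| ≤ C)
    (hdr : ∀ᶠ n in atTop, ∀ g, Good m d n g → 0 < Y n g → ¬ B n g →
      step m d n (Y (n + 1)) g ≤ Y n g - δ) {ε : ℝ} (hε : 0 < ε) :
    ExpSmall m d n0 g0 (fun n g => ε * n ≤ Y n g) := by
  obtain ⟨C', γ, hγ, hC'⟩ := hB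
  have hC0 : 0 ≤ C' := by
    have := (iter_nonneg hd hg fun g' _ => ind_nonneg _).trans (hC' 0)
    simpa using this
  obtain ⟨K, hK⟩ := eventually_atTop.1 hdr
  obtain ⟨t, ht, htC, htδ, htγ, ht1⟩ : ∃ t : ℝ, 0 < t ∧ t * C ≤ 1 ∧ t * C ^ 2 ≤ δ / 2 ∧
      t * C ≤ γ ∧ t * δ / 2 ≤ 1 := by
    refine ⟨min (min (1 / C) (δ / 2 / C ^ 2)) (min (γ / C) (1 / δ)), by positivity, ?_, ?_, ?_, ?_⟩
    · rw [← le_div_iff₀ hC]; exact (min_le_left _ _).trans (min_le_left _ _)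
    · rw [← le_div_iff₀ (by positivity)]; exact (min_le_left _ _).trans (min_le_right _ _)
    · rw [← le_div_iff₀ hC]; exact (min_le_right _ _).trans (min_le_left _ _)
    · have : min (min (1 / C) (δ / 2 / C ^ 2)) (min (γ / C) (1 / δ)) * δ ≤ 1 := by
        rw [← le_div_iff₀ hδ]; exact (min_le_right _ _).trans (min_le_right _ _)
      linarith
  set r := t * δ / 2 with hr
  have hrpos : 0 < r := by positivity
  set W : ℕ → ℝ := fun k => iter m d n0 k (fun g => Real.exp (t * max (Y (n0 + k) g) 0)) g0
  set A : ℝ := Real.exp 2 + C' * Real.exp (t * C * (n0 + 1)) with hA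
  have hrec : ∀ k ≥ K, W (k + 1) ≤ (1 - r) * W k + A := by
    intro k hk
    have hpt : ∀ g, Good m d (n0 + k) g →
        step m d (n0 + k) (fun g => Real.exp (t * max (Y (n0 + (k + 1)) g) 0)) g ≤
          (1 - r) * Real.exp (t * max (Y (n0 + k) g) 0) + (Real.exp 2 +
            Real.exp (t * C * (n0 + k + 1)) * ind (B (n0 + k) g)) := by
      intro g hg'
      have hF := Real.exp_pos (t * max (Y (n0 + k) g) 0)
      have hnn : 0 ≤ (1 - r) * Real.exp (t * max (Y (n0 + k) g) 0) :=
        mul_nonneg (by linarith) hF.le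
      have hnn2 : 0 ≤ Real.exp (t * C * (n0 + k + 1)) * ind (B (n0 + k) g) :=
        mul_nonneg (Real.exp_pos _).le (ind_nonneg _)
      by_cases hb : B (n0 + k) g
      · rw [ind_of hb, mul_one]
        have : step m d (n0 + k) (fun g => Real.exp (t * max (Y (n0 + (k + 1)) g) 0)) g ≤
            step m d (n0 + k) (fun _ => Real.exp (t * C * (n0 + k + 1))) g := by
          refine step_mono hg' hd fun S h1 h2 => ?_
          rw [Real.exp_le_exp, mul_assoc]
          refine mul_le_mul_of_nonneg_left (max_le ?_ (by positivity)) ht.le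
          have := hup _ _ (hg'.attach (by omega) h1 h2)
          push_cast at this
          exact this
        rw [step_const hg' hd] at this
        have := Real.exp_pos 2
        linarith
      · rcases le_or_gt C (Y (n0 + k) g) with hy | hy
        · have := step_exp_bound hd hg' hC ht htC htδ hy (fun S h1 h2 => hbd _ _ S hg' h1 h2)
            (hK (n0 + k) (by omega) g hg' (hC.trans_le hy) hb)
          have h2 := Real.exp_pos 2
          refine this.trans ?_
          rw [← hr]
          linarith
        · have : step m d (n0 + k) (fun g => Real.exp (t * max (Y (n0 + (k + 1)) g) 0)) g ≤
            step m d (n0 + k) (fun _ => Real.exp 2) g := by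
            refine step_mono hg' hd fun S h1 h2 => ?_
            rw [Real.exp_le_exp]
            have h3 := (abs_le.1 (hbd _ _ S hg' h1 h2)).2
            have : max (Y (n0 + (k + 1)) (attachStep g (n0 + k + 1) S)) 0 ≤ 2 * C := by
              refine max_le ?_ (by positivity)
              rw [← add_assoc]
              linarith
            nlinarith
          rw [step_const hg' hd] at this
          linarith
    refine (iter_mono hd hg hpt).trans ?_
    rw [iter_add, iter_mul, iter_add, iter_const hd hg, iter_mul, hA]
    have h5 : Real.exp (t * C * (n0 + k + 1)) * iter m d n0 k (fun g => ind (B (n0 + k) g)) g0 ≤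
        C' * Real.exp (t * C * (n0 + 1)) := by
      refine (mul_le_mul_of_nonneg_left (hC' k) (Real.exp_pos _).le).trans ?_
      rw [mul_left_comm, ← Real.exp_add]
      gcongr
      have : (0 : ℝ) ≤ k := by positivity
      nlinarith
    linarith
  have hW := bounded_of_affine hrpos ht1 hrec
  refine ExpSmall.of_eventually hd hg (γ := t * ε) (C := max (W K) (A / r)) (by positivity) ?_
  filter_upwards [eventually_ge_atTop K] with k hk
  have h1 : ∀ g, Good m d (n0 + k) g → ind (ε * (n0 + k : ℕ) ≤ Y (n0 + k) g) ≤
      Real.exp (-(t * ε) * k) * Real.exp (t * max (Y (n0 + k) g) 0) := by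
    intro g _
    by_cases h : ε * (n0 + k : ℕ) ≤ Y (n0 + k) g
    · rw [ind_of h, ← Real.exp_add, Real.one_le_exp_iff]
      have h2 : ε * k ≤ max (Y (n0 + k) g) 0 := by
        refine le_trans ?_ (h.trans (le_max_left _ _))
        gcongr; omega
      nlinarith
    · rw [ind_of_not h]; positivity
  refine (iter_mono hd hg h1).trans ?_
  rw [iter_mul, mul_comm]
  gcongr
  exact hW k hk

end UA

namespace UA

theorem card_powersetCard_mem {α : Type*} [DecidableEq α] (L : Finset α) {m : ℕ} (hm : 1 ≤ m)
    {a : α} (ha : a ∈ L) :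
    ((L.powersetCard m).filter (a ∈ ·)).card = (L.card - 1).choose (m - 1) := by
  rw [← Finset.card_erase_of_mem ha, ← Finset.card_powersetCard]
  refine Finset.card_bij' (fun S _ => S.erase a) (fun T _ => insert a T) ?_ ?_ ?_ ?_
  · intro S hS
    simp only [Finset.mem_filter, Finset.mem_powersetCard] at hS ⊢
    exact ⟨Finset.erase_subset_erase _ hS.1.1, by rw [Finset.card_erase_of_mem hS.2, hS.1.2]⟩
  · intro T hT
    simp only [Finset.mem_filter, Finset.mem_powersetCard] at hT ⊢
    have : a ∉ T := fun h => by simpa using hT.1 h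
    refine ⟨⟨Finset.insert_subset ha (hT.1.trans (Finset.erase_subset _ _)), ?_⟩, by simp⟩
    rw [Finset.card_insert_of_notMem this, hT.2]; omega
  · intro S hS
    simp only [Finset.mem_filter] at hS
    exact Finset.insert_erase hS.2
  · intro T hT
    simp only [Finset.mem_powersetCard] at hT
    exact Finset.erase_insert fun h => by simpa using hT.1 h

theorem sum_card_filter {α : Type*} [DecidableEq α] (L : Finset α) {m : ℕ} (hm : 1 ≤ m)
    (hL : m ≤ L.card) (p : α → Prop) [DecidablePred p] :
    (∑ S ∈ L.powersetCard m, ((S.filter p).card : ℝ)) / (L.card.choose m : ℝ) =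
      m / L.card * (L.filter p).card := by
  have h1 : (∑ S ∈ L.powersetCard m, (S.filter p).card) =
      (L.filter p).card * (L.card - 1).choose (m - 1) := by
    have : ∀ S ∈ L.powersetCard m, (S.filter p).card =
        ∑ a ∈ L.filter p, if a ∈ S then 1 else 0 := by
      intro S hS
      rw [Finset.mem_powersetCard] at hS
      rw [← Finset.card_filter]
      congr 1
      ext a
      simp only [Finset.mem_filter]
      exact ⟨fun h => ⟨⟨hS.1 h.1, h.2⟩, h.1⟩, fun h => ⟨h.2, h.1.2⟩⟩
    rw [Finset.sum_congr rfl this, Finset.sum_comm, Finset.card_eq_sum_ones, Finset.sum_mul]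
    refine Finset.sum_congr rfl fun a ha => ?_
    rw [← Finset.card_filter, card_powersetCard_mem L hm (Finset.mem_of_mem_filter a ha), one_mul]
  have h2 : (L.card : ℝ) * ((L.card - 1).choose (m - 1) : ℝ) = (L.card.choose m : ℝ) * m := by
    have := Nat.add_one_mul_choose_eq (L.card - 1) (m - 1)
    rw [Nat.sub_add_cancel hm, Nat.sub_add_cancel (hm.trans hL)] at this
    exact_mod_cast this
  have h3 : (0 : ℝ) < (L.card.choose m : ℝ) := by exact_mod_cast Nat.choose_pos hL
  have h4 : (0 : ℝ) < L.card := by exact_mod_cast (by omega : 0 < L.card)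
  rw [← Nat.cast_sum, h1, div_eq_iff h3.ne']
  push_cast
  field_simp
  linear_combination ((L.filter p).card : ℝ) * h2

/-- The number of vertices of degree at least `j`. -/
noncomputable def geDeg (g : SimpleGraph ℕ) (n j : ℕ) : ℕ :=
  ((Finset.Icc 1 n).filter (j ≤ graphDeg g ·)).card

variable {m d n n0 j : ℕ} {g g0 : SimpleGraph ℕ}

theorem geDeg_attach (hg : Good m d n g) (hj : m ≤ j) {S : Finset ℕ}
    (hS : S ⊆ Finset.Icc 1 n) (hc : S.card = m) :
    geDeg (attachStep g (n + 1) S) (n + 1) (j + 1) =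
      geDeg g n (j + 1) + (S.filter (graphDeg g · = j)).card := by
  rw [geDeg, geDeg, ← Finset.card_union_of_disjoint]
  · congr 1
    ext v
    simp only [Finset.mem_filter, Finset.mem_union]
    by_cases hv : v = n + 1
    · subst hv
      rw [deg_attach_new hg hS, hc]
      have : n + 1 ∉ S := fun h => by simpa using hS h
      simp [this]; omega
    · rw [deg_attach_old hg hv]
      have : v ∈ Finset.Icc 1 (n + 1) ↔ v ∈ Finset.Icc 1 n := by simp; omega
      rw [this]
      by_cases hvS : v ∈ S
      · simp only [hS hvS, hvS, if_true, true_and]; omega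
      · simp only [hvS, if_false, false_and, or_false, add_zero]
  · rw [Finset.disjoint_left]
    intro v h1 h2
    simp only [Finset.mem_filter] at h1 h2
    omega

theorem geDeg_succ (g : SimpleGraph ℕ) (n : ℕ) (hj : j < d) :
    geDeg g n j = geDeg g n (j + 1) + ((lowDegSet d g n).filter (graphDeg g · = j)).card := by
  rw [geDeg, geDeg, ← Finset.card_union_of_disjoint]
  · congr 1
    ext v
    simp only [Finset.mem_filter, Finset.mem_union, mem_lowDegSet]
    constructor
    · rintro ⟨h1, h2⟩
      rcases Nat.lt_or_ge j (graphDeg g v) with h | h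
      · exact Or.inl ⟨h1, h⟩
      · exact Or.inr ⟨⟨h1, by omega⟩, by omega⟩
    · rintro (⟨h1, h2⟩ | ⟨⟨h1, -⟩, h2⟩)
      · exact ⟨h1, by omega⟩
      · exact ⟨h1, by omega⟩
  · rw [Finset.disjoint_left]
    intro v h1 h2
    simp only [Finset.mem_filter] at h1 h2
    omega

theorem step_geDeg (hg : Good m d n g) (hm : 1 ≤ m) (hd : 2 * m < d) (hj : m ≤ j) (hjd : j < d) :
    step m d n (fun g' => (geDeg g' (n + 1) (j + 1) : ℝ)) g =
      geDeg g n (j + 1) + m / (lowDegSet d g n).card * (geDeg g n j - geDeg g n (j + 1)) := by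
  have h2 := sum_card_filter (lowDegSet d g n) hm (hg.m_le_card_low hd) (graphDeg g · = j)
  have h3 : (((lowDegSet d g n).filter (graphDeg g · = j)).card : ℝ) =
      geDeg g n j - geDeg g n (j + 1) := by
    rw [geDeg_succ g n hjd]; push_cast; ring
  rw [h3] at h2
  rw [← h2, step]
  have h4 : ∀ S ∈ (lowDegSet d g n).powersetCard m,
      (geDeg (attachStep g (n + 1) S) (n + 1) (j + 1) : ℝ) =
        geDeg g n (j + 1) + (S.filter (graphDeg g · = j)).card := fun S hS => by
    rw [Finset.mem_powersetCard] at hS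
    rw [geDeg_attach hg hj (hS.1.trans (lowDegSet_subset d g n)) hS.2]
    push_cast; rfl
  rw [Finset.sum_congr rfl h4, Finset.sum_add_distrib, add_div]
  congr 1
  have := hg.choose_pos hd
  simp only [Finset.sum_const, Finset.card_powersetCard, nsmul_eq_mul]
  field_simp

theorem geDeg_le (g : SimpleGraph ℕ) (n j : ℕ) : geDeg g n j ≤ n := by
  simpa [geDeg] using Finset.card_filter_le (Finset.Icc 1 n) (j ≤ graphDeg g ·)

theorem geDeg_m (hg : Good m d n g) : geDeg g n m = n := by
  rw [geDeg, Finset.filter_true_of_mem fun v hv => hg.le_deg v hv]; simp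

theorem geDeg_d (d : ℕ) (g : SimpleGraph ℕ) (n : ℕ) :
    geDeg g n d + (lowDegSet d g n).card = n := by
  have := Finset.card_filter_add_card_filter_not (s := Finset.Icc 1 n) (d ≤ graphDeg g ·)
  simpa [geDeg, lowDegSet] using this

theorem geDeg_attach_sub_le (hg : Good m d n g) (hj : m ≤ j) {S : Finset ℕ}
    (hS : S ⊆ lowDegSet d g n) (hc : S.card = m) :
    |(geDeg (attachStep g (n + 1) S) (n + 1) (j + 1) : ℝ) - geDeg g n (j + 1)| ≤ m := by
  rw [geDeg_attach hg hj (hS.trans (lowDegSet_subset d g n)) hc]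
  push_cast
  rw [add_sub_cancel_left, abs_of_nonneg (by positivity)]
  rw [← hc]
  exact_mod_cast Finset.card_filter_le _ _

/-- `L ≤ (x + ε) n` up to exponentially small probability. -/
def UpperLow (m d n0 : ℕ) (g0 : SimpleGraph ℕ) (x : ℝ) : Prop :=
  ∀ ε > 0, ExpSmall m d n0 g0 (fun n g => (x + ε) * n < (lowDegSet d g n).card)

/-- `L ≥ (x - ε) n` up to exponentially small probability. -/
def LowerLow (m d n0 : ℕ) (g0 : SimpleGraph ℕ) (x : ℝ) : Prop :=
  ∀ ε > 0, ExpSmall m d n0 g0 (fun n g => ((lowDegSet d g n).card : ℝ) < (x - ε) * n)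

theorem Good.card_low_pos (hg : Good m d n g) (hm : 1 ≤ m) (hd : 2 * m < d) :
    (0 : ℝ) < (lowDegSet d g n).card := by
  exact_mod_cast lt_of_lt_of_le (by omega) (hg.m_le_card_low hd)

theorem geDeg_lower_step (hm : 1 ≤ m) (hd : 2 * m < d) (hg : Good m d n0 g0) {x a : ℝ}
    (hx : 0 < x) (ha : 0 ≤ a) (ha1 : a ≤ 1) (hU : UpperLow m d n0 g0 x) (hj : m ≤ j) (hjd : j < d)
    (hA : ∀ ε > 0, ExpSmall m d n0 g0 (fun n g => (geDeg g n j : ℝ) < (a - ε) * n)) :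
    ∀ ε > 0, ExpSmall m d n0 g0
      (fun n g => (geDeg g n (j + 1) : ℝ) < (m / (m + x) * a - ε) * n) := by
  intro ε₀ hε₀
  set ε := ε₀ / 2 with hεd
  have hε : 0 < ε := half_pos hε₀
  have hm' : (1 : ℝ) ≤ m := by exact_mod_cast hm
  set q := (m : ℝ) / (m + x) with hq
  have hq0 : 0 ≤ q := by positivity
  have hq1 : q ≤ 1 := by rw [hq, div_le_one (by positivity)]; linarith
  have hqx : m * a * (1 - q) = x * (q * a) := by rw [hq]; field_simp; ring
  have hqa : q * a ≤ a := by nlinarith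
  set ε' := m * ε / (m + a) with hε'
  have hε'0 : 0 < ε' := by positivity
  have hε'1 : m * (ε - ε') = ε' * a := by rw [hε']; field_simp; ring
  have hε'2 : ε' ≤ ε := by nlinarith [mul_nonneg hε'0.le ha]
  have hbad := (hU ε' hε'0).or hd hg (hA ε' hε'0)
  have key := expSmall_of_drift hd hg (Y := fun n g => (q * a - ε) * n - geDeg g n (j + 1))
    (C := m + 2 + ε) (δ := ε / 2) (by positivity) (half_pos hε) hbad ?_ ?_ ?_ hε
  · refine key.mono hd hg (Eventually.of_forall fun n g _ h => ?_)
    have e : ε₀ = 2 * ε := by rw [hεd]; ring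
    rw [e] at h
    linarith
  · intro n g _
    have h1 : (0 : ℝ) ≤ geDeg g n (j + 1) := by positivity
    have h2 : (0 : ℝ) ≤ n := by positivity
    nlinarith
  · intro n g S hg' hS hc
    have h1 := geDeg_attach_sub_le hg' hj hS hc
    push_cast
    rw [abs_le] at h1 ⊢
    constructor <;> nlinarith [mul_nonneg hq0 ha]
  · refine Eventually.of_forall fun n g hg' hY hb => ?_
    push Not at hb
    rw [step_sub, step_const hg' hd, step_geDeg hg' hm hd hj hjd]
    have hL := hg'.card_low_pos hm hd
    set L := ((lowDegSet d g n).card : ℝ)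
    have hn : (0 : ℝ) < n := by have := hg'.le_n; exact_mod_cast (by omega : 0 < n)
    have h1 : q * a - ε / 2 ≤ m / L * (geDeg g n j - geDeg g n (j + 1)) := by
      have hge : (geDeg g n (j + 1) : ℝ) ≤ geDeg g n j := by
        rw [geDeg_succ g n hjd]; push_cast; linarith [Nat.cast_nonneg (α := ℝ)
          ((lowDegSet d g n).filter (graphDeg g · = j)).card]
      rcases le_or_gt (q * a - ε / 2) 0 with h0 | h0
      · refine h0.trans (mul_nonneg (by positivity) (by linarith))
      · rw [show (m : ℝ) / L * (geDeg g n j - geDeg g n (j + 1)) =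
          m * (geDeg g n j - geDeg g n (j + 1)) / L by ring, le_div_iff₀ hL]
        have h3 : (q * a - ε / 2) * L ≤ (q * a - ε / 2) * ((x + ε') * n) :=
          mul_le_mul_of_nonneg_left hb.1 h0.le
        have h4 : (a - ε' - q * a + ε) * n ≤ geDeg g n j - geDeg g n (j + 1) := by
          nlinarith [hb.2]
        have h5 : (q * a - ε / 2) * (x + ε') ≤ m * (a - ε' - q * a + ε) := by
          nlinarith [mul_nonneg hε.le hx.le, mul_nonneg hε.le hε'0.le,
            mul_nonneg hε'0.le (sub_nonneg.2 hqa)]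
        have h6 := mul_le_mul_of_nonneg_right h5 hn.le
        have h7 := mul_le_mul_of_nonneg_left h4 (by linarith : (0 : ℝ) ≤ m)
        nlinarith
    push_cast
    linarith

theorem geDeg_upper_step (hm : 1 ≤ m) (hd : 2 * m < d) (hg : Good m d n0 g0) {x a : ℝ}
    (hx : 0 < x) (ha : 0 ≤ a) (ha1 : a ≤ 1) (hU : LowerLow m d n0 g0 x) (hj : m ≤ j) (hjd : j < d)
    (hA : ∀ ε > 0, ExpSmall m d n0 g0 (fun n g => (a + ε) * n < (geDeg g n j : ℝ))) :
    ∀ ε > 0, ExpSmall m d n0 g0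
      (fun n g => (m / (m + x) * a + ε) * n < (geDeg g n (j + 1) : ℝ)) := by
  intro ε₀ hε₀
  set ε := ε₀ / 2 with hεd
  have hε : 0 < ε := half_pos hε₀
  have hm' : (1 : ℝ) ≤ m := by exact_mod_cast hm
  set q := (m : ℝ) / (m + x) with hq
  have hq0 : 0 ≤ q := by positivity
  have hq1 : q ≤ 1 := by rw [hq, div_le_one (by positivity)]; linarith
  have hqx : m * a * (1 - q) = x * (q * a) := by rw [hq]; field_simp; ring
  have hqa : q * a ≤ a := by nlinarith
  set ε' := min (m * ε / (m + a)) x with hε'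
  have hε'0 : 0 < ε' := by positivity
  have hε'x : ε' ≤ x := min_le_right _ _
  have hε'1 : ε' * a ≤ m * (ε - ε') := by
    have : ε' ≤ m * ε / (m + a) := min_le_left _ _
    rw [le_div_iff₀ (by positivity)] at this
    linarith
  have hbad := (hU ε' hε'0).or hd hg (hA ε' hε'0)
  have key := expSmall_of_drift hd hg (Y := fun n g => geDeg g n (j + 1) - (q * a + ε) * n)
    (C := m + 2 + ε) (δ := ε / 2) (by positivity) (half_pos hε) hbad ?_ ?_ ?_ hε
  · refine key.mono hd hg (Eventually.of_forall fun n g _ h => ?_)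
    have e : ε₀ = 2 * ε := by rw [hεd]; ring
    rw [e] at h
    linarith
  · intro n g _
    have h1 : (geDeg g n (j + 1) : ℝ) ≤ n := by exact_mod_cast geDeg_le g n (j + 1)
    have h2 : (0 : ℝ) ≤ n := by positivity
    have h3 : 0 ≤ (q * a + ε) * n := by positivity
    nlinarith
  · intro n g S hg' hS hc
    have h1 := geDeg_attach_sub_le hg' hj hS hc
    push_cast
    rw [abs_le] at h1 ⊢
    constructor <;> nlinarith [mul_nonneg hq0 ha]
  · refine Eventually.of_forall fun n g hg' hY hb => ?_
    push Not at hb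
    rw [step_sub, step_const hg' hd, step_geDeg hg' hm hd hj hjd]
    have hL := hg'.card_low_pos hm hd
    set L := ((lowDegSet d g n).card : ℝ)
    have hn : (0 : ℝ) < n := by have := hg'.le_n; exact_mod_cast (by omega : 0 < n)
    have h1 : m / L * (geDeg g n j - geDeg g n (j + 1)) ≤ q * a + ε / 2 := by
      rw [div_mul_eq_mul_div, div_le_iff₀ hL]
      have h0 : 0 ≤ q * a + ε / 2 := by positivity
      have h3 : (q * a + ε / 2) * ((x - ε') * n) ≤ (q * a + ε / 2) * L :=
        mul_le_mul_of_nonneg_left hb.1 h0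
      have h4 : (geDeg g n j - geDeg g n (j + 1) : ℝ) ≤ (a + ε' - q * a - ε) * n := by
        nlinarith [hb.2]
      have h5 : m * (a + ε' - q * a - ε) ≤ (q * a + ε / 2) * (x - ε') := by
        nlinarith [mul_nonneg hε.le (sub_nonneg.2 hε'x),
          mul_nonneg hε'0.le (sub_nonneg.2 hqa)]
      have h6 := mul_le_mul_of_nonneg_right h5 hn.le
      have h7 := mul_le_mul_of_nonneg_left h4 (by linarith : (0 : ℝ) ≤ m)
      nlinarith
    push_cast
    linarith

/-- The map whose fixed point is the limiting density of unsaturated vertices. -/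
noncomputable def densMap (m d : ℕ) (x : ℝ) : ℝ := 1 - ((m : ℝ) / (m + x)) ^ (d - m)

theorem upperLow_densMap (hm : 1 ≤ m) (hd : 2 * m < d) (hg : Good m d n0 g0) {x : ℝ}
    (hx : 0 < x) (hU : UpperLow m d n0 g0 x) : UpperLow m d n0 g0 (densMap m d x) := by
  have hm' : (1 : ℝ) ≤ m := by exact_mod_cast hm
  have hq0 : 0 ≤ (m : ℝ) / (m + x) := by positivity
  have hq1 : (m : ℝ) / (m + x) ≤ 1 := by rw [div_le_one (by positivity)]; linarith
  have h : ∀ i, i ≤ d - m → ∀ ε > 0, ExpSmall m d n0 g0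
      (fun n g => (geDeg g n (m + i) : ℝ) < (((m : ℝ) / (m + x)) ^ i - ε) * n) := by
    intro i
    induction i with
    | zero =>
      intro _ ε hε
      refine expSmall_false hd hg fun n g hg' h => ?_
      rw [add_zero, geDeg_m hg'] at h
      have h2 : (0 : ℝ) ≤ n := by positivity
      nlinarith
    | succ i ih =>
      intro hi ε hε
      have := geDeg_lower_step hm hd hg hx (pow_nonneg hq0 i) (pow_le_one₀ hq0 hq1) hU
        (Nat.le_add_right m i) (by omega) (ih (by omega)) ε hε
      rw [pow_succ']
      exact this
  intro ε hε
  refine (h (d - m) le_rfl ε hε).mono hd hg (Eventually.of_forall fun n g _ hlt => ?_)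
  have e := geDeg_d d g n
  have e' : (geDeg g n d : ℝ) + (lowDegSet d g n).card = n := by exact_mod_cast e
  rw [show m + (d - m) = d by omega]
  rw [densMap] at hlt
  linarith

theorem lowerLow_densMap (hm : 1 ≤ m) (hd : 2 * m < d) (hg : Good m d n0 g0) {x : ℝ}
    (hx : 0 < x) (hU : LowerLow m d n0 g0 x) : LowerLow m d n0 g0 (densMap m d x) := by
  have hm' : (1 : ℝ) ≤ m := by exact_mod_cast hm
  have hq0 : 0 ≤ (m : ℝ) / (m + x) := by positivity
  have hq1 : (m : ℝ) / (m + x) ≤ 1 := by rw [div_le_one (by positivity)]; linarith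
  have h : ∀ i, i ≤ d - m → ∀ ε > 0, ExpSmall m d n0 g0
      (fun n g => (((m : ℝ) / (m + x)) ^ i + ε) * n < (geDeg g n (m + i) : ℝ)) := by
    intro i
    induction i with
    | zero =>
      intro _ ε hε
      refine expSmall_false hd hg fun n g hg' h => ?_
      rw [add_zero, geDeg_m hg'] at h
      have h2 : (0 : ℝ) ≤ n := by positivity
      nlinarith
    | succ i ih =>
      intro hi ε hε
      have := geDeg_upper_step hm hd hg hx (pow_nonneg hq0 i) (pow_le_one₀ hq0 hq1) hU
        (Nat.le_add_right m i) (by omega) (ih (by omega)) ε hε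
      rw [pow_succ']
      exact this
  intro ε hε
  refine (h (d - m) le_rfl ε hε).mono hd hg (Eventually.of_forall fun n g _ hlt => ?_)
  have e := geDeg_d d g n
  have e' : (geDeg g n d : ℝ) + (lowDegSet d g n).card = n := by exact_mod_cast e
  rw [show m + (d - m) = d by omega]
  rw [densMap] at hlt
  linarith

theorem densMap_lt (hm : 1 ≤ m) (hd : 2 * m < d) {x y : ℝ} (hy : 0 < y) (hxy : y < x) :
    densMap m d x * y < densMap m d y * x := by
  have hm' : (1 : ℝ) ≤ m := by exact_mod_cast hm
  have hx : 0 < x := hy.trans hxy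
  have e : ∀ z : ℝ, 0 < z → densMap m d z =
      z * ((∑ i ∈ Finset.range (d - m), ((m : ℝ) / (m + z)) ^ i) / (m + z)) := by
    intro z hz
    have h1 := mul_neg_geom_sum ((m : ℝ) / (m + z)) (d - m)
    rw [densMap, ← h1]
    field_simp
    ring
  rw [e x hx, e y hy]
  have h1 : (∑ i ∈ Finset.range (d - m), ((m : ℝ) / (m + x)) ^ i) ≤
      (∑ i ∈ Finset.range (d - m), ((m : ℝ) / (m + y)) ^ i) := by
    gcongr
  have h2 : 0 < (∑ i ∈ Finset.range (d - m), ((m : ℝ) / (m + y)) ^ i) := by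
    refine Finset.sum_pos (fun i _ => by positivity) ?_
    rw [Finset.nonempty_range_iff]; omega
  have h3 : (∑ i ∈ Finset.range (d - m), ((m : ℝ) / (m + x)) ^ i) / (m + x) <
      (∑ i ∈ Finset.range (d - m), ((m : ℝ) / (m + y)) ^ i) / (m + y) := by
    refine (div_le_div_of_nonneg_right h1 (by positivity)).trans_lt ?_
    gcongr
  have := mul_lt_mul_of_pos_left h3 (mul_pos hx hy)
  linarith

theorem UpperLow.mono (hd : 2 * m < d) (hg : Good m d n0 g0) {x y : ℝ}
    (h : UpperLow m d n0 g0 x) (hxy : x ≤ y) : UpperLow m d n0 g0 y := fun ε hε =>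
  (h ε hε).mono hd hg (Eventually.of_forall fun n g _ hlt => lt_of_le_of_lt (by gcongr) hlt)

theorem LowerLow.mono (hd : 2 * m < d) (hg : Good m d n0 g0) {x y : ℝ}
    (h : LowerLow m d n0 g0 x) (hxy : y ≤ x) : LowerLow m d n0 g0 y := fun ε hε =>
  (h ε hε).mono hd hg (Eventually.of_forall fun n g _ hlt => lt_of_lt_of_le hlt (by gcongr))

/-- Law of large numbers for the number of unsaturated vertices, with exponential tails. -/
theorem exists_density (hm : 1 ≤ m) (hd : 2 * m < d) (hg : Good m d n0 g0) :
    ∃ l : ℝ, 0 < l ∧ UpperLow m d n0 g0 l ∧ LowerLow m d n0 g0 l := by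
  have hm' : (1 : ℝ) ≤ m := by exact_mod_cast hm
  set c0 : ℝ := 1 / (m + 1) with hc0
  have hc0pos : 0 < c0 := by positivity
  have hc01 : c0 ≤ 1 := by rw [hc0, div_le_one (by positivity)]; linarith
  have hU1 : UpperLow m d n0 g0 1 := by
    intro ε hε
    refine expSmall_false hd hg fun n g hg' h => ?_
    have h1 : ((lowDegSet d g n).card : ℝ) ≤ n := by exact_mod_cast card_low_le d g n
    have h2 : (0 : ℝ) ≤ n := by positivity
    nlinarith
  have hL0 : LowerLow m d n0 g0 c0 := by
    intro ε hε
    refine expSmall_false hd hg fun n g hg' h => ?_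
    have h1 := hg'.card_low hd
    have h2 : (n : ℝ) ≤ (m + 1) * (lowDegSet d g n).card := by
      exact_mod_cast (Nat.le_add_right _ _).trans h1
    have h3 : (0 : ℝ) ≤ n := by positivity
    have h4 : (m + 1) * c0 = 1 := by rw [hc0]; field_simp
    nlinarith [mul_nonneg hε.le h3]
  set A := {x | c0 ≤ x ∧ UpperLow m d n0 g0 x}
  set B := {y | y ≤ 1 ∧ LowerLow m d n0 g0 y}
  have hA1 : (1 : ℝ) ∈ A := ⟨hc01, hU1⟩
  have hB0 : c0 ∈ B := ⟨hc01, hL0⟩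
  have hAb : BddBelow A := ⟨c0, fun x hx => hx.1⟩
  have hBb : BddAbove B := ⟨1, fun x hx => hx.1⟩
  set x := sInf A
  set y := sSup B
  have hxc : c0 ≤ x := le_csInf ⟨1, hA1⟩ fun z hz => hz.1
  have hyc : c0 ≤ y := le_csSup hBb hB0
  have hxU : UpperLow m d n0 g0 x := by
    intro ε hε
    obtain ⟨z, hz, hzlt⟩ := exists_lt_of_csInf_lt ⟨1, hA1⟩ (by linarith : sInf A < x + ε / 2)
    refine (hz.2 (ε / 2) (half_pos hε)).mono hd hg (Eventually.of_forall fun n g _ hlt => ?_)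
    refine lt_of_le_of_lt ?_ hlt
    exact mul_le_mul_of_nonneg_right (by linarith) (Nat.cast_nonneg n)
  have hyL : LowerLow m d n0 g0 y := by
    intro ε hε
    obtain ⟨z, hz, hzlt⟩ := exists_lt_of_lt_csSup ⟨c0, hB0⟩ (by linarith : y - ε / 2 < sSup B)
    refine (hz.2 (ε / 2) (half_pos hε)).mono hd hg (Eventually.of_forall fun n g _ hlt => ?_)
    refine lt_of_lt_of_le hlt ?_
    exact mul_le_mul_of_nonneg_right (by linarith) (Nat.cast_nonneg n)
  have hx0 : 0 < x := hc0pos.trans_le hxc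
  have hy0 : 0 < y := hc0pos.trans_le hyc
  have hx1 : x ≤ max c0 (densMap m d x) :=
    csInf_le hAb ⟨le_max_left _ _, (upperLow_densMap hm hd hg hx0 hxU).mono hd hg (le_max_right _ _)⟩
  have hdy1 : densMap m d y ≤ 1 := by
    rw [densMap]
    have : 0 ≤ ((m : ℝ) / (m + y)) ^ (d - m) := by positivity
    linarith
  have hy1 : densMap m d y ≤ y := le_csSup hBb ⟨hdy1, lowerLow_densMap hm hd hg hy0 hyL⟩
  have hxy : x ≤ y := by
    by_contra hlt
    push Not at hlt
    have h1 : x ≤ densMap m d x := by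
      rcases le_max_iff.1 hx1 with h | h
      · linarith
      · exact h
    have h2 := densMap_lt hm hd hy0 hlt
    nlinarith
  exact ⟨x, hx0, hxU, hyL.mono hd hg hxy⟩

/-- Replacing a function of the number of unsaturated vertices by its limit. -/
theorem iter_mul_ratio (hd : 2 * m < d) (hg : Good m d n0 g0) {l : ℝ}
    (hU : UpperLow m d n0 g0 l) (hL : LowerLow m d n0 g0 l)
    {X : ℕ → SimpleGraph ℕ → ℝ} {s : ℕ} (hX0 : ∀ n g, 0 ≤ X n g)
    (hX : ∀ n g, Good m d n g → X n g ≤ (n : ℝ) ^ s)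
    {q : ℕ × ℕ → ℝ} {c C : ℝ} (hq : Tendsto q (ratioFilter l) (𝓝 c))
    (hqC : ∀ n L : ℕ, n ≤ (m + 1) * L → |q (n, L)| ≤ C) :
    ∀ ε > 0, ∀ᶠ k : ℕ in atTop,
      |iter m d n0 k (fun g => X (n0 + k) g * q (n0 + k, (lowDegSet d g (n0 + k)).card)) g0 -
        c * iter m d n0 k (X (n0 + k)) g0| ≤
      ε * (1 + iter m d n0 k (X (n0 + k)) g0) := by
  intro ε hε
  have h1 : ∀ᶠ p in ratioFilter l, |q p - c| ≤ ε := by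
    have := (Metric.tendsto_nhds.1 hq) ε hε
    filter_upwards [this] with p hp
    rw [Real.dist_eq] at hp
    exact hp.le
  obtain ⟨⟨N, δ⟩, ⟨-, hδ⟩, hb⟩ := ((atTop_basis.comap (Prod.fst : ℕ × ℕ → ℕ)).inf
    (Metric.nhds_basis_ball.comap (fun p : ℕ × ℕ => (p.2 : ℝ) / p.1))).eventually_iff.1 h1
  simp only [Set.mem_inter_iff, Set.mem_preimage, Set.mem_Ici, Metric.mem_ball, Real.dist_eq,
    and_imp, Prod.forall] at hb hδ
  have hbad := (hU (δ / 2) (half_pos hδ)).or hd hg (hL (δ / 2) (half_pos hδ))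
  set B : ℕ → SimpleGraph ℕ → Prop := fun n g => (l + δ / 2) * n < (lowDegSet d g n).card ∨
    ((lowDegSet d g n).card : ℝ) < (l - δ / 2) * n with hB
  have hC0 : 0 ≤ C := (abs_nonneg _).trans (hqC 0 0 (by simp))
  have ht := (hbad.tendsto hd hg s).const_mul (C + |c|)
  rw [mul_zero] at ht
  filter_upwards [ht.eventually_le_const hε, eventually_ge_atTop N] with k hk hkN
  set n := n0 + k with hn
  have e : iter m d n0 k (fun g => X n g * q (n, (lowDegSet d g n).card)) g0 -
      c * iter m d n0 k (X n) g0 =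
      iter m d n0 k (fun g => X n g * (q (n, (lowDegSet d g n).card) - c)) g0 := by
    rw [← iter_mul, ← iter_sub]
    exact congrArg (fun F => iter m d n0 k F g0) (funext fun g => by ring)
  rw [e]
  refine (iter_abs_le hd hg).trans ?_
  have hle : iter m d n0 k (fun g => |X n g * (q (n, (lowDegSet d g n).card) - c)|) g0 ≤
      iter m d n0 k (fun g => ε * X n g + (C + |c|) * (n : ℝ) ^ s * ind (B n g)) g0 := by
    refine iter_mono hd hg fun g hg' => ?_
    rw [← hn] at hg'
    rw [abs_mul, abs_of_nonneg (hX0 n g)]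
    have hnpos : (0 : ℝ) < n := by exact_mod_cast (Nat.succ_le_iff.1 ((Nat.le_add_left 1 m).trans hg'.le_n))
    by_cases hBg : B n g
    · rw [ind_of hBg, mul_one]
      have h2 := hqC n (lowDegSet d g n).card ((Nat.le_add_right _ _).trans (hg'.card_low hd))
      have h3 : |q (n, (lowDegSet d g n).card) - c| ≤ C + |c| := (abs_sub _ _).trans (by linarith)
      have h4 := mul_le_mul (hX n g hg') h3 (abs_nonneg _) (by positivity)
      have h5 := mul_nonneg hε.le (hX0 n g)
      linarith
    · rw [ind_of_not hBg, mul_zero, add_zero, mul_comm]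
      refine mul_le_mul_of_nonneg_right ?_ (hX0 n g)
      simp only [hB, not_or, not_lt] at hBg
      refine hb n _ (by omega) ?_
      rw [abs_lt]
      have h2 := (div_le_iff₀ hnpos).2 hBg.1
      have h3 := (le_div_iff₀ hnpos).2 hBg.2
      constructor <;> linarith
  refine hle.trans ?_
  rw [iter_add, iter_mul, iter_mul]
  linarith

end UA

namespace UA

variable {V : Type*}

/-- Connectedness inside the subgraph induced on `K`. -/
def Conn (H : SimpleGraph V) (K : Finset V) : V → V → Prop :=
  Relation.ReflTransGen (fun a b => a ∈ K ∧ b ∈ K ∧ H.Adj a b)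

variable {H : SimpleGraph V} {K K' : Finset V} {u v w h : V}

theorem Conn.refl (v : V) : Conn H K v v := Relation.ReflTransGen.refl

theorem Conn.trans (h1 : Conn H K u v) (h2 : Conn H K v w) : Conn H K u w :=
  Relation.ReflTransGen.trans h1 h2

theorem Conn.symm (h1 : Conn H K u v) : Conn H K v u := by
  induction h1 with
  | refl => exact Conn.refl _
  | tail _ h2 ih => exact Relation.ReflTransGen.head ⟨h2.2.1, h2.1, h2.2.2.symm⟩ ih

theorem Conn.of_adj (hu : u ∈ K) (hv : v ∈ K) (huv : H.Adj u v) : Conn H K u v :=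
  Relation.ReflTransGen.single ⟨hu, hv, huv⟩

theorem Conn.mono (hK : K ⊆ K') (h1 : Conn H K u v) : Conn H K' u v :=
  Relation.ReflTransGen.mono (fun _ _ h => ⟨hK h.1, hK h.2.1, h.2.2⟩) _ _ h1

theorem Conn.map {V' : Type*} {H' : SimpleGraph V'} {L : Finset V'} {f : V → V'}
    (hf : ∀ v ∈ K, f v ∈ L) (ha : ∀ u ∈ K, ∀ v ∈ K, H.Adj u v → H'.Adj (f u) (f v))
    (h1 : Conn H K u v) : Conn H' L (f u) (f v) :=
  Relation.ReflTransGen.lift f (fun a b h => ⟨hf a h.1, hf b h.2.1, ha a h.1 b h.2.1 h.2.2⟩) _ _ h1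

/-- A connected class that stays inside a set closed under adjacency is connected there. -/
theorem Conn.restrict (hu : u ∈ K')
    (hcl : ∀ a ∈ K', ∀ b ∈ K, H.Adj a b → b ∈ K') (h1 : Conn H K u v) :
    v ∈ K' ∧ Conn H K' u v := by
  induction h1 with
  | refl => exact ⟨hu, Conn.refl _⟩
  | tail _ h2 ih =>
    have := hcl _ ih.1 _ h2.2.1 h2.2.2
    exact ⟨this, ih.2.trans (Conn.of_adj ih.1 this h2.2.2)⟩

section comps

variable [DecidableEq V]

open Classical in
/-- The component of `v` in the subgraph induced on `K`. -/
noncomputable def compOf (H : SimpleGraph V) (K : Finset V) (v : V) : Finset V :=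
  K.filter (Conn H K v)

/-- The set of components of the subgraph induced on `K`. -/
noncomputable def comps (H : SimpleGraph V) (K : Finset V) : Finset (Finset V) :=
  K.image (compOf H K)

theorem mem_compOf : w ∈ compOf H K v ↔ w ∈ K ∧ Conn H K v w := by
  simp [compOf]

theorem compOf_eq (h1 : Conn H K u v) : compOf H K u = compOf H K v := by
  ext w
  simp only [mem_compOf]
  exact ⟨fun h => ⟨h.1, h1.symm.trans h.2⟩, fun h => ⟨h.1, h1.trans h.2⟩⟩

theorem conn_of_compOf_eq (hv : v ∈ K) (h1 : compOf H K u = compOf H K v) : Conn H K u v := by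
  have : v ∈ compOf H K v := mem_compOf.2 ⟨hv, Conn.refl _⟩
  rw [← h1] at this
  exact (mem_compOf.1 this).2

theorem conn_compOf (h1 : Conn H K v w) (hv : v ∈ K) : Conn H (compOf H K v) v w := by
  refine (Conn.restrict (K := K) (mem_compOf.2 ⟨hv, Conn.refl _⟩) ?_ h1).2
  intro a ha b hb hab
  rw [mem_compOf] at ha ⊢
  exact ⟨hb, ha.2.trans (Conn.of_adj ha.1 hb hab)⟩

theorem conn_insert_iff (hh : h ∉ K) (hu : u ∈ K) :
    Conn H (insert h K) h u ↔ ∃ a ∈ nbrs H K h, Conn H K a u := by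
  constructor
  · intro h1
    suffices ∀ w, Conn H (insert h K) h w → w = h ∨ (w ∈ K ∧ ∃ a ∈ nbrs H K h, Conn H K a w) by
      rcases this u h1 with rfl | h2
      · exact absurd hu hh
      · exact h2.2
    intro w hw
    induction hw with
    | refl => exact Or.inl rfl
    | @tail b c _ h2 ih =>
      by_cases hc : c = h
      · exact Or.inl hc
      have hcK : c ∈ K := Finset.mem_of_mem_insert_of_ne h2.2.1 hc
      refine Or.inr ⟨hcK, ?_⟩
      rcases ih with rfl | ⟨hb, a, ha, hab⟩
      · exact ⟨c, mem_nbrs.2 ⟨hcK, h2.2.2⟩, Conn.refl _⟩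
      · exact ⟨a, ha, hab.trans (Conn.of_adj hb hcK h2.2.2)⟩
  · rintro ⟨a, ha, hau⟩
    rw [mem_nbrs] at ha
    exact (Conn.of_adj (Finset.mem_insert_self _ _) (Finset.mem_insert_of_mem ha.1) ha.2).trans
      (hau.mono (Finset.subset_insert _ _))

theorem compOf_insert_of_not (hh : h ∉ K) (hv : v ∈ K)
    (hn : ¬ ∃ a ∈ nbrs H K h, Conn H K a v) : compOf H (insert h K) v = compOf H K v := by
  ext w
  simp only [mem_compOf]
  constructor
  · rintro ⟨hw, h1⟩
    have h2 := Conn.restrict (K' := compOf H K v) (mem_compOf.2 ⟨hv, Conn.refl _⟩) ?_ h1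
    · exact mem_compOf.1 h2.1
    · intro a ha b hb hab
      rw [mem_compOf] at ha ⊢
      have hbh : b ≠ h := by
        rintro rfl
        exact hn ⟨a, mem_nbrs.2 ⟨ha.1, hab.symm⟩, ha.2.symm⟩
      have hbK := Finset.mem_of_mem_insert_of_ne hb hbh
      exact ⟨hbK, ha.2.trans (Conn.of_adj ha.1 hbK hab)⟩
  · rintro ⟨hw, h1⟩
    exact ⟨Finset.mem_insert_of_mem hw, h1.mono (Finset.subset_insert _ _)⟩

theorem nbrs_image_subset : (nbrs H K h).image (compOf H K) ⊆ comps H K :=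
  Finset.image_subset_image fun _ ha => (mem_nbrs.1 ha).1

theorem comps_insert (hh : h ∉ K) :
    comps H (insert h K) = insert (compOf H (insert h K) h)
      (comps H K \ (nbrs H K h).image (compOf H K)) := by
  ext C
  simp only [comps, Finset.mem_image, Finset.mem_insert, Finset.mem_sdiff]
  constructor
  · rintro ⟨v, rfl | hv, rfl⟩
    · exact Or.inl rfl
    · by_cases hn : ∃ a ∈ nbrs H K h, Conn H K a v
      · exact Or.inl (compOf_eq ((conn_insert_iff hh hv).2 hn)).symm
      · rw [compOf_insert_of_not hh hv hn]
        refine Or.inr ⟨⟨v, hv, rfl⟩, ?_⟩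
        rintro ⟨a, ha, hav⟩
        exact hn ⟨a, ha, conn_of_compOf_eq hv hav⟩
  · rintro (rfl | ⟨⟨v, hv, rfl⟩, hn⟩)
    · exact ⟨h, Or.inl rfl, rfl⟩
    · refine ⟨v, Or.inr hv, compOf_insert_of_not hh hv ?_⟩
      rintro ⟨a, ha, hav⟩
      exact hn ⟨a, ha, compOf_eq hav⟩

theorem compOf_notMem_comps (hh : h ∉ K) : compOf H (insert h K) h ∉ comps H K := by
  intro h1
  obtain ⟨v, hv, e⟩ := Finset.mem_image.1 h1
  have : h ∈ compOf H (insert h K) h := mem_compOf.2 ⟨Finset.mem_insert_self _ _, Conn.refl _⟩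
  rw [← e, mem_compOf] at this
  exact hh this.1

theorem compOf_insert_self (hh : h ∉ K) : compOf H (insert h K) h =
    insert h (((nbrs H K h).image (compOf H K)).biUnion id) := by
  ext w
  simp only [mem_compOf, Finset.mem_insert, Finset.mem_biUnion, Finset.mem_image, id]
  constructor
  · rintro ⟨rfl | hw, h1⟩
    · exact Or.inl rfl
    · obtain ⟨a, ha, haw⟩ := (conn_insert_iff hh hw).1 h1
      exact Or.inr ⟨_, ⟨a, ha, rfl⟩, mem_compOf.2 ⟨hw, haw⟩⟩
  · rintro (rfl | ⟨_, ⟨a, ha, rfl⟩, h1⟩)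
    · exact ⟨Or.inl rfl, Conn.refl _⟩
    · rw [mem_compOf] at h1
      exact ⟨Or.inr h1.1, (conn_insert_iff hh h1.1).2 ⟨a, ha, h1.2⟩⟩

theorem mem_comps_disjoint {A B : Finset V} (hA : A ∈ comps H K) (hB : B ∈ comps H K)
    (hAB : A ≠ B) : Disjoint A B ∧ ∀ a ∈ A, ∀ b ∈ B, ¬ H.Adj a b := by
  obtain ⟨u, hu, rfl⟩ := Finset.mem_image.1 hA
  obtain ⟨v, hv, rfl⟩ := Finset.mem_image.1 hB
  have hno : ∀ a, a ∈ compOf H K u → a ∉ compOf H K v := fun a ha hb => by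
    rw [mem_compOf] at ha hb
    exact hAB (compOf_eq (ha.2.trans hb.2.symm))
  refine ⟨Finset.disjoint_left.2 hno, fun a ha b hb hab => ?_⟩
  rw [mem_compOf] at ha hb
  exact hAB (compOf_eq ((ha.2.trans (Conn.of_adj ha.1 hb.1 hab)).trans hb.2.symm))

theorem subset_of_mem_comps {A : Finset V} (hA : A ∈ comps H K) : A ⊆ K := by
  obtain ⟨u, hu, rfl⟩ := Finset.mem_image.1 hA
  exact fun w hw => (mem_compOf.1 hw).1

theorem comps_of_conn (hv : v ∈ K) (hc : ∀ w ∈ K, Conn H K v w) : comps H K = {K} := by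
  have e : ∀ w ∈ K, compOf H K w = K := fun w hw => by
    ext x
    rw [mem_compOf]
    exact ⟨fun h => h.1, fun hx => ⟨hx, (hc w hw).symm.trans (hc x hx)⟩⟩
  ext C
  simp only [comps, Finset.mem_image, Finset.mem_singleton]
  exact ⟨fun ⟨w, hw, h1⟩ => by rw [← h1, e w hw], fun h1 => ⟨v, hv, by rw [h1, e v hv]⟩⟩

/-- Patterns which the process creates in linear quantities (per component). -/
inductive Ab (m d : ℕ) (H : SimpleGraph V) : Finset V → (V → ℕ) → Prop
  | empty (D : V → ℕ) : Ab m d H ∅ D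
  | hit {K : Finset V} {D D' : V → ℕ} (u : V) (hu : u ∈ K) (hlt : D u < d) (h : Ab m d H K D)
      (hD' : ∀ v ∈ K, D' v = D v + if v = u then 1 else 0) : Ab m d H K D'
  | new {K : Finset V} {D D' : V → ℕ} (h : V) (hh : h ∉ K) (hab : Ab m d H K D) (hm : D' h = m)
      (hadj : ∀ u ∈ K, H.Adj h u → D' u = D u + 1 ∧ D u < d)
      (hnadj : ∀ u ∈ K, ¬ H.Adj h u → D' u = D u)
      (hcard : (nbrs H K h).card ≤ m)
      (hsep : ∀ u ∈ K, ∀ v ∈ K, H.Adj h u → H.Adj h v → Conn H K u v → u = v) :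
      Ab m d H (insert h K) D'

variable {m d : ℕ} {D D' : V → ℕ}

theorem Ab.congr (h1 : Ab m d H K D) (hD : ∀ v ∈ K, D v = D' v) : Ab m d H K D' := by
  cases h1 with
  | empty => exact Ab.empty _
  | hit u hu hlt h1 h2 => exact Ab.hit u hu hlt h1 fun v hv => by rw [← hD v hv, h2 v hv]
  | new h hh hab hm h1 h2 h3 h4 =>
    refine Ab.new h hh hab ?_ ?_ ?_ h3 h4
    · rw [← hD h (Finset.mem_insert_self _ _), hm]
    · intro u hu hadj
      rw [← hD u (Finset.mem_insert_of_mem hu)]; exact h1 u hu hadj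
    · intro u hu hadj
      rw [← hD u (Finset.mem_insert_of_mem hu)]; exact h2 u hu hadj

theorem Ab.mono_deg (h1 : Ab m d H K D) (hD : ∀ v ∈ K, D v ≤ D' v) (hd : ∀ v ∈ K, D' v ≤ d) :
    Ab m d H K D' := by
  induction hs : ∑ v ∈ K, (D' v - D v) generalizing D with
  | zero =>
    rw [Finset.sum_eq_zero_iff] at hs
    exact h1.congr fun v hv => by have := hs v hv; have := hD v hv; omega
  | succ s ih =>
    obtain ⟨u, hu, hlt⟩ : ∃ u ∈ K, 0 < D' u - D u := by
      by_contra hcon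
      push Not at hcon
      have : ∑ v ∈ K, (D' v - D v) = 0 := Finset.sum_eq_zero fun v hv => by
        have := hcon v hv; omega
      omega
    have hd' := hd u hu
    refine ih (D := fun v => D v + if v = u then 1 else 0)
      (Ab.hit u hu (by omega) h1 fun v _ => rfl) ?_ ?_
    · intro v hv
      split_ifs with h
      · subst h; omega
      · simpa using hD v hv
    · have e : ∀ v ∈ K, D' v - D v = (D' v - (D v + if v = u then 1 else 0)) +
          if v = u then 1 else 0 := by
        intro v hv
        split_ifs with h
        · subst h; omega
        · omega
      rw [Finset.sum_congr rfl e, Finset.sum_add_distrib, Finset.sum_ite_eq' K u, if_pos hu] at hs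
      omega

/-- Abundance passes to induced subpatterns. -/
theorem Ab.pullback {V' : Type*} [DecidableEq V'] {H' : SimpleGraph V'}
    (h1 : Ab m d H K D) : ∀ {K' : Finset V'} {D' : V' → ℕ} {f : V' → V}, Set.InjOn f K' →
    (∀ v ∈ K', f v ∈ K) → (∀ u ∈ K', ∀ v ∈ K', H'.Adj u v ↔ H.Adj (f u) (f v)) →
    (∀ v ∈ K', D' v = D (f v)) → (∀ v ∈ K', D' v ≤ d) → Ab m d H' K' D' := by
  induction h1 with
  | empty D =>
    intro K' D' f _ hf _ _ _
    have : K' = ∅ := Finset.eq_empty_of_forall_notMem fun v hv => by simpa using hf v hv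
    subst this
    exact Ab.empty _
  | hit u hu hlt h1 h2 ih =>
    rename_i K D D1
    intro K' D' f hinj hf hadj hD hdd
    refine (ih (D' := fun v => D (f v)) hinj hf hadj (fun _ _ => rfl) ?_).mono_deg ?_ hdd
    · intro v hv
      have h3 := hdd v hv
      rw [hD v hv, h2 _ (hf v hv)] at h3
      exact (Nat.le_add_right _ _).trans h3
    · intro v hv
      rw [hD v hv, h2 _ (hf v hv)]
      exact Nat.le_add_right _ _
  | new h hh hab hm h1 h2 h3 h4 ih =>
    rename_i K D D1
    intro K' D' f hinj hf hadj hD hdd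
    have hle : ∀ v ∈ K', f v ∈ K → D (f v) ≤ D' v := fun v hv hfv => by
      rw [hD v hv]
      by_cases hav : H.Adj h (f v)
      · rw [(h1 _ hfv hav).1]; omega
      · rw [h2 _ hfv hav]
    by_cases hex : ∃ h' ∈ K', f h' = h
    · obtain ⟨h', hh', rfl⟩ := hex
      have hfe : ∀ v ∈ K'.erase h', f v ∈ K := fun v hv => by
        rw [Finset.mem_erase] at hv
        refine Finset.mem_of_mem_insert_of_ne (hf v hv.2) fun e => hv.1 (hinj hv.2 hh' e)
      have hsub : K'.erase h' ⊆ K' := Finset.erase_subset _ _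
      have hab' := ih (K' := K'.erase h') (D' := fun v => D (f v)) (hinj.mono (by exact_mod_cast hsub))
        hfe (fun u hu v hv => hadj u (hsub hu) v (hsub hv)) (fun _ _ => rfl)
        (fun v hv => (hle v (hsub hv) (hfe v hv)).trans (hdd v (hsub hv)))
      rw [← Finset.insert_erase hh']
      refine Ab.new h' (Finset.notMem_erase _ _) hab' ?_ ?_ ?_ ?_ ?_
      · rw [hD h' hh', hm]
      · intro u hu hau
        rw [hD u (hsub hu)]
        exact h1 _ (hfe u hu) ((hadj h' hh' u (hsub hu)).1 hau)
      · intro u hu hau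
        rw [hD u (hsub hu)]
        exact h2 _ (hfe u hu) fun h5 => hau ((hadj h' hh' u (hsub hu)).2 h5)
      · refine le_trans (Finset.card_le_card_of_injOn f ?_ ?_) h3
        · intro v hv
          rw [Finset.mem_coe, mem_nbrs] at hv
          exact mem_nbrs.2 ⟨hfe v hv.1, (hadj h' hh' v (hsub hv.1)).1 hv.2⟩
        · intro a ha b hb hab
          rw [Finset.mem_coe, mem_nbrs] at ha hb
          exact hinj (hsub ha.1) (hsub hb.1) hab
      · intro u hu v hv hau hav hc
        refine hinj (hsub hu) (hsub hv) (h4 _ (hfe u hu) _ (hfe v hv)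
          ((hadj h' hh' u (hsub hu)).1 hau) ((hadj h' hh' v (hsub hv)).1 hav) ?_)
        exact hc.map hfe fun a ha b hb => (hadj a (hsub ha) b (hsub hb)).1
    · push Not at hex
      have hfe : ∀ v ∈ K', f v ∈ K := fun v hv =>
        Finset.mem_of_mem_insert_of_ne (hf v hv) (hex v hv)
      exact (ih (D' := fun v => D (f v)) hinj hfe hadj (fun _ _ => rfl)
        (fun v hv => (hle v hv (hfe v hv)).trans (hdd v hv))).mono_deg
        (fun v hv => hle v hv (hfe v hv)) hdd

theorem Ab.union {B : Finset V} {D : V → ℕ} (hB : Ab m d H B D) : ∀ {A : Finset V} {D' : V → ℕ},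
    (∀ v ∈ B, D' v = D v) → Ab m d H A D' → Disjoint A B →
    (∀ a ∈ A, ∀ b ∈ B, ¬ H.Adj a b) → Ab m d H (A ∪ B) D' := by
  induction hB with
  | empty D => intro A D' _ hA _ _; rwa [Finset.union_empty]
  | hit u hu hlt h1 h2 ih =>
    rename_i B D D1
    intro A D' hD hA hdis hno
    have huA : u ∉ A := fun h => Finset.disjoint_left.1 hdis h hu
    have := ih (A := A) (D' := fun v => if v ∈ B then D v else D' v) (fun v hv => by simp [hv])
      (hA.congr fun v hv => by simp [Finset.disjoint_left.1 hdis hv]) hdis hno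
    refine Ab.hit u (Finset.mem_union_right _ hu) (by simpa [hu] using hlt) this ?_
    intro v hv
    by_cases hvB : v ∈ B
    · simp only [hvB, if_true]; rw [hD v hvB, h2 v hvB]
    · have : v ≠ u := fun e => hvB (e ▸ hu)
      simp [hvB, this]
  | new h hh hab hm h1 h2 h3 h4 ih =>
    rename_i B D D1
    intro A D' hD hA hdis hno
    rw [Finset.disjoint_insert_right] at hdis
    have hno' : ∀ a ∈ A, ∀ b ∈ B, ¬ H.Adj a b := fun a ha b hb => hno a ha b (Finset.mem_insert_of_mem hb)
    have hnh : ∀ a ∈ A, ¬ H.Adj h a := fun a ha hadj => hno a ha h (Finset.mem_insert_self _ _) hadj.symm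
    have := ih (A := A) (D' := fun v => if v ∈ B then D v else D' v) (fun v hv => by simp [hv])
      (hA.congr fun v hv => by simp [Finset.disjoint_left.1 hdis.2 hv]) hdis.2 hno'
    rw [Finset.union_insert]
    refine Ab.new h (by simp [hh, hdis.1]) this ?_ ?_ ?_ ?_ ?_
    · rw [hD h (Finset.mem_insert_self _ _), hm]
    · intro u hu hau
      rcases Finset.mem_union.1 hu with hu | hu
      · exact absurd hau (hnh u hu)
      · simp only [hu, if_true]
        rw [hD u (Finset.mem_insert_of_mem hu)]; exact h1 u hu hau
    · intro u hu hau
      by_cases huB : u ∈ B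
      · simp only [huB, if_true]
        rw [hD u (Finset.mem_insert_of_mem huB)]; exact h2 u huB hau
      · simp [huB]
    · refine le_trans (Finset.card_le_card fun u hu => ?_) h3
      rw [mem_nbrs] at hu ⊢
      rcases Finset.mem_union.1 hu.1 with h5 | h5
      · exact absurd hu.2 (hnh u h5)
      · exact ⟨h5, hu.2⟩
    · intro u hu v hv hau hav hc
      have huB : u ∈ B := (Finset.mem_union.1 hu).resolve_left fun h5 => hnh u h5 hau
      have hvB : v ∈ B := (Finset.mem_union.1 hv).resolve_left fun h5 => hnh v h5 hav
      refine h4 u huB v hvB hau hav (Conn.restrict huB ?_ hc).2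
      intro a ha b hb hab
      exact (Finset.mem_union.1 hb).resolve_left fun h5 => hno' b h5 a ha hab.symm

theorem Ab.biUnion {s : Finset (Finset V)} (hs : s ⊆ comps H K)
    (h : ∀ C ∈ s, Ab m d H C D) : Ab m d H (s.biUnion id) D := by
  induction s using Finset.induction_on with
  | empty => simpa using Ab.empty D
  | insert C s hC ih =>
    rw [Finset.biUnion_insert, Finset.union_comm]
    have hs' : s ⊆ comps H K := (Finset.subset_insert _ _).trans hs
    have hdis : ∀ A ∈ s, Disjoint A C ∧ ∀ a ∈ A, ∀ b ∈ C, ¬ H.Adj a b := fun A hA =>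
      mem_comps_disjoint (hs' hA) (hs (Finset.mem_insert_self _ _)) fun e => hC (e ▸ hA)
    refine (h C (Finset.mem_insert_self _ _)).union (fun _ _ => rfl)
      (ih hs' fun A hA => h A (Finset.mem_insert_of_mem hA)) ?_ ?_
    · rw [Finset.disjoint_biUnion_left]
      exact fun A hA => (hdis A hA).1
    · intro a ha b hb
      obtain ⟨A, hA, haA⟩ := Finset.mem_biUnion.1 ha
      exact (hdis A hA).2 a haA b hb

open Classical in
/-- The number of abundant components. -/
noncomputable def abComps (m d : ℕ) (H : SimpleGraph V) (K : Finset V) (D : V → ℕ) : ℕ :=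
  ((comps H K).filter (Ab m d H · D)).card

theorem abComps_mono (hD : ∀ v ∈ K, D v ≤ D' v) (hd : ∀ v ∈ K, D' v ≤ d) :
    abComps m d H K D ≤ abComps m d H K D' := by
  classical
  refine Finset.card_le_card fun C hC => ?_
  rw [Finset.mem_filter] at hC ⊢
  have := subset_of_mem_comps hC.1
  exact ⟨hC.1, hC.2.mono_deg (fun v hv => hD v (this hv)) fun v hv => hd v (this hv)⟩

theorem abComps_insert (hh : h ∉ K) (hD : D h = m) (hcard : (nbrs H K h).card ≤ m)
    (hpos : ∀ v ∈ K, 1 ≤ D v) (hd : ∀ v ∈ K, D v ≤ d) :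
    abComps m d H K (lower D (nbrs H K h)) + 1 ≤
      abComps m d H (insert h K) D + (nbrs H K h).card := by
  classical
  set N := nbrs H K h with hN
  set NC := N.image (compOf H K) with hNC
  have hNCs : NC ⊆ comps H K := nbrs_image_subset
  have hlow : ∀ u ∈ K, u ∉ N → lower D N u = D u := fun u _ hu => by simp [lower, hu]
  have h1 : abComps m d H K (lower D N) =
      ((comps H K \ NC).filter (Ab m d H · D)).card + (NC.filter (Ab m d H · (lower D N))).card := by
    rw [abComps, ← Finset.sdiff_union_of_subset hNCs, Finset.filter_union,
      Finset.card_union_of_disjoint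
        (Finset.disjoint_filter_filter (by exact Finset.sdiff_disjoint)),
      Finset.sdiff_union_of_subset hNCs]
    congr 2
    refine Finset.filter_congr fun C hC => ?_
    rw [Finset.mem_sdiff] at hC
    have e : ∀ v ∈ C, lower D N v = D v := fun v hv => by
      refine hlow v (subset_of_mem_comps hC.1 hv) fun hvN => hC.2 ?_
      obtain ⟨u, hu, rfl⟩ := Finset.mem_image.1 hC.1
      rw [mem_compOf] at hv
      exact Finset.mem_image.2 ⟨v, hvN, (compOf_eq hv.2).symm⟩
    exact ⟨fun h => h.congr e, fun h => h.congr fun v hv => (e v hv).symm⟩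
  have h2 : abComps m d H (insert h K) D =
      ((comps H K \ NC).filter (Ab m d H · D)).card +
        if Ab m d H (compOf H (insert h K) h) D then 1 else 0 := by
    rw [abComps, comps_insert hh, Finset.filter_insert]
    split_ifs with hif
    · rw [Finset.card_insert_of_notMem]
      exact fun h3 => compOf_notMem_comps hh (Finset.mem_sdiff.1 (Finset.mem_filter.1 h3).1).1
    · rfl
  have h3 : (NC.filter (Ab m d H · (lower D N))).card ≤ NC.card := Finset.card_filter_le _ _
  have h4 : NC.card ≤ N.card := Finset.card_image_le
  rw [h1, h2]
  by_cases hlt : (NC.filter (Ab m d H · (lower D N))).card < N.card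
  · omega
  · have e1 : (NC.filter (Ab m d H · (lower D N))).card = NC.card := by omega
    have e2 : NC.card = N.card := by omega
    have hall : ∀ C ∈ NC, Ab m d H C (lower D N) := Finset.card_filter_eq_iff.1 e1
    have hinj := Finset.card_image_iff.1 e2
    have hsub : NC.biUnion id ⊆ K := Finset.biUnion_subset.2 fun C hC =>
      subset_of_mem_comps (hNCs hC)
    have hab : Ab m d H (compOf H (insert h K) h) D := by
      rw [compOf_insert_self hh]
      refine Ab.new h (fun h5 => hh (hsub h5)) (Ab.biUnion hNCs hall) hD ?_ ?_ ?_ ?_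
      · intro u hu hau
        have huN : u ∈ N := mem_nbrs.2 ⟨hsub hu, hau⟩
        have := hpos u (hsub hu)
        have := hd u (hsub hu)
        simp only [lower, huN, if_true]
        omega
      · intro u hu hau
        rw [hlow u (hsub hu) fun h5 => hau (mem_nbrs.1 h5).2]
      · refine le_trans (Finset.card_le_card fun u hu => ?_) hcard
        rw [mem_nbrs] at hu ⊢
        exact ⟨hsub hu.1, hu.2⟩
      · intro u hu v hv hau hav hc
        exact hinj (mem_nbrs.2 ⟨hsub hu, hau⟩) (mem_nbrs.2 ⟨hsub hv, hav⟩)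
          (compOf_eq (hc.mono hsub))
    rw [if_pos hab]
    omega

/-- Every component of the pattern has an unsaturated vertex. -/
def Unsat (d : ℕ) (H : SimpleGraph V) (K : Finset V) (D : V → ℕ) : Prop :=
  ∀ v ∈ K, ∃ u ∈ K, Conn H K v u ∧ D u < d

theorem Unsat.lower (hU : Unsat d H K D) (U : Finset V) : Unsat d H K (lower D U) := by
  intro v hv
  obtain ⟨u, hu, hc, hlt⟩ := hU v hv
  exact ⟨u, hu, hc, lt_of_le_of_lt (Nat.sub_le _ _) hlt⟩

theorem Unsat.erase (hU : Unsat d H (insert h K) D) (hh : h ∉ K)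
    (hpos : ∀ v ∈ K, 1 ≤ D v) (hd : ∀ v ∈ K, D v ≤ d) :
    Unsat d H K (UA.lower D (nbrs H K h)) := by
  intro v hv
  by_cases hn : ∃ a ∈ nbrs H K h, Conn H K a v
  · obtain ⟨a, ha, hav⟩ := hn
    have haK := (mem_nbrs.1 ha).1
    refine ⟨a, haK, hav.symm, ?_⟩
    have := hpos a haK
    have := hd a haK
    simp only [UA.lower, ha, if_true]; omega
  · obtain ⟨u, hu, hc, hlt⟩ := hU v (Finset.mem_insert_of_mem hv)
    have : u ∈ compOf H (insert h K) v := mem_compOf.2 ⟨hu, hc⟩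
    rw [compOf_insert_of_not hh hv hn, mem_compOf] at this
    exact ⟨u, this.1, this.2, lt_of_le_of_lt (Nat.sub_le _ _) hlt⟩

end comps

end UA

namespace UA

/-! ### Convergence of normalised expected pattern counts -/

theorem tendsto_ratio_succ_pow (ρ n0 : ℕ) :
    Tendsto (fun k : ℕ => (((n0 + k : ℕ) : ℝ) / ((n0 + k : ℕ) + 1)) ^ ρ) atTop (𝓝 1) := by
  have h : Tendsto (fun n : ℕ => (n : ℝ) / (n + 1)) atTop (𝓝 1) := tendsto_natCast_div_add_atTop 1
  have h2 : Tendsto (fun k : ℕ => n0 + k) atTop atTop := tendsto_atTop_mono (fun k => Nat.le_add_left k n0) tendsto_id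
  simpa using (h.comp h2).pow ρ

theorem tendsto_mul_one_sub_ratio_pow (ρ n0 : ℕ) :
    Tendsto (fun k : ℕ => ((n0 + k : ℕ) : ℝ) * (1 - (((n0 + k : ℕ) : ℝ) / ((n0 + k : ℕ) + 1)) ^ ρ))
      atTop (𝓝 ρ) := by
  induction ρ with
  | zero => simp
  | succ ρ ih =>
    have h := ih.add ((tendsto_ratio_succ_pow ρ n0).mul (tendsto_ratio_succ_pow 1 n0))
    rw [mul_one] at h
    push_cast at h ⊢
    refine h.congr fun k => ?_
    have h0 : (n0 + k : ℝ) + 1 ≠ 0 := by positivity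
    rw [pow_one, pow_succ]
    field_simp
    ring

theorem tendsto_pow_div_pow {a b : ℕ} (hab : a ≤ b) (n0 : ℕ) (hn0 : 1 ≤ n0) :
    ∃ c : ℝ, Tendsto (fun k : ℕ => ((n0 + k : ℕ) : ℝ) ^ a / ((n0 + k : ℕ) : ℝ) ^ b) atTop (𝓝 c) := by
  have hpos : ∀ k : ℕ, (0 : ℝ) < ((n0 + k : ℕ) : ℝ) := fun k => by
    exact_mod_cast (by omega : 0 < n0 + k)
  have h2 : Tendsto (fun k : ℕ => ((n0 + k : ℕ) : ℝ)) atTop atTop :=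
    tendsto_natCast_atTop_atTop.comp
      (tendsto_atTop_mono (fun k => Nat.le_add_left k n0) tendsto_id)
  obtain ⟨e, rfl⟩ := Nat.exists_eq_add_of_le hab
  have h3 := ((tendsto_inv_atTop_zero.comp h2).pow e)
  refine ⟨_, h3.congr fun k => ?_⟩
  have := hpos k
  simp only [Function.comp]
  rw [pow_add, inv_pow]
  field_simp

theorem tendsto_of_renormalised_recursion {x y r : ℕ → ℝ} {n0 ρ : ℕ} {a c : ℝ} (hn0 : 1 ≤ n0)
    (ha : 0 < a) (hx : ∀ k, 0 ≤ x k)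
    (hy : ∀ ε > 0, ∀ᶠ k : ℕ in atTop, |y k - a * x k| ≤ ε * (1 + x k))
    (hr : Tendsto r atTop (𝓝 c))
    (hrec : ∀ k, x (k + 1) = (((n0 + k : ℕ) : ℝ) / ((n0 + k : ℕ) + 1)) ^ ρ *
      (x k - y k / (n0 + k : ℕ) + r k / (n0 + k : ℕ))) :
    Tendsto x atTop (𝓝 (c / (a + ρ))) := by
  refine tendsto_of_linear_recursion hn0 (by positivity) hx fun ε hε => ?_
  have h1 := tendsto_ratio_succ_pow ρ n0
  have h2 := tendsto_mul_one_sub_ratio_pow ρ n0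
  set t : ℕ → ℝ := fun k => (((n0 + k : ℕ) : ℝ) / ((n0 + k : ℕ) + 1)) ^ ρ with ht
  have h3 : Tendsto (fun k => |(ρ : ℝ) - ((n0 + k : ℕ) : ℝ) * (1 - t k)|) atTop (𝓝 0) := by
    have h := (h2.const_sub (ρ : ℝ)).abs
    rwa [sub_self, abs_zero] at h
  have h4 : Tendsto (fun k => |(1 - t k) * a|) atTop (𝓝 0) := by
    have h := ((h1.const_sub 1).mul_const a).abs
    rwa [sub_self, zero_mul, abs_zero] at h
  have h5 : Tendsto (fun k => |t k * r k - c|) atTop (𝓝 0) := by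
    have h := ((h1.mul hr).sub_const c).abs
    rwa [one_mul, sub_self, abs_zero] at h
  have hε4 : 0 < ε / 4 := by positivity
  filter_upwards [hy (ε / 4) hε4, h3.eventually_le_const hε4, h4.eventually_le_const hε4,
    h5.eventually_le_const hε4] with k k1 k2 k3 k4
  have hn : (0 : ℝ) < ((n0 + k : ℕ) : ℝ) := by exact_mod_cast (by omega : 0 < n0 + k)
  have ht0 : 0 ≤ t k := by rw [ht]; positivity
  have ht1 : t k ≤ 1 := by
    refine pow_le_one₀ (by positivity) ?_
    rw [div_le_one (by positivity)]; linarith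
  have hrk := hrec k
  change x (k + 1) = t k * _ at hrk
  set n := ((n0 + k : ℕ) : ℝ)
  have e : x (k + 1) - (1 - (a + ρ) / n) * x k - c / n =
      ((ρ - n * (1 - t k)) * x k - t k * (y k - a * x k) + (1 - t k) * a * x k +
        (t k * r k - c)) / n := by
    rw [hrk]; field_simp; ring
  rw [e, abs_div, abs_of_pos hn]
  gcongr
  have b1 : |(ρ - n * (1 - t k)) * x k| ≤ ε / 4 * x k := by
    rw [abs_mul, abs_of_nonneg (hx k)]; exact mul_le_mul_of_nonneg_right k2 (hx k)
  have b2 : |t k * (y k - a * x k)| ≤ ε / 4 * (1 + x k) := by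
    rw [abs_mul, abs_of_nonneg ht0]
    exact (mul_le_of_le_one_left (abs_nonneg _) ht1).trans k1
  have b3 : |(1 - t k) * a * x k| ≤ ε / 4 * x k := by
    rw [abs_mul, abs_of_nonneg (hx k)]; exact mul_le_mul_of_nonneg_right k3 (hx k)
  have := hx k
  rw [abs_le] at b1 b2 b3 k4 ⊢
  constructor <;> nlinarith

variable {V : Type*} [Fintype V] [DecidableEq V] {H : SimpleGraph V} {K : Finset V} {D : V → ℕ}
  {m d n n0 : ℕ} {g g0 : SimpleGraph ℕ}

theorem cnt_le (hm : 1 ≤ m) (hg : Good m d n g) :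
    (cnt H K D g n : ℝ) ≤ (n : ℝ) ^ (2 * Fintype.card V) := by
  classical
  have h1 : cnt H K D g n ≤ (n + 1) ^ Fintype.card V := by
    exact (Finset.card_filter_le _ _).trans (by simp [Fintype.card_piFinset])
  have h2 : n + 1 ≤ n ^ 2 := by have := hg.le_n; nlinarith
  rw [pow_mul]
  exact_mod_cast h1.trans (Nat.pow_le_pow_left h2 _)

/-- Asymptotics of an expectation weighted by a function of the number of unsaturated vertices. -/
theorem tendsto_iter_mul (hd : 2 * m < d) (hg : Good m d n0 g0) (hn0 : 1 ≤ n0) {l : ℝ}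
    (hl : 0 < l) (hU : UpperLow m d n0 g0 l) (hL : LowerLow m d n0 g0 l)
    {X : ℕ → SimpleGraph ℕ → ℝ} {s : ℕ} (hX0 : ∀ n g, 0 ≤ X n g)
    (hX : ∀ n g, Good m d n g → X n g ≤ (n : ℝ) ^ s) {r : ℕ} {c : ℝ}
    (hc : Tendsto (fun k : ℕ => iter m d n0 k (X (n0 + k)) g0 / ((n0 + k : ℕ) : ℝ) ^ r) atTop (𝓝 c))
    {u : ℕ → ℝ} {j : ℕ} {cu : ℝ}
    (hu : Tendsto (fun L : ℕ => (L : ℝ) ^ j * u L) atTop (𝓝 cu)) {ρ : ℕ} (hρ : r + 1 ≤ ρ + j) :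
    ∃ c' : ℝ, Tendsto (fun k : ℕ =>
      iter m d n0 k (fun g => X (n0 + k) g * u (lowDegSet d g (n0 + k)).card) g0 *
        ((n0 + k : ℕ) : ℝ) / ((n0 + k : ℕ) : ℝ) ^ ρ) atTop (𝓝 c') := by
  obtain ⟨C, hC⟩ := bounded_ratio j m hu
  set q : ℕ × ℕ → ℝ := fun p => (p.1 : ℝ) ^ j * u p.2 with hq
  have hR := iter_mul_ratio hd hg hU hL hX0 hX (q := q) (tendsto_ratio_inv hl j hu) hC
  set c1 := cu / l ^ j
  have hpos : ∀ k : ℕ, (1 : ℝ) ≤ ((n0 + k : ℕ) : ℝ) := fun k => by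
    exact_mod_cast (by omega : 1 ≤ n0 + k)
  have h1 : Tendsto (fun k : ℕ => iter m d n0 k (fun g => X (n0 + k) g *
      q (n0 + k, (lowDegSet d g (n0 + k)).card)) g0 / ((n0 + k : ℕ) : ℝ) ^ r) atTop (𝓝 (c1 * c)) := by
    have h2 : Tendsto (fun k : ℕ => iter m d n0 k (fun g => X (n0 + k) g *
        q (n0 + k, (lowDegSet d g (n0 + k)).card)) g0 / ((n0 + k : ℕ) : ℝ) ^ r -
        c1 * (iter m d n0 k (X (n0 + k)) g0 / ((n0 + k : ℕ) : ℝ) ^ r)) atTop (𝓝 0) := by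
      rw [Metric.tendsto_nhds]
      intro ε hε
      set ε' := ε / (2 * (2 + |c|)) with hε'
      have hε'0 : 0 < ε' := by positivity
      filter_upwards [hR ε' hε'0, hc.eventually_le_const (by
        have := le_abs_self c; linarith : c < |c| + 1)] with k k1 k2
      rw [Real.dist_eq, sub_zero, ← mul_div_assoc, ← sub_div, abs_div,
        abs_of_nonneg (by positivity : (0 : ℝ) ≤ ((n0 + k : ℕ) : ℝ) ^ r)]
      have hp : (1 : ℝ) ≤ ((n0 + k : ℕ) : ℝ) ^ r := one_le_pow₀ (hpos k)
      have hp0 : (0 : ℝ) < ((n0 + k : ℕ) : ℝ) ^ r := by linarith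
      rw [div_lt_iff₀ hp0]
      rw [div_le_iff₀ hp0] at k2
      refine k1.trans_lt ?_
      have h3 : ε' * (2 + |c|) = ε / 2 := by rw [hε']; field_simp
      have h4 : ε' * (1 + iter m d n0 k (X (n0 + k)) g0) ≤
          ε' * ((2 + |c|) * ((n0 + k : ℕ) : ℝ) ^ r) :=
        mul_le_mul_of_nonneg_left (by linarith) hε'0.le
      nlinarith
    have h3 := h2.add (hc.const_mul c1)
    rw [zero_add] at h3
    refine h3.congr fun k => ?_
    ring
  obtain ⟨e, he⟩ := tendsto_pow_div_pow hρ n0 hn0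
  refine ⟨_, (h1.mul he).congr fun k => ?_⟩
  have hn : (0 : ℝ) < ((n0 + k : ℕ) : ℝ) := by linarith [hpos k]
  have e1 : iter m d n0 k (fun g => X (n0 + k) g * q (n0 + k, (lowDegSet d g (n0 + k)).card)) g0 =
      ((n0 + k : ℕ) : ℝ) ^ j *
        iter m d n0 k (fun g => X (n0 + k) g * u (lowDegSet d g (n0 + k)).card) g0 := by
    rw [← iter_mul]
    refine congrArg (fun F => iter m d n0 k F g0) (funext fun g => ?_)
    simp only [hq]; ring
  rw [e1, pow_add, pow_add, pow_one]
  field_simp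

theorem cnt_eq_zero (hg : Good m d n g) {v : V} (hv : v ∈ K) (h0 : D v < m) :
    cnt H K D g n = 0 := by
  rw [cnt, Finset.card_eq_zero]
  refine Finset.eq_empty_of_forall_notMem fun f hf => ?_
  rw [mem_emb] at hf
  have := hg.le_deg _ (hf.mem v hv)
  rw [hf.deg v hv] at this
  omega

theorem cnt_empty (g : SimpleGraph ℕ) (n : ℕ) : cnt H ∅ D g n = 1 := by
  rw [cnt, Finset.card_eq_one]
  refine ⟨fun _ => 0, ?_⟩
  ext f
  rw [mem_emb, Finset.mem_singleton]
  constructor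
  · exact fun h => funext fun v => h.off v (by simp)
  · rintro rfl
    exact ⟨by simp, by simp, by simp, by simp, by simp⟩

theorem tendsto_cnt (hm : 1 ≤ m) (hd : 2 * m < d) (hg : Good m d n0 g0)
    (hD : ∀ v ∈ K, D v ≤ d) (hU : Unsat d H K D) :
    ∃ c : ℝ, Tendsto (fun k : ℕ => iter m d n0 k (fun g => (cnt H K D g (n0 + k) : ℝ)) g0 /
      ((n0 + k : ℕ) : ℝ) ^ abComps m d H K D) atTop (𝓝 c) := by
  obtain ⟨l, hl, hUl, hLl⟩ := exists_density hm hd hg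
  have hn0 : 1 ≤ n0 := by have := hg.le_n; omega
  have hpos : ∀ k : ℕ, (1 : ℝ) ≤ ((n0 + k : ℕ) : ℝ) := fun k => by
    exact_mod_cast (by omega : 1 ≤ n0 + k)
  induction hs : K.card + ∑ v ∈ K, D v using Nat.strong_induction_on generalizing K D with
  | _ s ih =>
  subst hs
  by_cases hlow : ∃ v ∈ K, D v < m
  · obtain ⟨v, hv, hvm⟩ := hlow
    refine ⟨0, tendsto_const_nhds.congr fun k => ?_⟩
    rw [iter_congr hd hg (f' := fun _ => 0) fun g' hg' => by
      rw [cnt_eq_zero hg' hv hvm, Nat.cast_zero], iter_const hd hg, zero_div]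
  push Not at hlow
  have hD1 : ∀ v ∈ K, 1 ≤ D v := fun v hv => hm.trans (hlow v hv)
  rcases K.eq_empty_or_nonempty with rfl | hKne
  · refine ⟨1, tendsto_const_nhds.congr fun k => ?_⟩
    simp only [cnt_empty, Nat.cast_one]
    rw [iter_const hd hg]
    simp [abComps, comps]
  set ρ := abComps m d H K D with hρ
  have hσ : 1 ≤ unsat d K D := by
    obtain ⟨v, hv⟩ := hKne
    obtain ⟨u, hu, -, hlt⟩ := hU v hv
    exact Finset.card_pos.2 ⟨u, Finset.mem_filter.2 ⟨hu, hlt⟩⟩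
  have hsumlt : ∀ U ⊆ K, U.Nonempty → ∑ v ∈ K, lower D U v < ∑ v ∈ K, D v := by
    intro U hU ⟨u, hu⟩
    refine Finset.sum_lt_sum (fun v _ => Nat.sub_le _ _) ⟨u, hU hu, ?_⟩
    have := hD1 u (hU hu)
    simp only [lower, hu, if_true]; omega
  have hlowle : ∀ U v, lower D U v ≤ D v := fun U v => Nat.sub_le _ _
  -- the terms where vertices are hit
  have hhit : ∀ U ∈ K.powerset.erase ∅, ∃ c' : ℝ, Tendsto (fun k : ℕ =>
      iter m d n0 k (fun g => (cnt H K (lower D U) g (n0 + k) : ℝ) *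
        pr m (lowDegSet d g (n0 + k)).card (unsat d K (lower D U)) U.card) g0 *
        ((n0 + k : ℕ) : ℝ) / ((n0 + k : ℕ) : ℝ) ^ ρ) atTop (𝓝 c') := by
    intro U hUm
    rw [Finset.mem_erase, Finset.mem_powerset] at hUm
    have hUne := Finset.nonempty_of_ne_empty hUm.1
    obtain ⟨c, hc⟩ := ih _ (Nat.add_lt_add_left (hsumlt U hUm.2 hUne) _)
      (fun v hv => (hlowle U v).trans (hD v hv)) (hU.lower U) rfl
    have h1 : abComps m d H K (lower D U) ≤ ρ := abComps_mono (fun v _ => hlowle U v) hD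
    have h2 := hUne.card_pos
    exact tendsto_iter_mul (X := fun n g => (cnt H K (lower D U) g n : ℝ)) hd hg hn0 hl hUl hLl
      (fun _ _ => Nat.cast_nonneg _) (fun n g hg' => cnt_le hm hg') hc
      (tendsto_pow_mul_pr m _ U.card) (by omega)
  -- the terms involving the new vertex
  have hnew : ∀ h ∈ K.filter (D · = m), ∃ c' : ℝ, Tendsto (fun k : ℕ =>
      iter m d n0 k (fun g => (cnt H (K.erase h) (lower D (nbrs H K h)) g (n0 + k) : ℝ) *
        pr m (lowDegSet d g (n0 + k)).card (unsat d (K.erase h) (lower D (nbrs H K h)))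
          (nbrs H K h).card) g0 *
        ((n0 + k : ℕ) : ℝ) / ((n0 + k : ℕ) : ℝ) ^ ρ) atTop (𝓝 c') := by
    intro h hh
    rw [Finset.mem_filter] at hh
    by_cases hN : (nbrs H K h).card ≤ m
    · have hsub : K.erase h ⊆ K := Finset.erase_subset _ _
      have hnh : h ∉ K.erase h := Finset.notMem_erase _ _
      have hins : insert h (K.erase h) = K := Finset.insert_erase hh.1
      have hnb : nbrs H (K.erase h) h = nbrs H K h := by
        ext v
        simp only [mem_nbrs, Finset.mem_erase]
        exact ⟨fun h1 => ⟨h1.1.2, h1.2⟩, fun h1 => ⟨⟨h1.2.ne', h1.1⟩, h1.2⟩⟩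
      have hU' : Unsat d H (insert h (K.erase h)) D := by rwa [hins]
      have hUe := hU'.erase hnh (fun v hv => hD1 v (hsub hv)) (fun v hv => hD v (hsub hv))
      have hab := abComps_insert (m := m) (d := d) (H := H) (D := D) hnh hh.2 (by rwa [hnb])
        (fun v hv => hD1 v (hsub hv)) (fun v hv => hD v (hsub hv))
      rw [hnb] at hUe hab
      rw [hins, ← hρ] at hab
      obtain ⟨c, hc⟩ := ih ((K.erase h).card + ∑ v ∈ K.erase h, lower D (nbrs H K h) v) (by
        have h1 := Finset.card_erase_lt_of_mem hh.1
        have h2 : ∑ v ∈ K.erase h, lower D (nbrs H K h) v ≤ ∑ v ∈ K, D v :=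
          (Finset.sum_le_sum fun v _ => hlowle _ v).trans (Finset.sum_le_sum_of_subset hsub)
        omega) (fun v hv => (hlowle _ v).trans (hD v (hsub hv))) hUe rfl
      exact tendsto_iter_mul (X := fun n g => (cnt H (K.erase h) (lower D (nbrs H K h)) g n : ℝ))
        hd hg hn0 hl hUl hLl (fun _ _ => Nat.cast_nonneg _) (fun n g hg' => cnt_le hm hg') hc
        (tendsto_pow_mul_pr m _ _) hab
    · refine ⟨0, tendsto_const_nhds.congr fun k => ?_⟩
      rw [iter_congr hd hg (f' := fun _ => 0) fun g' _ => by rw [pr, if_neg hN, mul_zero],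
        iter_const hd hg, zero_mul, zero_div]
  choose! c1 hc1 using hhit
  choose! c2 hc2 using hnew
  have hr := (tendsto_finsetSum _ hc1).add (tendsto_finsetSum _ hc2)
  -- the term where nothing happens
  obtain ⟨C, hC⟩ := bounded_ratio 1 m (u := fun L => 1 - pr m L (unsat d K D) 0)
    (by simpa using tendsto_mul_one_sub_pr m (unsat d K D))
  have hy := iter_mul_ratio hd hg hUl hLl (X := fun n g => (cnt H K D g n : ℝ) / (n : ℝ) ^ ρ)
    (s := 2 * Fintype.card V) (fun n g => by positivity) (fun n g hg' => by
      have h1 : (1 : ℝ) ≤ n := by exact_mod_cast (by have := hg'.le_n; omega : 1 ≤ n)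
      exact (div_le_self (Nat.cast_nonneg _) (one_le_pow₀ h1)).trans (cnt_le hm hg'))
    (q := fun p => (p.1 : ℝ) ^ 1 * (1 - pr m p.2 (unsat d K D) 0))
    (tendsto_ratio_inv hl 1 (by simpa using tendsto_mul_one_sub_pr m (unsat d K D))) hC
  have hiter : ∀ k, iter m d n0 k (fun g => (cnt H K D g (n0 + k) : ℝ) / ((n0 + k : ℕ) : ℝ) ^ ρ) g0 =
      iter m d n0 k (fun g => (cnt H K D g (n0 + k) : ℝ)) g0 / ((n0 + k : ℕ) : ℝ) ^ ρ := fun k => by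
    rw [div_eq_inv_mul, ← iter_mul]
    exact congrArg (fun F => iter m d n0 k F g0) (funext fun g => by rw [div_eq_inv_mul])
  simp only [hiter] at hy
  have hm' : (0 : ℝ) < m := by exact_mod_cast hm
  have hσ' : (0 : ℝ) < unsat d K D := by exact_mod_cast hσ
  refine ⟨_, tendsto_of_renormalised_recursion (ρ := ρ) hn0 (by positivity) (fun k => ?_) hy hr fun k => ?_⟩
  · exact div_nonneg (iter_nonneg hd hg fun _ _ => Nat.cast_nonneg _) (by positivity)
  · have hn : (0 : ℝ) < ((n0 + k : ℕ) : ℝ) := by linarith [hpos k]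
    have e1 : iter m d n0 (k + 1) (fun g => (cnt H K D g (n0 + (k + 1)) : ℝ)) g0 =
        iter m d n0 k (fun g => (cnt H K D g (n0 + k) : ℝ) -
          (cnt H K D g (n0 + k) : ℝ) * (1 - pr m (lowDegSet d g (n0 + k)).card (unsat d K D) 0) +
          (∑ U ∈ K.powerset.erase ∅, (cnt H K (lower D U) g (n0 + k) : ℝ) *
            pr m (lowDegSet d g (n0 + k)).card (unsat d K (lower D U)) U.card +
          ∑ h ∈ K.filter (D · = m), (cnt H (K.erase h) (lower D (nbrs H K h)) g (n0 + k) : ℝ) *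
            pr m (lowDegSet d g (n0 + k)).card (unsat d (K.erase h) (lower D (nbrs H K h)))
              (nbrs H K h).card)) g0 := by
      rw [iter_succ]
      refine iter_congr hd hg fun g' hg' => ?_
      have h1 := step_cnt (H := H) hg' hm hd hD
      rw [← add_assoc n0 k 1, h1,
        ← Finset.add_sum_erase K.powerset _ (Finset.empty_mem_powerset K)]
      have h2 : lower D ∅ = D := by funext v; simp [lower]
      rw [h2, Finset.card_empty]
      ring
    rw [e1, iter_add, iter_sub, iter_add, iter_sum, iter_sum, ← Finset.sum_div, ← Finset.sum_div]
    have e2 : iter m d n0 k (fun g => (cnt H K D g (n0 + k) : ℝ) / ((n0 + k : ℕ) : ℝ) ^ ρ *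
        ((((n0 + k : ℕ) : ℝ)) ^ 1 * (1 - pr m (lowDegSet d g (n0 + k)).card (unsat d K D) 0))) g0 =
        ((n0 + k : ℕ) : ℝ) / ((n0 + k : ℕ) : ℝ) ^ ρ * iter m d n0 k (fun g => (cnt H K D g (n0 + k) : ℝ) *
          (1 - pr m (lowDegSet d g (n0 + k)).card (unsat d K D) 0)) g0 := by
      rw [← iter_mul]
      exact congrArg (fun F => iter m d n0 k F g0) (funext fun g => by ring)
    rw [e2, ← Finset.sum_mul, ← Finset.sum_mul, div_pow]
    rw [← add_assoc n0 k 1]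
    push_cast at hn ⊢
    field_simp

end UA

namespace UA

/-! ### Balls -/

open Classical in
/-- The closed neighbourhood of a set of vertices. -/
noncomputable def nbh (g : SimpleGraph ℕ) (n : ℕ) (A : Finset ℕ) : Finset ℕ :=
  A ∪ (Finset.Icc 1 n).filter (fun b => ∃ a ∈ A, g.Adj a b)

/-- The ball of radius `r` around a set of vertices. -/
noncomputable def ball (g : SimpleGraph ℕ) (n r : ℕ) (A : Finset ℕ) : Finset ℕ := (nbh g n)^[r] A

section Balls

variable {m d n : ℕ} {g : SimpleGraph ℕ} {A B : Finset ℕ}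

theorem mem_nbh (hg : Good m d n g) {b : ℕ} : b ∈ nbh g n A ↔ b ∈ A ∨ ∃ a ∈ A, g.Adj a b := by
  simp only [nbh, Finset.mem_union, Finset.mem_filter]
  refine or_congr_right ⟨fun h => h.2, fun h => ⟨?_, h⟩⟩
  obtain ⟨a, -, ha⟩ := h
  exact hg.mem_of_adj' ha

theorem subset_nbh (g : SimpleGraph ℕ) (n : ℕ) (A : Finset ℕ) : A ⊆ nbh g n A :=
  Finset.subset_union_left

theorem ball_zero (g : SimpleGraph ℕ) (n : ℕ) (A : Finset ℕ) : ball g n 0 A = A := rfl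

theorem ball_succ (g : SimpleGraph ℕ) (n r : ℕ) (A : Finset ℕ) :
    ball g n (r + 1) A = nbh g n (ball g n r A) := by
  rw [ball, Function.iterate_succ', Function.comp, ball]

theorem ball_ball (g : SimpleGraph ℕ) (n r s : ℕ) (A : Finset ℕ) :
    ball g n r (ball g n s A) = ball g n (r + s) A := by
  rw [ball, ball, ball, Function.iterate_add, Function.comp]

theorem ball_mono_radius (g : SimpleGraph ℕ) (n : ℕ) (A : Finset ℕ) {r s : ℕ} (h : r ≤ s) :
    ball g n r A ⊆ ball g n s A := by
  induction s, h using Nat.le_induction with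
  | base => exact subset_rfl
  | succ s _ ih => rw [ball_succ]; exact ih.trans (subset_nbh _ _ _)

theorem subset_ball (g : SimpleGraph ℕ) (n r : ℕ) (A : Finset ℕ) : A ⊆ ball g n r A :=
  ball_mono_radius g n A (Nat.zero_le r)

theorem Good.graphDeg_le (hg : Good m d n g) (v : ℕ) : graphDeg g v ≤ d := by
  by_cases hv : v ∈ Finset.Icc 1 n
  · exact hg.deg_le v hv
  · have : g.neighborSet v = ∅ := Set.eq_empty_of_forall_notMem fun b hb =>
      hv (hg.mem_of_adj v b hb)
    simp [graphDeg, this]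

theorem card_nbh_le (hg : Good m d n g) (A : Finset ℕ) :
    (nbh g n A).card ≤ (d + 1) * A.card := by
  classical
  have h1 : nbh g n A ⊆ A.biUnion fun a => insert a (hg.finite_nbr a).toFinset := by
    intro b hb
    rw [mem_nbh hg] at hb
    rw [Finset.mem_biUnion]
    rcases hb with hb | ⟨a, ha, hab⟩
    · exact ⟨b, hb, Finset.mem_insert_self _ _⟩
    · exact ⟨a, ha, Finset.mem_insert_of_mem (by simpa using hab)⟩
  refine (Finset.card_le_card h1).trans ((Finset.card_biUnion_le_card_mul _ _ (d + 1) ?_).trans_eq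
    (mul_comm _ _))
  intro a _
  refine (Finset.card_insert_le _ _).trans (Nat.succ_le_succ ?_)
  rw [← Set.ncard_eq_toFinset_card _ (hg.finite_nbr a)]
  exact hg.graphDeg_le a

theorem card_ball_le (hg : Good m d n g) (r : ℕ) (A : Finset ℕ) :
    (ball g n r A).card ≤ (d + 1) ^ r * A.card := by
  induction r with
  | zero => simp [ball_zero]
  | succ r ih =>
    rw [ball_succ, pow_succ']
    refine (card_nbh_le hg _).trans ?_
    rw [mul_assoc]
    exact Nat.mul_le_mul_left _ ih

theorem conn_subset_ball (hg : Good m d n g) {W : Finset ℕ} {x : ℕ} (hx : x ∈ W)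
    (hc : ∀ w ∈ W, Conn g W x w) : W ⊆ ball g n W.card {x} := by
  have key : ∀ r, W ⊆ ball g n r {x} ∨ r + 1 ≤ (W ∩ ball g n r {x}).card := by
    intro r
    induction r with
    | zero => exact Or.inr (Finset.card_pos.2 ⟨x, by simp [ball_zero, hx]⟩)
    | succ r ih =>
      have hmono := ball_mono_radius g n {x} (Nat.le_succ r)
      rcases ih with ih | ih
      · exact Or.inl (ih.trans hmono)
      by_cases he : W ∩ ball g n (r + 1) {x} ⊆ W ∩ ball g n r {x}
      · left
        intro w hw
        have h1 := (hc w hw).restrict (K' := W ∩ ball g n r {x})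
          (Finset.mem_inter.2 ⟨hx, subset_ball _ _ _ _ (by simp)⟩) (fun a ha b hb hab =>
            he (Finset.mem_inter.2 ⟨hb, by
              rw [ball_succ, mem_nbh hg]
              exact Or.inr ⟨a, (Finset.mem_inter.1 ha).2, hab⟩⟩))
        exact hmono (Finset.mem_inter.1 h1.1).2
      · right
        have h2 : W ∩ ball g n r {x} ⊂ W ∩ ball g n (r + 1) {x} :=
          ⟨Finset.inter_subset_inter_left hmono, he⟩
        have := Finset.card_lt_card h2
        omega
  rcases key W.card with h | h
  · exact h
  · have := Finset.card_le_card (Finset.inter_subset_left : W ∩ ball g n W.card {x} ⊆ W)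
    omega

end Balls

/-! ### Deterministic bounds for connected patterns -/

/-- A bound for the number of embeddings of a connected pattern with one prescribed value. -/
def fib (d s : ℕ) : ℕ := ((d + 1) ^ s + 1) ^ s

section Fibers

variable {V : Type*} [Fintype V] [DecidableEq V] {H : SimpleGraph V} {K : Finset V} {D : V → ℕ}
  {m d n n0 : ℕ} {g g0 : SimpleGraph ℕ} {v : V}

theorem IsEmb.conn {f : V → ℕ} (hf : IsEmb H K D g n f) {u w : V} (h : Conn H K u w) :
    Conn g (K.image f) (f u) (f w) :=
  h.map (fun _ hv => Finset.mem_image_of_mem f hv) fun u hu w hw huw => (hf.adj u hu w hw).1 huw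

theorem IsEmb.mem_ball (hg : Good m d n g) {f : V → ℕ} (hf : IsEmb H K D g n f) (hv : v ∈ K)
    (hc : ∀ w ∈ K, Conn H K v w) {w : V} (hw : w ∈ K) : f w ∈ ball g n (Fintype.card V) {f v} := by
  have h1 := conn_subset_ball hg (Finset.mem_image_of_mem f hv) (fun y hy => by
    obtain ⟨w, hw, rfl⟩ := Finset.mem_image.1 hy
    exact hf.conn (hc w hw)) (Finset.mem_image_of_mem f hw)
  exact ball_mono_radius _ _ _ (Finset.card_image_le.trans (Finset.card_le_univ K)) h1

theorem card_fiber_le (hg : Good m d n g) (hv : v ∈ K) (hc : ∀ w ∈ K, Conn H K v w) (x : ℕ) :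
    ((emb H K D g n).filter (fun f => f v = x)).card ≤ fib d (Fintype.card V) := by
  have h1 : (emb H K D g n).filter (fun f => f v = x) ⊆
      Fintype.piFinset fun _ : V => insert 0 (ball g n (Fintype.card V) {x}) := by
    intro f hf
    rw [Finset.mem_filter, mem_emb] at hf
    obtain ⟨hf, rfl⟩ := hf
    rw [Fintype.mem_piFinset]
    intro w
    by_cases hw : w ∈ K
    · exact Finset.mem_insert_of_mem (hf.mem_ball hg hv hc hw)
    · rw [hf.off w hw]; exact Finset.mem_insert_self _ _
  refine (Finset.card_le_card h1).trans ?_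
  rw [Fintype.card_piFinset, Finset.prod_const, Finset.card_univ, fib]
  refine Nat.pow_le_pow_left ((Finset.card_insert_le _ _).trans ?_) _
  have := card_ball_le hg (Fintype.card V) {x}
  simpa using this

/-- The number of embeddings of a connected pattern which meet a given set. -/
theorem card_meet_le (hg : Good m d n g) (hc : ∀ u ∈ K, ∀ w ∈ K, Conn H K u w) (A : Finset ℕ) :
    ((emb H K D g n).filter (fun f => ∃ v ∈ K, f v ∈ A)).card ≤
      Fintype.card V * (A.card * fib d (Fintype.card V)) := by
  have h1 : (emb H K D g n).filter (fun f => ∃ v ∈ K, f v ∈ A) ⊆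
      K.biUnion fun v => A.biUnion fun x => (emb H K D g n).filter (fun f => f v = x) := by
    intro f hf
    obtain ⟨hf, v, hv, hx⟩ := Finset.mem_filter.1 hf
    exact Finset.mem_biUnion.2 ⟨v, hv, Finset.mem_biUnion.2 ⟨f v, hx, Finset.mem_filter.2 ⟨hf, rfl⟩⟩⟩
  refine (Finset.card_le_card h1).trans ((Finset.card_biUnion_le_card_mul _ _ _ fun v hv =>
    Finset.card_biUnion_le_card_mul _ _ _ fun x _ => card_fiber_le hg hv (hc v hv) x).trans ?_)
  exact Nat.mul_le_mul_right _ (Finset.card_le_univ K)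

theorem cnt_mul_cnt_le (hg : Good m d n g) {A B : Finset V} (hAB : Disjoint A B)
    (hadj : ∀ a ∈ A, ∀ b ∈ B, ¬ H.Adj a b) (hc : ∀ u ∈ B, ∀ w ∈ B, Conn H B u w) :
    cnt H A D g n * cnt H B D g n ≤ cnt H (A ∪ B) D g n + cnt H A D g n *
      (Fintype.card V * ((d + 1) * Fintype.card V * fib d (Fintype.card V))) := by
  classical
  set bad : (V → ℕ) → (V → ℕ) → Prop := fun f f' => ∃ b ∈ B, f' b ∈ nbh g n (A.image f)
  have h1 : (emb H A D g n).card * (emb H B D g n).card =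
      ((emb H A D g n ×ˢ emb H B D g n).filter (fun p => ¬ bad p.1 p.2)).card +
      ((emb H A D g n ×ˢ emb H B D g n).filter (fun p => bad p.1 p.2)).card := by
    rw [← Finset.card_product, add_comm, Finset.card_filter_add_card_filter_not]
  have hoff : ∀ {v}, v ∈ A → v ∉ B := fun hA hB => Finset.disjoint_left.1 hAB hA hB
  rw [cnt, cnt, h1]
  refine add_le_add ?_ ?_
  · refine Finset.card_le_card_of_injOn (fun p v => p.1 v + p.2 v) ?_ ?_
    · rintro ⟨f, f'⟩ hp
      simp only [Finset.coe_filter, Finset.mem_product, mem_emb, Set.mem_ofPred_eq] at hp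
      obtain ⟨⟨hf, hf'⟩, hb⟩ := hp
      have eA : ∀ v ∈ A, f v + f' v = f v := fun v hv => by rw [hf'.off v (hoff hv), add_zero]
      have eB : ∀ v ∈ B, f v + f' v = f' v := fun v hv => by
        rw [hf.off v (fun h => hoff h hv), zero_add]
      have hne : ∀ a ∈ A, ∀ b ∈ B, f a ≠ f' b ∧ ¬ g.Adj (f a) (f' b) := by
        intro a ha b hb'
        have : f' b ∉ nbh g n (A.image f) := fun h => hb ⟨b, hb', h⟩
        rw [mem_nbh hg] at this
        push Not at this
        exact ⟨fun h => this.1 (h ▸ Finset.mem_image_of_mem f ha),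
          this.2 _ (Finset.mem_image_of_mem f ha)⟩
      rw [Finset.mem_coe, mem_emb]
      refine ⟨?_, ?_, ?_, ?_, ?_⟩
      · intro v hv
        rcases Finset.mem_union.1 hv with h | h
        · simpa only [eA v h] using hf.mem v h
        · simpa only [eB v h] using hf'.mem v h
      · intro v hv
        rw [Finset.mem_union, not_or] at hv
        simp only [hf.off v hv.1, hf'.off v hv.2]
      · intro u hu v hv huv
        simp only [Finset.coe_union, Set.mem_union, Finset.mem_coe] at hu hv
        simp only at huv
        rcases hu with hu | hu <;> rcases hv with hv | hv
        · rw [eA u hu, eA v hv] at huv; exact hf.inj hu hv huv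
        · rw [eA u hu, eB v hv] at huv; exact absurd huv (hne u hu v hv).1
        · rw [eB u hu, eA v hv] at huv; exact absurd huv.symm (hne v hv u hu).1
        · rw [eB u hu, eB v hv] at huv; exact hf'.inj hu hv huv
      · intro u hu v hv
        simp only
        rcases Finset.mem_union.1 hu with hu | hu <;> rcases Finset.mem_union.1 hv with hv | hv
        · rw [eA u hu, eA v hv]; exact hf.adj u hu v hv
        · rw [eA u hu, eB v hv]; exact iff_of_false (hadj u hu v hv) (hne u hu v hv).2
        · rw [eB u hu, eA v hv]
          exact iff_of_false (fun h => hadj v hv u hu h.symm) fun h => (hne v hv u hu).2 h.symm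
        · rw [eB u hu, eB v hv]; exact hf'.adj u hu v hv
      · intro v hv
        simp only
        rcases Finset.mem_union.1 hv with h | h
        · rw [eA v h]; exact hf.deg v h
        · rw [eB v h]; exact hf'.deg v h
    · rintro ⟨f, f'⟩ hp ⟨e, e'⟩ hq h
      simp only [Finset.coe_filter, Finset.mem_product, mem_emb, Set.mem_ofPred_eq] at hp hq
      have h' : ∀ v, f v + f' v = e v + e' v := fun v => congrFun h v
      have : ∀ v, f v = e v ∧ f' v = e' v := by
        intro v
        have hv := h' v
        by_cases hA : v ∈ A
        · rw [hp.1.2.off v (hoff hA), hq.1.2.off v (hoff hA)] at hv ⊢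
          exact ⟨by omega, rfl⟩
        · rw [hp.1.1.off v hA, hq.1.1.off v hA] at hv ⊢
          exact ⟨rfl, by omega⟩
      exact Prod.ext (funext fun v => (this v).1) (funext fun v => (this v).2)
  · have h2 : (emb H A D g n ×ˢ emb H B D g n).filter (fun p => bad p.1 p.2) ⊆
        (emb H A D g n).biUnion fun f => ((emb H B D g n).filter (bad f)).image (Prod.mk f) := by
      rintro ⟨f, f'⟩ hp
      simp only [Finset.mem_filter, Finset.mem_product] at hp
      exact Finset.mem_biUnion.2 ⟨f, hp.1.1, Finset.mem_image_of_mem _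
        (Finset.mem_filter.2 ⟨hp.1.2, hp.2⟩)⟩
    refine (Finset.card_le_card h2).trans (Finset.card_biUnion_le_card_mul _ _ _ fun f _ => ?_)
    refine Finset.card_image_le.trans ((card_meet_le hg hc _).trans ?_)
    gcongr
    refine (card_nbh_le hg _).trans ?_
    gcongr
    exact Finset.card_image_le.trans (Finset.card_le_univ A)

theorem cnt_congr {D' : V → ℕ} (h : ∀ v ∈ K, D v = D' v) (g : SimpleGraph ℕ) (n : ℕ) :
    cnt H K D g n = cnt H K D' g n := by
  rw [cnt, cnt]
  congr 1
  ext f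
  rw [mem_emb, mem_emb]
  exact ⟨fun hf => ⟨hf.mem, hf.off, hf.inj, hf.adj, fun v hv => (hf.deg v hv).trans (h v hv)⟩,
    fun hf => ⟨hf.mem, hf.off, hf.inj, hf.adj, fun v hv => (hf.deg v hv).trans (h v hv).symm⟩⟩

theorem lower_empty (D : V → ℕ) : lower D ∅ = D := by funext v; simp [lower]

theorem cnt_attach_sub_le (hm : 1 ≤ m) (hd : 2 * m < d) (hg : Good m d n g)
    (hc : ∀ u ∈ K, ∀ w ∈ K, Conn H K u w) {S : Finset ℕ} (hS : S ⊆ lowDegSet d g n)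
    (hS' : S.card = m) :
    |(cnt H K D (attachStep g (n + 1) S) (n + 1) : ℝ) - cnt H K D g n| ≤
      (Fintype.card V * ((m + 1) * fib d (Fintype.card V)) : ℕ) := by
  classical
  have hg' := hg.attach (by omega) hS hS'
  have hSn := hS.trans (lowDegSet_subset d g n)
  have hnS : n + 1 ∉ S := fun h => by have := hSn h; simp at this
  have hcomm : ∀ f : V → ℕ, (¬ ∃ v ∈ K, f v ∈ insert (n + 1) S) →
      (f ∈ emb H K D (attachStep g (n + 1) S) (n + 1) ↔ f ∈ emb H K D g n) := by
    intro f hf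
    push Not at hf
    have h1 : hitSet K f S = ∅ := Finset.filter_eq_empty_iff.2 fun v hv h =>
      hf v hv (Finset.mem_insert_of_mem h)
    have h2 := isEmb_attach_old (H := H) (K := K) (D := D) hg (S := S) f hm
    rw [h1, lower_empty] at h2
    rw [mem_emb, mem_emb, ← h2]
    exact ⟨fun h => ⟨h, fun ⟨v, hv, e⟩ => hf v hv (e ▸ Finset.mem_insert_self _ _)⟩, fun h => h.1⟩
  have hA : (insert (n + 1) S).card = m + 1 := by rw [Finset.card_insert_of_notMem hnS, hS']
  have b1 := card_meet_le (D := D) hg' hc (insert (n + 1) S)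
  have b2 := card_meet_le (D := D) hg hc (insert (n + 1) S)
  rw [hA] at b1 b2
  have e1 := Finset.card_filter_add_card_filter_not (s := emb H K D (attachStep g (n + 1) S) (n + 1))
    (fun f => ∃ v ∈ K, f v ∈ insert (n + 1) S)
  have e2 := Finset.card_filter_add_card_filter_not (s := emb H K D g n)
    (fun f => ∃ v ∈ K, f v ∈ insert (n + 1) S)
  have e3 : (emb H K D (attachStep g (n + 1) S) (n + 1)).filter
      (fun f => ¬ ∃ v ∈ K, f v ∈ insert (n + 1) S) =
      (emb H K D g n).filter (fun f => ¬ ∃ v ∈ K, f v ∈ insert (n + 1) S) := by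
    ext f
    simp only [Finset.mem_filter]
    exact ⟨fun h => ⟨(hcomm f h.2).1 h.1, h.2⟩, fun h => ⟨(hcomm f h.2).2 h.1, h.2⟩⟩
  rw [e3] at e1
  rw [cnt, cnt, abs_le]
  constructor
  · have : (emb H K D g n).card ≤ (emb H K D (attachStep g (n + 1) S) (n + 1)).card +
      Fintype.card V * ((m + 1) * fib d (Fintype.card V)) := by omega
    have : ((emb H K D g n).card : ℝ) ≤ (emb H K D (attachStep g (n + 1) S) (n + 1)).card +
      (Fintype.card V * ((m + 1) * fib d (Fintype.card V)) : ℕ) := by exact_mod_cast this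
    linarith
  · have : (emb H K D (attachStep g (n + 1) S) (n + 1)).card ≤ (emb H K D g n).card +
      Fintype.card V * ((m + 1) * fib d (Fintype.card V)) := by omega
    have : ((emb H K D (attachStep g (n + 1) S) (n + 1)).card : ℝ) ≤ (emb H K D g n).card +
      (Fintype.card V * ((m + 1) * fib d (Fintype.card V)) : ℕ) := by exact_mod_cast this
    linarith

end Fibers

end UA

namespace UA

/-! ### Abundant patterns are abundant -/

variable {V : Type*} [Fintype V] [DecidableEq V] {H : SimpleGraph V} {K : Finset V} {D : V → ℕ}
  {m d n n0 : ℕ} {g g0 : SimpleGraph ℕ} {v : V}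

/-- The pattern has linearly many embeddings, up to exponentially small probabilities. -/
def Linear (m d n0 : ℕ) (g0 : SimpleGraph ℕ) (H : SimpleGraph V) (K : Finset V) (D : V → ℕ) : Prop :=
  ∃ β : ℝ, 0 < β ∧ ExpSmall m d n0 g0 (fun n g => (cnt H K D g n : ℝ) < β * n)

theorem Linear.congr {D' : V → ℕ} (h : Linear m d n0 g0 H K D) (hD : ∀ v ∈ K, D v = D' v) :
    Linear m d n0 g0 H K D' := by
  obtain ⟨β, hβ, hE⟩ := h
  refine ⟨β, hβ, ?_⟩
  simpa only [cnt_congr hD] using hE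

theorem exists_le_pr (m σ j : ℕ) (hj : j ≤ m) : ∃ c : ℝ, 0 < c ∧ ∃ L0 : ℕ, ∀ L n : ℕ, L0 ≤ L →
    L ≤ n → c ≤ (n : ℝ) ^ j * pr m L σ j := by
  have h := tendsto_pow_mul_pr m σ j
  have hpos : (0 : ℝ) < m.descFactorial j := by
    exact_mod_cast Nat.pos_of_ne_zero fun h => by rw [Nat.descFactorial_eq_zero_iff_lt] at h; omega
  obtain ⟨L0, hL0⟩ := eventually_atTop.1 (h.eventually_const_le (half_lt_self hpos))
  refine ⟨_, half_pos hpos, L0, fun L n hL hLn => (hL0 L hL).trans ?_⟩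
  have := pr_nonneg m L σ j
  gcongr

theorem le_step_cnt (hg : Good m d n g) (hm : 1 ≤ m) (hd : 2 * m < d) (hD : ∀ v ∈ K, D v ≤ d)
    {U : Finset V} (hU : U ⊆ K) (hne : U.Nonempty) :
    (cnt H K D g n : ℝ) * pr m (lowDegSet d g n).card (unsat d K D) 0 +
      cnt H K (lower D U) g n * pr m (lowDegSet d g n).card (unsat d K (lower D U)) U.card ≤
    step m d n (fun g' => (cnt H K D g' (n + 1) : ℝ)) g := by
  rw [step_cnt hg hm hd hD]
  have h1 : (0 : ℝ) ≤ ∑ h ∈ K.filter (D · = m),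
      (cnt H (K.erase h) (lower D (nbrs H K h)) g n : ℝ) *
        pr m (lowDegSet d g n).card (unsat d (K.erase h) (lower D (nbrs H K h)))
          (nbrs H K h).card := Finset.sum_nonneg fun h _ => mul_nonneg (Nat.cast_nonneg _) (pr_nonneg ..)
  have h2 := Finset.sum_le_sum_of_subset_of_nonneg (s := {∅, U}) (t := K.powerset)
    (f := fun U => (cnt H K (lower D U) g n : ℝ) *
        pr m (lowDegSet d g n).card (unsat d K (lower D U)) U.card) (by
      intro W hW
      simp only [Finset.mem_insert, Finset.mem_singleton] at hW
      rcases hW with rfl | rfl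
      · exact Finset.empty_mem_powerset _
      · exact Finset.mem_powerset.2 hU)
    (fun _ _ _ => mul_nonneg (Nat.cast_nonneg _) (pr_nonneg ..))
  rw [Finset.sum_pair hne.ne_empty.symm, lower_empty, Finset.card_empty] at h2
  linarith

theorem le_step_cnt_new (hg : Good m d n g) (hm : 1 ≤ m) (hd : 2 * m < d) (hD : ∀ v ∈ K, D v ≤ d)
    {h : V} (hh : h ∈ K) (hDh : D h = m) :
    (cnt H K D g n : ℝ) * pr m (lowDegSet d g n).card (unsat d K D) 0 +
      cnt H (K.erase h) (lower D (nbrs H K h)) g n *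
        pr m (lowDegSet d g n).card (unsat d (K.erase h) (lower D (nbrs H K h)))
          (nbrs H K h).card ≤
    step m d n (fun g' => (cnt H K D g' (n + 1) : ℝ)) g := by
  rw [step_cnt hg hm hd hD]
  have h1 := Finset.single_le_sum (s := K.powerset)
    (f := fun U => (cnt H K (lower D U) g n : ℝ) *
        pr m (lowDegSet d g n).card (unsat d K (lower D U)) U.card)
    (fun _ _ => mul_nonneg (Nat.cast_nonneg _) (pr_nonneg ..)) (Finset.empty_mem_powerset K)
  have h2 := Finset.single_le_sum (s := K.filter (D · = m))
    (f := fun h => (cnt H (K.erase h) (lower D (nbrs H K h)) g n : ℝ) *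
        pr m (lowDegSet d g n).card (unsat d (K.erase h) (lower D (nbrs H K h)))
          (nbrs H K h).card)
    (fun _ _ => mul_nonneg (Nat.cast_nonneg _) (pr_nonneg ..)) (Finset.mem_filter.2 ⟨hh, hDh⟩)
  simp only [lower_empty, Finset.card_empty] at h1
  linarith

theorem linear_of_gain (hm : 1 ≤ m) (hd : 2 * m < d) (hg : Good m d n0 g0)
    (hc : ∀ u ∈ K, ∀ w ∈ K, Conn H K u w) {γ : ℝ} (hγ : 0 < γ)
    {B : ℕ → SimpleGraph ℕ → Prop} (hB : ExpSmall m d n0 g0 B)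
    (hgain : ∀ᶠ n in atTop, ∀ g, Good m d n g → ¬ B n g →
      (cnt H K D g n : ℝ) * pr m (lowDegSet d g n).card (unsat d K D) 0 + γ ≤
        step m d n (fun g' => (cnt H K D g' (n + 1) : ℝ)) g) :
    Linear m d n0 g0 H K D := by
  obtain ⟨C, hC⟩ := bounded_ratio 1 m (u := fun L => 1 - pr m L (unsat d K D) 0)
    (by simpa using tendsto_mul_one_sub_pr m (unsat d K D))
  have hC0 : 0 ≤ C := (abs_nonneg _).trans (hC 0 0 (by simp))
  set β := γ / (2 * (1 + C)) with hβ
  have hβ0 : 0 < β := by positivity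
  have hβC : β * (1 + C) = γ / 2 := by rw [hβ]; field_simp
  set F : ℕ := Fintype.card V * ((m + 1) * fib d (Fintype.card V))
  have hE := expSmall_of_drift (Y := fun n g => β * n - cnt H K D g n) (C := β + F) (δ := γ / 2)
    hd hg (by positivity) (by positivity) hB (fun n g _ => by
      have : (0 : ℝ) ≤ cnt H K D g n := Nat.cast_nonneg _
      have : (0 : ℝ) ≤ F * n := by positivity
      nlinarith) (fun n g S hg' hS hS' => by
      have := cnt_attach_sub_le (H := H) (D := D) hm hd hg' hc hS hS'
      change |_| ≤ ((F : ℕ) : ℝ) at this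
      rw [abs_le] at this ⊢
      rw [Nat.cast_succ]
      constructor <;> linarith [this.1, this.2]) (by
      filter_upwards [hgain] with n hn g hg' hY hnB
      have h1 := hn g hg' hnB
      rw [step_sub, step_const hg' hd]
      have hn0 : (0 : ℝ) < n := by exact_mod_cast (by have := hg'.le_n; omega : 0 < n)
      have h2 := (abs_le.1 (hC n (lowDegSet d g n).card (by have := hg'.card_low hd; omega))).2
      rw [pow_one] at h2
      have h3 : (0 : ℝ) ≤ cnt H K D g n := Nat.cast_nonneg _
      have h4 : (cnt H K D g n : ℝ) * (1 - pr m (lowDegSet d g n).card (unsat d K D) 0) ≤ β * C := by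
        rcases le_or_gt (1 - pr m (lowDegSet d g n).card (unsat d K D) 0) 0 with h | h
        · exact (mul_nonpos_of_nonneg_of_nonpos h3 h).trans (by positivity)
        · calc _ ≤ β * n * (1 - pr m (lowDegSet d g n).card (unsat d K D) 0) := by
                gcongr; linarith
            _ = β * (n * (1 - pr m (lowDegSet d g n).card (unsat d K D) 0)) := by ring
            _ ≤ _ := by gcongr
      push_cast
      nlinarith) (ε := β / 2) (by positivity)
  refine ⟨β / 2, by positivity, hE.mono hd hg (Eventually.of_forall fun n g _ h => ?_)⟩
  linarith

theorem Linear.biUnion (hd : 2 * m < d) (hg : Good m d n0 g0)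
    {s : Finset (Finset V)} (hs : s ⊆ comps H K) (h : ∀ C ∈ s, Linear m d n0 g0 H C D) :
    ∃ β : ℝ, 0 < β ∧ ExpSmall m d n0 g0
      (fun n g => (cnt H (s.biUnion id) D g n : ℝ) < β * (n : ℝ) ^ s.card) := by
  induction s using Finset.induction_on with
  | empty =>
    refine ⟨1, one_pos, expSmall_false hd hg fun n g _ => ?_⟩
    simp [cnt_empty]
  | insert C s hCs ih =>
    obtain ⟨β, hβ, hE⟩ := ih (fun x hx => hs (Finset.mem_insert_of_mem hx))
      fun x hx => h x (Finset.mem_insert_of_mem hx)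
    obtain ⟨β', hβ', hE'⟩ := h C (Finset.mem_insert_self _ _)
    set F : ℕ := Fintype.card V * ((d + 1) * Fintype.card V * fib d (Fintype.card V))
    refine ⟨β * (β' / 2), by positivity, (hE.or hd hg hE').mono hd hg ?_⟩
    obtain ⟨N, hN⟩ := exists_nat_ge ((F : ℝ) * 2 / β')
    filter_upwards [eventually_ge_atTop N] with n hn g hg' hlt
    by_contra! hcon
    have hCc := hs (Finset.mem_insert_self C s)
    obtain ⟨v, hv, rfl⟩ := Finset.mem_image.1 hCc
    have hdis : ∀ x ∈ s, Disjoint x (compOf H K v) ∧ ∀ a ∈ x, ∀ b ∈ compOf H K v, ¬ H.Adj a b :=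
      fun x hx => mem_comps_disjoint (hs (Finset.mem_insert_of_mem hx)) hCc
        (fun e => hCs (e ▸ hx))
    have h1 := cnt_mul_cnt_le (D := D) hg' (A := s.biUnion id) (B := compOf H K v)
      ((Finset.disjoint_biUnion_left _ _ _).2 fun x hx => (hdis x hx).1) (fun a ha b hb => by
        obtain ⟨x, hx, hax⟩ := Finset.mem_biUnion.1 ha
        exact (hdis x hx).2 a hax b hb) (fun u hu w hw => by
        rw [mem_compOf] at hu hw
        exact (conn_compOf hu.2 hv).symm.trans (conn_compOf hw.2 hv))
    rw [Finset.union_comm, ← id_eq (compOf H K v), ← Finset.biUnion_insert, id_eq] at h1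
    have h2 : (cnt H (s.biUnion id) D g n : ℝ) * cnt H (compOf H K v) D g n ≤
        cnt H ((insert (compOf H K v) s).biUnion id) D g n + cnt H (s.biUnion id) D g n * F := by
      exact_mod_cast h1
    rw [Finset.card_insert_of_notMem hCs, pow_succ] at hlt
    have h3 : (F : ℝ) ≤ β' / 2 * n := by
      have : (N : ℝ) ≤ n := by exact_mod_cast hn
      have := hN.trans this
      rw [div_le_iff₀ hβ'] at this
      linarith
    have h4 : β * (n : ℝ) ^ s.card * (β' / 2 * n) ≤
        (cnt H (s.biUnion id) D g n : ℝ) * (cnt H (compOf H K v) D g n - F) := by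
      refine mul_le_mul hcon.1 (by linarith [hcon.2]) (by positivity) (by positivity)
    nlinarith

theorem Ab.le_d (hmd : m ≤ d) (h : Ab m d H K D) : ∀ v ∈ K, D v ≤ d := by
  induction h with
  | empty => simp
  | @hit K D D' u hu hlt _ hD' ih =>
    intro v hv
    rw [hD' v hv]
    have := ih v hv
    split_ifs with h
    · subst h; omega
    · omega
  | @new K D D' h hh hab hm h1 h2 h3 h4 ih =>
    intro v hv
    rcases Finset.mem_insert.1 hv with rfl | hv
    · omega
    · by_cases ha : H.Adj h v
      · have := h1 v hv ha; omega
      · rw [h2 v hv ha]; exact ih v hv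

theorem eventually_low (hd : 2 * m < d) (L0 : ℕ) : ∀ᶠ n in atTop, ∀ g, Good m d n g →
    L0 ≤ (lowDegSet d g n).card := by
  filter_upwards [eventually_ge_atTop ((m + 1) * L0)] with n hn g hg
  have h1 := hg.card_low hd
  have : (m + 1) * L0 ≤ (m + 1) * (lowDegSet d g n).card := by omega
  exact Nat.le_of_mul_le_mul_left this (by omega)

theorem Ab.linear (hm : 1 ≤ m) (hd : 2 * m < d) (hg : Good m d n0 g0) (h : Ab m d H K D) :
    ∀ C ∈ comps H K, Linear m d n0 g0 H C D := by
  induction h with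
  | empty => simp [comps]
  | @hit K D D' u hu hlt hab hD' ih =>
    intro C hC
    have hle := (Ab.hit u hu hlt hab hD').le_d (by omega)
    obtain ⟨β, hβ, hE⟩ := ih C hC
    have hCK := subset_of_mem_comps hC
    by_cases huC : u ∈ C
    · obtain ⟨c, hc, L0, hL0⟩ := exists_le_pr m (unsat d C (lower D' {u})) 1 hm
      obtain ⟨v, hv, rfl⟩ := Finset.mem_image.1 hC
      refine linear_of_gain hm hd hg (fun a ha b hb => by
        rw [mem_compOf] at ha hb
        exact (conn_compOf ha.2 hv).symm.trans (conn_compOf hb.2 hv)) (γ := β * c) (by positivity) hE ?_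
      filter_upwards [eventually_low hd L0] with n hn g hg' hnB
      refine le_trans ?_ (le_step_cnt (U := {u}) hg' hm hd (fun v hv => hle v (hCK hv))
        (Finset.singleton_subset_iff.2 huC) (Finset.singleton_nonempty u))
      refine add_le_add_right ?_ _
      have e : cnt H (compOf H K v) (lower D' {u}) g n = cnt H (compOf H K v) D g n :=
        cnt_congr (fun w hw => by
          simp only [lower, hD' w (hCK hw), Finset.mem_singleton]; omega) g n
      rw [e, Finset.card_singleton]
      have h1 := hL0 _ n (hn g hg') (card_low_le d g n)
      rw [not_lt] at hnB
      rw [pow_one] at h1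
      calc β * c ≤ β * (n * pr m (lowDegSet d g n).card
            (unsat d (compOf H K v) (lower D' {u})) 1) := by gcongr
        _ = β * n * pr m (lowDegSet d g n).card (unsat d (compOf H K v) (lower D' {u})) 1 := by ring
        _ ≤ _ := mul_le_mul_of_nonneg_right hnB (pr_nonneg ..)
    · refine (ih C hC).congr fun v hv => ?_
      have hvu : v ≠ u := fun e => huC (e ▸ hv)
      rw [hD' v (hCK hv), if_neg hvu, add_zero]
  | @new K D D' h hh hab hDm h1 h2 hcard hsep ih =>
    intro C hC
    have hle := (Ab.new h hh hab hDm h1 h2 hcard hsep).le_d (by omega)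
    rw [comps_insert hh, Finset.mem_insert, Finset.mem_sdiff] at hC
    rcases hC with rfl | ⟨hC, hCN⟩
    · set s := (nbrs H K h).image (compOf H K) with hs
      have hsub : s ⊆ comps H K := nbrs_image_subset
      have hscard : s.card = (nbrs H K h).card := Finset.card_image_of_injOn fun a ha b hb e => by
        simp only [Finset.mem_coe, mem_nbrs] at ha hb
        exact hsep a ha.1 b hb.1 ha.2 hb.2 (conn_of_compOf_eq hb.1 e)
      obtain ⟨β, hβ, hE⟩ := Linear.biUnion hd hg hsub fun C hC => ih C (hsub hC)
      set P := compOf H (insert h K) h with hP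
      have hPe : P = insert h (s.biUnion id) := compOf_insert_self hh
      have hsK : s.biUnion id ⊆ K := Finset.biUnion_subset.2 fun C hC => subset_of_mem_comps (hsub hC)
      have hhs : h ∉ s.biUnion id := fun hx => hh (hsK hx)
      have hPer : P.erase h = s.biUnion id := by rw [hPe, Finset.erase_insert hhs]
      have hPsub : P ⊆ insert h K := by rw [hPe]; exact Finset.insert_subset_insert _ hsK
      have hnb : nbrs H P h = nbrs H K h := by
        ext w
        simp only [mem_nbrs]
        refine ⟨fun hw => ⟨?_, hw.2⟩, fun hw => ⟨?_, hw.2⟩⟩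
        · exact (Finset.mem_insert.1 (hPsub hw.1)).resolve_left hw.2.ne'
        · rw [hPe]
          refine Finset.mem_insert_of_mem (Finset.mem_biUnion.2 ⟨compOf H K w,
            Finset.mem_image_of_mem _ (mem_nbrs.2 hw), ?_⟩)
          exact mem_compOf.2 ⟨hw.1, Conn.refl _⟩
      obtain ⟨c, hc, L0, hL0⟩ := exists_le_pr m (unsat d (P.erase h) (lower D' (nbrs H P h)))
        (nbrs H K h).card hcard
      refine linear_of_gain hm hd hg (fun a ha b hb => by
        rw [hP, mem_compOf] at ha hb
        have hhi := Finset.mem_insert_self h K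
        exact (conn_compOf ha.2 hhi).symm.trans (conn_compOf hb.2 hhi)) (γ := β * c) (by positivity) hE ?_
      filter_upwards [eventually_low hd L0] with n hn g hg' hnB
      refine le_trans ?_ (le_step_cnt_new (h := h) hg' hm hd (fun v hv => hle v (hPsub hv))
        (by rw [hPe]; exact Finset.mem_insert_self _ _) hDm)
      refine add_le_add_right ?_ _
      have e : cnt H (P.erase h) (lower D' (nbrs H P h)) g n = cnt H (s.biUnion id) D g n := by
        rw [hPer]
        refine cnt_congr (fun w hw => ?_) g n
        simp only [lower, hnb]
        split_ifs with ha
        · have := h1 w (hsK hw) (mem_nbrs.1 ha).2; omega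
        · rw [h2 w (hsK hw) fun hb => ha (mem_nbrs.2 ⟨hsK hw, hb⟩), Nat.sub_zero]
      have h3 := hL0 _ n (hn g hg') (card_low_le d g n)
      rw [e, hnb]
      rw [hnb] at h3
      rw [not_lt, hscard] at hnB
      set p := pr m (lowDegSet d g n).card (unsat d (P.erase h) (lower D' (nbrs H K h)))
        (nbrs H K h).card
      have hp : 0 ≤ p := pr_nonneg ..
      calc β * c ≤ β * ((n : ℝ) ^ (nbrs H K h).card * p) := by gcongr
        _ = β * (n : ℝ) ^ (nbrs H K h).card * p := by ring
        _ ≤ _ := mul_le_mul_of_nonneg_right hnB hp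
    · refine (ih C hC).congr fun v hv => (h2 v (subset_of_mem_comps hC hv) fun ha => hCN ?_).symm
      obtain ⟨u, hu, rfl⟩ := Finset.mem_image.1 hC
      rw [mem_compOf] at hv
      exact Finset.mem_image.2 ⟨v, mem_nbrs.2 ⟨hv.1, ha⟩, (compOf_eq hv.2).symm⟩

end UA

namespace UA

/-! ### Rare sets -/

variable {m d s n n0 : ℕ} {g g0 : SimpleGraph ℕ} {S W : Finset ℕ}

/-- A small connected unsaturated set of vertices that is not abundant. -/
structure Rare (m d s : ℕ) (g : SimpleGraph ℕ) (W : Finset ℕ) : Prop where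
  card_le : W.card ≤ s
  low : ∃ v ∈ W, graphDeg g v < d
  conn : ∀ u ∈ W, ∀ w ∈ W, Conn g W u w
  not_ab : ¬ Ab m d g W (graphDeg g)

open Classical in
/-- The rare sets of a graph. -/
noncomputable def rares (m d s : ℕ) (g : SimpleGraph ℕ) (n : ℕ) : Finset (Finset ℕ) :=
  (Finset.Icc 1 n).powerset.filter (Rare m d s g)

theorem mem_rares : W ∈ rares m d s g n ↔ W ⊆ Finset.Icc 1 n ∧ Rare m d s g W := by
  simp [rares]

/-- Two of the vertices of `S` are close. -/
def Clash (s : ℕ) (g : SimpleGraph ℕ) (n : ℕ) (S : Finset ℕ) : Prop :=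
  ∃ u ∈ S, ∃ v ∈ S, u ≠ v ∧ v ∈ ball g n s {u}

theorem Ab.congr_graph {V : Type*} [DecidableEq V] {H H' : SimpleGraph V} {K : Finset V}
    {D D' : V → ℕ} (h : Ab m d H K D) (hH : ∀ u ∈ K, ∀ v ∈ K, H'.Adj u v ↔ H.Adj u v)
    (hD : ∀ v ∈ K, D v ≤ D' v) (hd : ∀ v ∈ K, D' v ≤ d) : Ab m d H' K D' :=
  (h.pullback (f := id) (H' := H') (D' := D) Function.injective_id.injOn (fun _ hv => hv) hH
    (fun _ _ => rfl) (fun v hv => (hD v hv).trans (hd v hv))).mono_deg hD hd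

theorem conn_congr {V : Type*} {H H' : SimpleGraph V} {K : Finset V}
    (hH : ∀ u ∈ K, ∀ v ∈ K, H'.Adj u v ↔ H.Adj u v) {u v : V} (h : Conn H K u v) :
    Conn H' K u v :=
  h.map (f := id) (fun _ hv => hv) fun u hu v hv huv => (hH u hu v hv).2 huv

theorem ne_succ_of_mem_Icc {v : ℕ} (hv : v ∈ Finset.Icc 1 n) : v ≠ n + 1 := by
  simp at hv; omega

theorem rare_attach_old (hd : m ≤ d) (hg : Good m d n g) (hS : S ⊆ lowDegSet d g n)
    (hc : S.card = m) (hW : W ⊆ Finset.Icc 1 n) (h : Rare m d s (attachStep g (n + 1) S) W) :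
    Rare m d s g W := by
  have hne : ∀ v ∈ W, v ≠ n + 1 := fun v hv => ne_succ_of_mem_Icc (hW hv)
  have hadj : ∀ u ∈ W, ∀ v ∈ W, (attachStep g (n + 1) S).Adj u v ↔ g.Adj u v :=
    fun u hu v hv => attach_adj_old g (hne u hu) (hne v hv)
  have hdeg : ∀ v ∈ W, graphDeg g v ≤ graphDeg (attachStep g (n + 1) S) v := fun v hv => by
    rw [deg_attach_old hg (hne v hv)]; exact Nat.le_add_right _ _
  refine ⟨h.card_le, ?_, fun u hu w hw => conn_congr (fun a ha b hb => (hadj a ha b hb).symm)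
    (h.conn u hu w hw), fun hab => h.not_ab (hab.congr_graph hadj hdeg fun v _ =>
      (hg.attach hd hS hc).graphDeg_le v)⟩
  obtain ⟨v, hv, hlt⟩ := h.low
  exact ⟨v, hv, (hdeg v hv).trans_lt hlt⟩

theorem rare_attach_new (hg : Good m d n g) (hS : S ⊆ lowDegSet d g n)
    (hc : S.card = m) (hW : W ⊆ Finset.Icc 1 (n + 1)) (hnW : n + 1 ∈ W)
    (h : Rare m d s (attachStep g (n + 1) S) W) (hcl : ¬ Clash s g n S) :
    ∃ C ∈ rares m d s g n, (∃ u ∈ C, u ∈ S) ∧ C ⊆ W := by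
  classical
  have hSn := hS.trans (lowDegSet_subset d g n)
  set K := W.erase (n + 1) with hK
  have hKn : K ⊆ Finset.Icc 1 n := by
    intro v hv
    have h1 := hW (Finset.mem_of_mem_erase hv)
    have h2 := Finset.ne_of_mem_erase hv
    simp only [Finset.mem_Icc] at h1 ⊢
    omega
  have hnK : n + 1 ∉ K := Finset.notMem_erase _ _
  have hins : insert (n + 1) K = W := Finset.insert_erase hnW
  have hne : ∀ v ∈ K, v ≠ n + 1 := fun v hv => ne_succ_of_mem_Icc (hKn hv)
  have hadj : ∀ u ∈ K, ∀ v ∈ K, (attachStep g (n + 1) S).Adj u v ↔ g.Adj u v :=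
    fun u hu v hv => attach_adj_old g (hne u hu) (hne v hv)
  have hKc : K.card ≤ s := (Finset.card_erase_le).trans h.card_le
  have hcompcard : ∀ v, (compOf g K v).card ≤ s := fun v =>
    (Finset.card_le_card fun w hw => (mem_compOf.1 hw).1).trans hKc
  have hcompconn : ∀ v ∈ K, ∀ a ∈ compOf g K v, ∀ b ∈ compOf g K v, Conn g (compOf g K v) a b := by
    intro v hv a ha b hb
    rw [mem_compOf] at ha hb
    exact (conn_compOf ha.2 hv).symm.trans (conn_compOf hb.2 hv)
  have hsep : ∀ u ∈ K, ∀ v ∈ K, u ∈ S → v ∈ S → Conn g K u v → u = v := by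
    intro u hu v hv huS hvS huv
    by_contra hne
    refine hcl ⟨u, huS, v, hvS, hne, ?_⟩
    have hu' : u ∈ compOf g K u := mem_compOf.2 ⟨hu, Conn.refl _⟩
    have h1 := conn_subset_ball hg hu' (hcompconn u hu u hu') (mem_compOf.2 ⟨hv, huv⟩)
    exact ball_mono_radius _ _ _ (hcompcard u) h1
  by_cases hall : ∀ C ∈ comps g K, Ab m d g C (graphDeg g)
  · exfalso
    have hKab : Ab m d g K (graphDeg g) := by
      have h1 := Ab.biUnion (H := g) (K := K) subset_rfl hall
      have h2 : (comps g K).biUnion id = K := by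
        ext v
        simp only [Finset.mem_biUnion, id_eq]
        exact ⟨fun ⟨C, hC, hv⟩ => subset_of_mem_comps hC hv, fun hv => ⟨compOf g K v,
          Finset.mem_image_of_mem _ hv, mem_compOf.2 ⟨hv, Conn.refl _⟩⟩⟩
      rwa [h2] at h1
    have hKab' : Ab m d (attachStep g (n + 1) S) K (graphDeg g) :=
      hKab.congr_graph hadj (fun _ _ => le_rfl) fun v _ => hg.graphDeg_le v
    apply h.not_ab
    rw [← hins]
    refine Ab.new (n + 1) hnK hKab' ?_ ?_ ?_ ?_ ?_
    · rw [deg_attach_new hg hSn, hc]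
    · intro u hu ha
      rw [attach_adj_new hg hSn] at ha
      rw [deg_attach_old hg (hne u hu), if_pos ha]
      exact ⟨rfl, (mem_lowDegSet.1 (hS ha)).2⟩
    · intro u hu ha
      rw [attach_adj_new hg hSn] at ha
      rw [deg_attach_old hg (hne u hu), if_neg ha, add_zero]
    · rw [← hc]
      refine Finset.card_le_card fun v hv => ?_
      rw [mem_nbrs, attach_adj_new hg hSn] at hv
      exact hv.2
    · intro u hu v hv hau hav huv
      rw [attach_adj_new hg hSn] at hau hav
      exact hsep u hu v hv hau hav (conn_congr (fun a ha b hb => (hadj a ha b hb).symm) huv)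
  · push Not at hall
    obtain ⟨C, hC, hCab⟩ := hall
    obtain ⟨v, hv, rfl⟩ := Finset.mem_image.1 hC
    have hvW : v ∈ W := Finset.mem_of_mem_erase hv
    have h1 := h.conn (n + 1) hnW v hvW
    rw [← hins, conn_insert_iff hnK hv] at h1
    obtain ⟨a, ha, hav⟩ := h1
    rw [mem_nbrs, attach_adj_new hg hSn] at ha
    have haC : a ∈ compOf g K v := mem_compOf.2 ⟨ha.1,
      (conn_congr (fun a ha b hb => (hadj a ha b hb).symm) hav).symm⟩
    have hsub := subset_of_mem_comps hC
    exact ⟨compOf g K v, mem_rares.2 ⟨hsub.trans hKn, hcompcard v,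
      ⟨a, haC, (mem_lowDegSet.1 (hS ha.2)).2⟩, hcompconn v hv, hCab⟩, ⟨a, haC, ha.2⟩,
      hsub.trans (Finset.erase_subset _ _)⟩

theorem card_rares_mem_le (hg : Good m d n g) (x : ℕ) :
    ((rares m d s g n).filter (x ∈ ·)).card ≤ 2 ^ (d + 1) ^ s := by
  have h1 : (rares m d s g n).filter (x ∈ ·) ⊆ (ball g n s {x}).powerset := by
    intro W hW
    rw [Finset.mem_filter, mem_rares] at hW
    rw [Finset.mem_powerset]
    exact (conn_subset_ball hg hW.2 (hW.1.2.conn x hW.2)).trans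
      (ball_mono_radius _ _ _ hW.1.2.card_le)
  refine (Finset.card_le_card h1).trans ?_
  rw [Finset.card_powerset]
  refine Nat.pow_le_pow_right two_pos ?_
  simpa using card_ball_le hg s {x}

/-- The weight of a set of vertices. -/
noncomputable def wt (η : ℝ) (g : SimpleGraph ℕ) (W : Finset ℕ) : ℝ := η ^ ∑ v ∈ W, graphDeg g v

/-- The total weight of the rare sets. -/
noncomputable def rareWeight (m d s : ℕ) (η : ℝ) (g : SimpleGraph ℕ) (n : ℕ) : ℝ :=
  ∑ W ∈ rares m d s g n, wt η g W

/-- The total weight of the rare sets that meet `S`. -/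
noncomputable def hitWeight (m d s : ℕ) (η : ℝ) (g : SimpleGraph ℕ) (n : ℕ) (S : Finset ℕ) : ℝ :=
  ∑ W ∈ (rares m d s g n).filter (¬ Disjoint · S), wt η g W

variable {η : ℝ}

theorem wt_pos (hη : 0 < η) (g : SimpleGraph ℕ) (W : Finset ℕ) : 0 < wt η g W := by
  unfold wt; positivity

theorem wt_le_one (hη : 0 < η) (hη1 : η ≤ 1) (g : SimpleGraph ℕ) (W : Finset ℕ) :
    wt η g W ≤ 1 := pow_le_one₀ hη.le hη1

theorem le_wt (hη : 0 < η) (hη1 : η ≤ 1) (hg : Good m d n g) (hW : W.card ≤ s) :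
    η ^ (s * d) ≤ wt η g W := by
  refine pow_le_pow_of_le_one hη.le hη1 ?_
  refine (Finset.sum_le_card_nsmul _ _ d fun v _ => hg.graphDeg_le v).trans ?_
  rw [smul_eq_mul]
  exact Nat.mul_le_mul_right _ hW

theorem rares_attach_subset (hd : m ≤ d) (hg : Good m d n g) (hS : S ⊆ lowDegSet d g n)
    (hc : S.card = m) : (rares m d s (attachStep g (n + 1) S) (n + 1)).filter (n + 1 ∉ ·) ⊆
      rares m d s g n := by
  intro W hW
  rw [Finset.mem_filter, mem_rares] at hW
  have hWn : W ⊆ Finset.Icc 1 n := by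
    intro v hv
    have h1 := hW.1.1 hv
    have h2 : v ≠ n + 1 := fun e => hW.2 (e ▸ hv)
    simp only [Finset.mem_Icc] at h1 ⊢
    omega
  exact mem_rares.2 ⟨hWn, rare_attach_old hd hg hS hc hWn hW.1.2⟩

theorem wt_attach (hη : 0 < η) (hη1 : η ≤ 1) (hg : Good m d n g) (hW : W ⊆ Finset.Icc 1 n) :
    wt η (attachStep g (n + 1) S) W ≤ (if Disjoint W S then 1 else η) * wt η g W := by
  have h1 : ∑ v ∈ W, graphDeg (attachStep g (n + 1) S) v =
      ∑ v ∈ W, graphDeg g v + ∑ v ∈ W, (if v ∈ S then 1 else 0) := by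
    rw [← Finset.sum_add_distrib]
    exact Finset.sum_congr rfl fun v hv => deg_attach_old hg (ne_succ_of_mem_Icc (hW hv))
  rw [wt, h1, pow_add, mul_comm, wt]
  refine mul_le_mul_of_nonneg_right ?_ (by positivity)
  split_ifs with h
  · exact pow_le_one₀ hη.le hη1
  · rw [Finset.not_disjoint_iff] at h
    obtain ⟨v, hv, hvS⟩ := h
    have : 1 ≤ ∑ v ∈ W, (if v ∈ S then 1 else 0) := by
      refine le_trans ?_ (Finset.single_le_sum (f := fun v => if v ∈ S then 1 else 0)
        (fun _ _ => Nat.zero_le _) hv)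
      simp [hvS]
    calc η ^ _ ≤ η ^ 1 := pow_le_pow_of_le_one hη.le hη1 this
      _ = η := pow_one η

theorem sum_old_le (hη : 0 < η) (hη1 : η ≤ 1) (hd : m ≤ d) (hg : Good m d n g)
    (hS : S ⊆ lowDegSet d g n) (hc : S.card = m) :
    ∑ W ∈ (rares m d s (attachStep g (n + 1) S) (n + 1)).filter (n + 1 ∉ ·),
      wt η (attachStep g (n + 1) S) W ≤
    rareWeight m d s η g n - (1 - η) * hitWeight m d s η g n S := by
  have h1 : ∑ W ∈ (rares m d s (attachStep g (n + 1) S) (n + 1)).filter (n + 1 ∉ ·),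
      wt η (attachStep g (n + 1) S) W ≤
      ∑ W ∈ rares m d s g n, (if Disjoint W S then 1 else η) * wt η g W := by
    refine (Finset.sum_le_sum_of_subset_of_nonneg (rares_attach_subset hd hg hS hc)
      fun _ _ _ => (wt_pos hη _ _).le).trans ?_
    exact Finset.sum_le_sum fun W hW => wt_attach hη hη1 hg (mem_rares.1 hW).1
  refine h1.trans_eq ?_
  rw [rareWeight, hitWeight, Finset.sum_filter, Finset.mul_sum, ← Finset.sum_sub_distrib]
  refine Finset.sum_congr rfl fun W _ => ?_
  split_ifs <;> ring

theorem rareWeight_attach_le (hη : 0 < η) (hη1 : η * (2 * (1 + 2 ^ (d + 1) ^ s)) ≤ 1)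
    (hd : m ≤ d) (hg : Good m d n g) (hS : S ⊆ lowDegSet d g n) (hc : S.card = m)
    (hcl : ¬ Clash s g n S) :
    rareWeight m d s η (attachStep g (n + 1) S) (n + 1) ≤
      rareWeight m d s η g n - hitWeight m d s η g n S / 2 := by
  have hB : (0 : ℝ) < 2 ^ (d + 1) ^ s := by positivity
  have hη2 : η ≤ 1 := by nlinarith
  have hg' := hg.attach hd hS hc
  have h0 : 0 ≤ hitWeight m d s η g n S := Finset.sum_nonneg fun _ _ => (wt_pos hη _ _).le
  have h1 := sum_old_le (s := s) hη hη2 hd hg hS hc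
  have h2 : ∑ W ∈ (rares m d s (attachStep g (n + 1) S) (n + 1)).filter (n + 1 ∈ ·),
      wt η (attachStep g (n + 1) S) W ≤ 2 ^ (d + 1) ^ s * (η * hitWeight m d s η g n S) := by
    refine (Finset.sum_le_card_nsmul _ _ (η * hitWeight m d s η g n S) ?_).trans ?_
    · intro W hW
      rw [Finset.mem_filter, mem_rares] at hW
      obtain ⟨C, hC, ⟨u, huC, huS⟩, hCW⟩ := rare_attach_new hg hS hc hW.1.1 hW.2 hW.1.2 hcl
      have hdis : ¬ Disjoint C S := Finset.not_disjoint_iff.2 ⟨u, huC, huS⟩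
      have h3 := wt_attach (S := S) hη hη2 hg (mem_rares.1 hC).1
      rw [if_neg hdis] at h3
      have h4 : wt η (attachStep g (n + 1) S) W ≤ wt η (attachStep g (n + 1) S) C :=
        pow_le_pow_of_le_one hη.le hη2 (Finset.sum_le_sum_of_subset hCW)
      refine (h4.trans h3).trans (mul_le_mul_of_nonneg_left ?_ hη.le)
      exact Finset.single_le_sum (f := wt η g) (fun _ _ => (wt_pos hη _ _).le)
        (Finset.mem_filter.2 ⟨hC, hdis⟩)
    · rw [nsmul_eq_mul]
      refine mul_le_mul_of_nonneg_right ?_ (by positivity)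
      exact_mod_cast card_rares_mem_le hg' (n + 1)
  rw [rareWeight, ← Finset.sum_filter_add_sum_filter_not _ (n + 1 ∈ ·)]
  nlinarith

theorem rareWeight_attach_le_add (hη : 0 < η) (hη1 : η ≤ 1)
    (hd : m ≤ d) (hg : Good m d n g) (hS : S ⊆ lowDegSet d g n) (hc : S.card = m) :
    rareWeight m d s η (attachStep g (n + 1) S) (n + 1) ≤
      rareWeight m d s η g n + 2 ^ (d + 1) ^ s := by
  have hg' := hg.attach hd hS hc
  have h0 : 0 ≤ hitWeight m d s η g n S := Finset.sum_nonneg fun _ _ => (wt_pos hη _ _).le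
  have h1 := sum_old_le (s := s) hη hη1 hd hg hS hc
  have h2 : ∑ W ∈ (rares m d s (attachStep g (n + 1) S) (n + 1)).filter (n + 1 ∈ ·),
      wt η (attachStep g (n + 1) S) W ≤ 2 ^ (d + 1) ^ s := by
    refine (Finset.sum_le_card_nsmul _ _ 1 fun W _ => wt_le_one hη hη1 _ _).trans ?_
    rw [nsmul_eq_mul, mul_one]
    exact_mod_cast card_rares_mem_le hg' (n + 1)
  rw [rareWeight, ← Finset.sum_filter_add_sum_filter_not _ (n + 1 ∈ ·)]
  nlinarith

/-- The unsaturated vertices in rare sets. -/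
noncomputable def rareLow (m d s : ℕ) (g : SimpleGraph ℕ) (n : ℕ) : Finset ℕ :=
  (lowDegSet d g n).filter (fun v => ∃ W ∈ rares m d s g n, v ∈ W)

theorem card_rares_le (hg : Good m d n g) :
    (rares m d s g n).card ≤ (rareLow m d s g n).card * 2 ^ (d + 1) ^ s := by
  have h1 : rares m d s g n ⊆ (rareLow m d s g n).biUnion
      fun v => (rares m d s g n).filter (v ∈ ·) := by
    intro W hW
    obtain ⟨hWn, hr⟩ := mem_rares.1 hW
    obtain ⟨v, hv, hlt⟩ := hr.low
    exact Finset.mem_biUnion.2 ⟨v, Finset.mem_filter.2 ⟨mem_lowDegSet.2 ⟨hWn hv, hlt⟩, W, hW, hv⟩,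
      Finset.mem_filter.2 ⟨hW, hv⟩⟩
  exact (Finset.card_le_card h1).trans (Finset.card_biUnion_le_card_mul _ _ _ fun v _ =>
    card_rares_mem_le hg v)

theorem rareWeight_le (hη : 0 < η) (hη1 : η ≤ 1) (hg : Good m d n g) :
    rareWeight m d s η g n ≤ (rareLow m d s g n).card * 2 ^ (d + 1) ^ s := by
  refine (Finset.sum_le_card_nsmul _ _ 1 fun W _ => wt_le_one hη hη1 _ _).trans ?_
  rw [nsmul_eq_mul, mul_one]
  exact_mod_cast card_rares_le hg

theorem card_rares_le_rareWeight (hη : 0 < η) (hη1 : η ≤ 1) (hg : Good m d n g) :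
    ((rares m d s g n).card : ℝ) * η ^ (s * d) ≤ rareWeight m d s η g n := by
  rw [← nsmul_eq_mul]
  exact Finset.card_nsmul_le_sum _ _ _ fun W hW => le_wt hη hη1 hg (mem_rares.1 hW).2.card_le

theorem le_hitWeight (hη : 0 < η) (hη1 : η ≤ 1) (hg : Good m d n g)
    (h : ¬ Disjoint (rareLow m d s g n) S) : η ^ (s * d) ≤ hitWeight m d s η g n S := by
  obtain ⟨v, hv, hvS⟩ := Finset.not_disjoint_iff.1 h
  obtain ⟨-, W, hW, hvW⟩ := Finset.mem_filter.1 hv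
  refine (le_wt hη hη1 hg (mem_rares.1 hW).2.card_le).trans ?_
  exact Finset.single_le_sum (f := wt η g) (fun _ _ => (wt_pos hη _ _).le)
    (Finset.mem_filter.2 ⟨hW, Finset.not_disjoint_iff.2 ⟨v, hvW, hvS⟩⟩)

end UA

namespace UA

variable {m d s n n0 : ℕ} {g g0 : SimpleGraph ℕ} {S W : Finset ℕ} {η : ℝ}

theorem card_powersetCard_pair_le (L : Finset ℕ) {u v : ℕ} (huv : u ≠ v) :
    (((L.powersetCard m).filter (fun S => u ∈ S ∧ v ∈ S)).card : ℝ) ≤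
      pr m L.card 2 2 * (L.card.choose m : ℝ) := by
  classical
  rcases Finset.eq_empty_or_nonempty ((L.powersetCard m).filter (fun S => u ∈ S ∧ v ∈ S)) with
    h0 | ⟨S0, hS0⟩
  · rw [h0]
    simp only [Finset.card_empty, Nat.cast_zero]
    exact mul_nonneg (pr_nonneg _ _ _ _) (Nat.cast_nonneg _)
  have pair_sub : ∀ S : Finset ℕ, (u ∈ S ∧ v ∈ S) → ({u, v} : Finset ℕ) ⊆ S := fun S h => by
    intro x hx
    simp only [Finset.mem_insert, Finset.mem_singleton] at hx
    rcases hx with rfl | rfl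
    exacts [h.1, h.2]
  rw [Finset.mem_filter, Finset.mem_powersetCard] at hS0
  have h2m : 2 ≤ m := by
    rw [← hS0.1.2, ← Finset.card_pair huv]
    exact Finset.card_le_card (pair_sub _ hS0.2)
  have hch : (0 : ℝ) < (L.card.choose m : ℝ) := by
    have : m ≤ L.card := hS0.1.2 ▸ Finset.card_le_card hS0.1.1
    exact_mod_cast Nat.choose_pos this
  have hle : ((L.powersetCard m).filter (fun S => u ∈ S ∧ v ∈ S)).card ≤
      ((L \ {u, v}).powersetCard (m - 2)).card := by
    refine Finset.card_le_card_of_injOn (fun S => S \ {u, v}) ?_ ?_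
    · intro S hS
      simp only [Finset.coe_filter, Set.mem_ofPred_eq, Finset.mem_powersetCard] at hS
      simp only [Finset.mem_coe, Finset.mem_powersetCard]
      refine ⟨Finset.sdiff_subset_sdiff hS.1.1 le_rfl, ?_⟩
      rw [Finset.card_sdiff_of_subset (pair_sub _ hS.2), Finset.card_pair huv, hS.1.2]
    · intro S hS T hT hST
      simp only [Finset.coe_filter, Set.mem_ofPred_eq] at hS hT
      have h1 := Finset.sdiff_union_of_subset (pair_sub _ hS.2)
      have h2 := Finset.sdiff_union_of_subset (pair_sub _ hT.2)
      rw [← h1, ← h2]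
      simp only at hST
      rw [hST]
  have hc2 : (L \ {u, v}).card = L.card - 2 := by
    rw [Finset.card_sdiff_of_subset (pair_sub _ ⟨hS0.1.1 hS0.2.1, hS0.1.1 hS0.2.2⟩),
      Finset.card_pair huv]
  rw [Finset.card_powersetCard, hc2] at hle
  rw [pr, if_pos h2m, div_mul_cancel₀ _ hch.ne']
  exact_mod_cast hle

/-- Two attachment targets lie close to each other with probability `O(1/n)`. -/
theorem exists_clash_bound (hd : 2 * m < d) (s : ℕ) : ∃ C : ℝ, 0 ≤ C ∧ ∀ n g, Good m d n g →
    (∑ S ∈ (lowDegSet d g n).powersetCard m, ind (Clash s g n S)) /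
      ((lowDegSet d g n).card.choose m : ℝ) ≤ C / n := by
  classical
  obtain ⟨C, hC⟩ := bounded_ratio 2 m (tendsto_pow_mul_pr m 2 2)
  have hC0 : 0 ≤ C := (abs_nonneg _).trans (hC 0 0 (by simp))
  refine ⟨(d + 1) ^ s * C, by positivity, fun n g hg => ?_⟩
  set L := lowDegSet d g n with hL
  have hch := hg.choose_pos hd
  have hn : (0 : ℝ) < n := by
    have := hg.le_n
    exact_mod_cast (by omega : 0 < n)
  have hnL : n ≤ (m + 1) * L.card :=
    (Nat.le_add_right _ _).trans (hg.card_low hd)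
  have hpr : (n : ℝ) ^ 2 * pr m L.card 2 2 ≤ C := (le_abs_self _).trans (hC n L.card hnL)
  have key : ∑ S ∈ L.powersetCard m, ind (Clash s g n S) ≤
      ∑ u ∈ L, ∑ v ∈ (ball g n s {u}).filter (u ≠ ·), ∑ S ∈ L.powersetCard m,
        (if u ∈ S ∧ v ∈ S then (1 : ℝ) else 0) := by
    rw [Finset.sum_congr rfl fun u _ => Finset.sum_comm, Finset.sum_comm]
    refine Finset.sum_le_sum fun S hS => ?_
    rw [Finset.mem_powersetCard] at hS
    by_cases hcl : Clash s g n S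
    · obtain ⟨u, hu, v, hv, huv, hb⟩ := hcl
      refine (ind_le_one _).trans ?_
      calc (1 : ℝ) = if u ∈ S ∧ v ∈ S then (1 : ℝ) else 0 := by rw [if_pos ⟨hu, hv⟩]
        _ ≤ ∑ v ∈ (ball g n s {u}).filter (u ≠ ·), (if u ∈ S ∧ v ∈ S then (1 : ℝ) else 0) :=
          Finset.single_le_sum (f := fun v => if u ∈ S ∧ v ∈ S then (1 : ℝ) else 0)
            (fun _ _ => by positivity) (Finset.mem_filter.2 ⟨hb, huv⟩)
        _ ≤ _ := Finset.single_le_sum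
            (f := fun u => ∑ v ∈ (ball g n s {u}).filter (u ≠ ·),
              (if u ∈ S ∧ v ∈ S then (1 : ℝ) else 0))
            (fun _ _ => by positivity) (hS.1 hu)
    · rw [ind_of_not hcl]
      positivity
  have key2 : ∑ S ∈ L.powersetCard m, ind (Clash s g n S) ≤
      n * ((d + 1) ^ s * (pr m L.card 2 2 * (L.card.choose m : ℝ))) := by
    refine key.trans ?_
    have hp : 0 ≤ pr m L.card 2 2 * (L.card.choose m : ℝ) :=
      mul_nonneg (pr_nonneg _ _ _ _) hch.le
    have hinner : ∀ u ∈ L, ∑ v ∈ (ball g n s {u}).filter (u ≠ ·), ∑ S ∈ L.powersetCard m,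
        (if u ∈ S ∧ v ∈ S then (1 : ℝ) else 0) ≤
        (d + 1) ^ s * (pr m L.card 2 2 * (L.card.choose m : ℝ)) := by
      intro u _
      have : ∀ v ∈ (ball g n s {u}).filter (u ≠ ·), ∑ S ∈ L.powersetCard m,
          (if u ∈ S ∧ v ∈ S then (1 : ℝ) else 0) ≤
          pr m L.card 2 2 * (L.card.choose m : ℝ) := by
        intro v hv
        rw [Finset.sum_boole]
        exact card_powersetCard_pair_le L (Finset.mem_filter.1 hv).2
      refine (Finset.sum_le_card_nsmul _ _ _ this).trans ?_
      rw [nsmul_eq_mul]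
      refine mul_le_mul_of_nonneg_right ?_ hp
      have h1 := (Finset.card_filter_le (ball g n s {u}) (u ≠ ·)).trans
        (card_ball_le hg s {u})
      rw [Finset.card_singleton, mul_one] at h1
      exact_mod_cast h1
    refine (Finset.sum_le_card_nsmul _ _ _ hinner).trans ?_
    rw [nsmul_eq_mul]
    refine mul_le_mul_of_nonneg_right ?_ (by positivity)
    exact_mod_cast card_low_le d g n
  rw [div_le_div_iff₀ hch hn]
  calc (∑ S ∈ L.powersetCard m, ind (Clash s g n S)) * n
      ≤ n * ((d + 1) ^ s * (pr m L.card 2 2 * (L.card.choose m : ℝ))) * n := by gcongr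
    _ = (d + 1) ^ s * ((n : ℝ) ^ 2 * pr m L.card 2 2) * (L.card.choose m : ℝ) := by ring
    _ ≤ (d + 1) ^ s * C * (L.card.choose m : ℝ) := by gcongr

theorem le_hit_prob (hm : 1 ≤ m) (hd : 2 * m < d) (hg : Good m d n g) :
    ((rareLow m d s g n).card : ℝ) / n ≤
      (∑ S ∈ (lowDegSet d g n).powersetCard m, ind (¬ Disjoint (rareLow m d s g n) S)) /
      ((lowDegSet d g n).card.choose m : ℝ) := by
  classical
  set L := lowDegSet d g n with hL
  have hch := hg.choose_pos hd
  have hLpos := hg.card_low_pos hm hd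
  have hn : (0 : ℝ) < n := by
    have := hg.le_n
    exact_mod_cast (by omega : 0 < n)
  have hmpos : (0 : ℝ) < m := by exact_mod_cast hm
  have h1 := sum_card_filter L hm (hg.m_le_card_low hd) (fun v => v ∈ rareLow m d s g n)
  have hsub : rareLow m d s g n ⊆ L := Finset.filter_subset _ _
  have hfil : L.filter (fun v => v ∈ rareLow m d s g n) = rareLow m d s g n := by
    rw [Finset.filter_mem_eq_inter]
    exact Finset.inter_eq_right.2 hsub
  rw [hfil] at h1
  have h2 : ∑ S ∈ L.powersetCard m, ((S.filter (fun v => v ∈ rareLow m d s g n)).card : ℝ) ≤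
      m * ∑ S ∈ L.powersetCard m, ind (¬ Disjoint (rareLow m d s g n) S) := by
    rw [Finset.mul_sum]
    refine Finset.sum_le_sum fun S hS => ?_
    rw [Finset.mem_powersetCard] at hS
    by_cases h : Disjoint (rareLow m d s g n) S
    · have : S.filter (fun v => v ∈ rareLow m d s g n) = ∅ := by
        refine Finset.filter_eq_empty_iff.2 fun x hx hx' => ?_
        exact Finset.disjoint_left.1 h hx' hx
      rw [this, ind_of_not (not_not.2 h)]
      simp
    · rw [ind_of h, mul_one]
      have := Finset.card_filter_le S (fun v => v ∈ rareLow m d s g n)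
      rw [hS.2] at this
      exact_mod_cast this
  have h3 : m / (L.card : ℝ) * ((rareLow m d s g n).card : ℝ) ≤
      m * ((∑ S ∈ L.powersetCard m, ind (¬ Disjoint (rareLow m d s g n) S)) /
        (L.card.choose m : ℝ)) := by
    rw [← h1, ← mul_div_assoc]
    gcongr
  have h4 : ((rareLow m d s g n).card : ℝ) / (L.card : ℝ) ≤
      (∑ S ∈ L.powersetCard m, ind (¬ Disjoint (rareLow m d s g n) S)) /
        (L.card.choose m : ℝ) := by
    rw [div_mul_eq_mul_div, mul_div_assoc] at h3
    exact le_of_mul_le_mul_left h3 hmpos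
  refine le_trans ?_ h4
  have : (L.card : ℝ) ≤ n := by exact_mod_cast card_low_le d g n
  gcongr

/-- One step of the exponential moment of the rare weight. -/
theorem step_exp_rareWeight (hm : 1 ≤ m) (hd : 2 * m < d) (hη : 0 < η)
    (hη1 : η * (2 * (1 + 2 ^ (d + 1) ^ s)) ≤ 1) {θ : ℝ} (hθ : 0 < θ) :
    ∃ C : ℝ, 0 ≤ C ∧ ∀ n g, Good m d n g →
      step m d n (fun g' => Real.exp (θ * rareWeight m d s η g' (n + 1))) g ≤
        (1 - 1 / n) * Real.exp (θ * rareWeight m d s η g n) + C / n := by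
  classical
  obtain ⟨C, hC0, hC⟩ := exists_clash_bound hd s
  set B : ℝ := 2 ^ (d + 1) ^ s with hB
  have hBpos : 0 < B := by positivity
  have hη1' : η ≤ 1 := by nlinarith
  set ρ : ℝ := 1 - Real.exp (-(θ * (η ^ (s * d) / 2))) with hρ
  have hρpos : 0 < ρ := by
    have : Real.exp (-(θ * (η ^ (s * d) / 2))) < 1 := by
      rw [Real.exp_lt_one_iff]
      have : 0 < θ * (η ^ (s * d) / 2) := by positivity
      linarith
    linarith
  set A : ℝ := (1 + Real.exp (θ * B) * C) * B / ρ with hA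
  have hA0 : 0 ≤ A := by positivity
  refine ⟨(1 + Real.exp (θ * B) * C) * Real.exp (θ * A), by positivity, fun n g hg => ?_⟩
  set Φ := rareWeight m d s η g n with hΦ
  have hch := hg.choose_pos hd
  have hn : (0 : ℝ) < n := by
    have := hg.le_n
    exact_mod_cast (by omega : 0 < n)
  have hpt : ∀ S ∈ (lowDegSet d g n).powersetCard m,
      Real.exp (θ * rareWeight m d s η (attachStep g (n + 1) S) (n + 1)) ≤
      Real.exp (θ * Φ) * (1 - ρ * ind (¬ Disjoint (rareLow m d s g n) S) +
        Real.exp (θ * B) * ind (Clash s g n S)) := by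
    intro S hS
    rw [Finset.mem_powersetCard] at hS
    by_cases hcl : Clash s g n S
    · have h := rareWeight_attach_le_add hη hη1' (s := s) (by omega) hg hS.1 hS.2
      rw [ind_of hcl]
      have h1 : ρ * ind (¬ Disjoint (rareLow m d s g n) S) ≤ 1 := by
        have hρ1 : ρ ≤ 1 := by
          have := Real.exp_pos (-(θ * (η ^ (s * d) / 2)))
          linarith
        exact mul_le_one₀ hρ1 (ind_nonneg _) (ind_le_one _)
      calc Real.exp (θ * rareWeight m d s η (attachStep g (n + 1) S) (n + 1))
          ≤ Real.exp (θ * (Φ + B)) := by gcongr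
        _ = Real.exp (θ * Φ) * Real.exp (θ * B) := by rw [← Real.exp_add]; ring_nf
        _ ≤ _ := by
          gcongr
          linarith
    · have h := rareWeight_attach_le hη hη1 (s := s) (by omega) hg hS.1 hS.2 hcl
      rw [ind_of_not hcl, mul_zero, add_zero]
      by_cases hh : Disjoint (rareLow m d s g n) S
      · rw [ind_of_not (not_not.2 hh), mul_zero, sub_zero, mul_one]
        have h0 : 0 ≤ hitWeight m d s η g n S :=
          Finset.sum_nonneg fun W _ => (wt_pos hη g W).le
        gcongr
        linarith
      · have h0 := le_hitWeight hη hη1' hg hh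
        rw [ind_of hh, mul_one]
        calc Real.exp (θ * rareWeight m d s η (attachStep g (n + 1) S) (n + 1))
            ≤ Real.exp (θ * (Φ - η ^ (s * d) / 2)) := by
              gcongr
              linarith
          _ = Real.exp (θ * Φ) * (1 - ρ) := by
              rw [hρ, sub_sub_cancel, ← Real.exp_add]
              ring_nf
  have hhit := le_hit_prob (s := s) hm hd hg
  have hclash := hC n g hg
  set ph := (∑ S ∈ (lowDegSet d g n).powersetCard m,
    ind (¬ Disjoint (rareLow m d s g n) S)) / ((lowDegSet d g n).card.choose m : ℝ) with hph
  set pc := (∑ S ∈ (lowDegSet d g n).powersetCard m, ind (Clash s g n S)) /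
    ((lowDegSet d g n).card.choose m : ℝ) with hpc
  have h1 : step m d n (fun g' => Real.exp (θ * rareWeight m d s η g' (n + 1))) g ≤
      Real.exp (θ * Φ) * (1 - ρ * ph + Real.exp (θ * B) * pc) := by
    rw [step, div_le_iff₀ hch]
    refine (Finset.sum_le_sum hpt).trans (le_of_eq ?_)
    rw [← Finset.mul_sum, Finset.sum_add_distrib, Finset.sum_sub_distrib, ← Finset.mul_sum,
      ← Finset.mul_sum, Finset.sum_const, Finset.card_powersetCard, nsmul_eq_mul, mul_one, hph, hpc]
    field_simp
  have hy := rareWeight_le (s := s) hη hη1' hg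
  have hΦy : Φ / B / n ≤ ph := by
    refine le_trans ?_ hhit
    have : Φ / B ≤ (rareLow m d s g n).card := by
      rw [div_le_iff₀ hBpos]
      exact hy
    gcongr
  have hexp := Real.exp_pos (θ * Φ)
  have hexpB := Real.exp_pos (θ * B)
  have h2 : Real.exp (θ * Φ) * (1 - ρ * ph + Real.exp (θ * B) * pc) ≤
      Real.exp (θ * Φ) * (1 - ρ * (Φ / B / n) + Real.exp (θ * B) * (C / n)) := by
    gcongr
  refine (h1.trans h2).trans ?_
  have hΦ0 : 0 ≤ Φ := Finset.sum_nonneg fun W _ => (wt_pos hη g W).le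
  rcases le_total A Φ with hAΦ | hAΦ
  · have h3 : (1 + Real.exp (θ * B) * C) ≤ ρ * (Φ / B) := by
      rw [hA, div_le_iff₀ hρpos] at hAΦ
      rw [mul_div_assoc', le_div_iff₀ hBpos]
      linarith
    have h4 : 1 - ρ * (Φ / B / n) + Real.exp (θ * B) * (C / n) ≤ 1 - 1 / n := by
      have : (1 + Real.exp (θ * B) * C) / n ≤ ρ * (Φ / B) / n := by gcongr
      have e1 : ρ * (Φ / B) / n = ρ * (Φ / B / n) := by ring
      have e2 : (1 + Real.exp (θ * B) * C) / n = 1 / n + Real.exp (θ * B) * (C / n) := by ring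
      linarith
    have h5 : 0 ≤ (1 + Real.exp (θ * B) * C) * Real.exp (θ * A) / n := by positivity
    nlinarith
  · have h3 : 0 ≤ ρ * (Φ / B / n) := by positivity
    have h4 : Real.exp (θ * Φ) * (1 - ρ * (Φ / B / n) + Real.exp (θ * B) * (C / n)) ≤
        Real.exp (θ * Φ) * (1 + Real.exp (θ * B) * (C / n)) := by
      gcongr
      linarith
    have h5 : Real.exp (θ * Φ) * (1 + Real.exp (θ * B) * (C / n)) =
        (1 - 1 / n) * Real.exp (θ * Φ) + (1 + Real.exp (θ * B) * C) * Real.exp (θ * Φ) / n := by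
      ring
    have h6 : (1 + Real.exp (θ * B) * C) * Real.exp (θ * Φ) / n ≤
        (1 + Real.exp (θ * B) * C) * Real.exp (θ * A) / n := by gcongr
    linarith

theorem exists_iter_exp_rareWeight_le (hm : 1 ≤ m) (hd : 2 * m < d) (hg : Good m d n0 g0)
    (hη : 0 < η) (hη1 : η * (2 * (1 + 2 ^ (d + 1) ^ s)) ≤ 1) {θ : ℝ} (hθ : 0 < θ) :
    ∃ C : ℝ, ∀ k, iter m d n0 k
      (fun g => Real.exp (θ * rareWeight m d s η g (n0 + k))) g0 ≤ C := by
  obtain ⟨C, hC0, hC⟩ := step_exp_rareWeight hm hd hη hη1 hθ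
  refine ⟨max (Real.exp (θ * rareWeight m d s η g0 n0)) C, fun k => ?_⟩
  induction k with
  | zero => exact le_max_left _ _
  | succ k ih =>
    have hn : (1 : ℝ) ≤ ((n0 + k : ℕ) : ℝ) := by
      have := hg.le_n
      exact_mod_cast (by omega : 1 ≤ n0 + k)
    rw [iter_succ]
    have h1 : iter m d n0 k (step m d (n0 + k)
        (fun g => Real.exp (θ * rareWeight m d s η g (n0 + (k + 1))))) g0 ≤
        iter m d n0 k (fun g => (1 - 1 / ((n0 + k : ℕ) : ℝ)) *
          Real.exp (θ * rareWeight m d s η g (n0 + k)) + C / ((n0 + k : ℕ) : ℝ)) g0 :=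
      iter_mono hd hg fun g hg' => hC _ g hg'
    refine h1.trans ?_
    rw [iter_add, iter_mul, iter_const hd hg]
    set M := max (Real.exp (θ * rareWeight m d s η g0 n0)) C
    have hM : C ≤ M := le_max_right _ _
    have h2 : 0 ≤ 1 - 1 / ((n0 + k : ℕ) : ℝ) := by
      rw [sub_nonneg, div_le_one (by linarith)]
      exact hn
    calc (1 - 1 / ((n0 + k : ℕ) : ℝ)) * iter m d n0 k
          (fun g => Real.exp (θ * rareWeight m d s η g (n0 + k))) g0 + C / ((n0 + k : ℕ) : ℝ)
        ≤ (1 - 1 / ((n0 + k : ℕ) : ℝ)) * M + M / ((n0 + k : ℕ) : ℝ) := by gcongr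
      _ = M := by ring

/-- The vertices covered by rare sets. -/
noncomputable def rareVerts (m d s : ℕ) (g : SimpleGraph ℕ) (n : ℕ) : Finset ℕ :=
  (rares m d s g n).biUnion id

theorem mem_rareVerts {v : ℕ} : v ∈ rareVerts m d s g n ↔ ∃ W ∈ rares m d s g n, v ∈ W := by
  simp [rareVerts]

/-- The number of vertices covered by rare sets has uniformly bounded exponential moments. -/
theorem exists_iter_pow_rareVerts_le (hm : 1 ≤ m) (hd : 2 * m < d) (hg : Good m d n0 g0)
    (s : ℕ) {b : ℝ} (hb : 1 < b) :
    ∃ C : ℝ, ∀ k, iter m d n0 k (fun g => b ^ (rareVerts m d s g (n0 + k)).card) g0 ≤ C := by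
  set η : ℝ := 1 / (2 * (1 + 2 ^ (d + 1) ^ s)) with hη
  have hηpos : 0 < η := by positivity
  have hη1 : η * (2 * (1 + 2 ^ (d + 1) ^ s)) ≤ 1 := by
    rw [hη, one_div, inv_mul_cancel₀ (by positivity)]
  have hη1' : η ≤ 1 := by
    have : (0 : ℝ) < 2 ^ (d + 1) ^ s := by positivity
    nlinarith
  have hlog : 0 < Real.log b := Real.log_pos hb
  obtain ⟨C, hC⟩ := exists_iter_exp_rareWeight_le (s := s) hm hd hg hηpos hη1
    (θ := (s + 1) * Real.log b / η ^ (s * d)) (by positivity)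
  refine ⟨C, fun k => (iter_mono hd hg fun g hg' => ?_).trans (hC k)⟩
  have h1 : (rareVerts m d s g (n0 + k)).card ≤ (rares m d s g (n0 + k)).card * s :=
    Finset.card_biUnion_le_card_mul _ _ _ fun W hW => (mem_rares.1 hW).2.card_le
  have h2 := card_rares_le_rareWeight (s := s) hηpos hη1' hg'
  rw [← le_div_iff₀ (by positivity)] at h2
  have h1' : ((rareVerts m d s g (n0 + k)).card : ℝ) ≤ (rares m d s g (n0 + k)).card * (s + 1) := by
    have : ((rareVerts m d s g (n0 + k)).card : ℝ) ≤ (rares m d s g (n0 + k)).card * s := by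
      exact_mod_cast h1
    have h0 : (0 : ℝ) ≤ (rares m d s g (n0 + k)).card := Nat.cast_nonneg _
    linarith
  calc b ^ (rareVerts m d s g (n0 + k)).card
      = Real.exp (Real.log b * (rareVerts m d s g (n0 + k)).card) := by
        rw [mul_comm, Real.exp_nat_mul, Real.exp_log (by linarith)]
    _ ≤ Real.exp (Real.log b * (rareWeight m d s η g (n0 + k) / η ^ (s * d) * (s + 1))) := by
        have h0 : (0 : ℝ) ≤ (s : ℝ) + 1 := by positivity
        gcongr
        exact h1'.trans (mul_le_mul_of_nonneg_right h2 h0)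
    _ = _ := by
        congr 1
        ring

end UA

namespace UA

/-- A real sequence that is uniformly approximated by convergent sequences converges. -/
theorem exists_tendsto_of_approx {a : ℕ → ℝ}
    (h : ∀ ε > 0, ∃ x : ℕ → ℝ, (∃ c, Tendsto x atTop (𝓝 c)) ∧ ∀ᶠ k in atTop, |a k - x k| ≤ ε) :
    ∃ c, Tendsto a atTop (𝓝 c) := by
  refine cauchySeq_tendsto_of_complete ?_
  rw [Metric.cauchySeq_iff']
  intro ε hε
  obtain ⟨x, ⟨c, hc⟩, hx⟩ := h (ε / 5) (by positivity)
  have h1 := (Metric.tendsto_nhds.1 hc) (ε / 5) (by positivity)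
  obtain ⟨N, hN⟩ := (hx.and h1).exists_forall_of_atTop
  refine ⟨N, fun k hk => ?_⟩
  have e1 := hN k hk
  have e2 := hN N le_rfl
  simp only [Real.dist_eq] at *
  rw [abs_le, abs_lt] at e1 e2
  rw [abs_lt]
  constructor <;> linarith [e1.1.1, e1.1.2, e1.2.1, e1.2.2, e2.1.1, e2.1.2, e2.2.1, e2.2.2]

section Moebius

variable {V V' : Type*} [DecidableEq V'] [DecidableEq V]

/-- The Möbius transform of a set function. -/
noncomputable def mob (F : Finset V → ℝ) (T : Finset V) : ℝ :=
  ∑ U ∈ T.powerset, (-1) ^ (T.card + U.card) * F U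

theorem mob_congr {F F' : Finset V → ℝ} {T : Finset V} (h : ∀ U ⊆ T, F U = F' U) :
    mob F T = mob F' T :=
  Finset.sum_congr rfl fun U hU => by rw [h U (Finset.mem_powerset.1 hU)]

theorem mob_insert (F : Finset V → ℝ) {T : Finset V} {x : V} (hx : x ∉ T) :
    mob F (insert x T) = mob (fun U => F (insert x U)) T - mob F T := by
  simp only [mob]
  rw [Finset.sum_powerset_insert hx, Finset.card_insert_of_notMem hx, add_comm,
    sub_eq_add_neg, ← Finset.sum_neg_distrib]
  congr 1
  · refine Finset.sum_congr rfl fun U hU => ?_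
    rw [Finset.card_insert_of_notMem fun h => hx (Finset.mem_powerset.1 hU h),
      show T.card + 1 + (U.card + 1) = T.card + U.card + 2 by ring, pow_add]
    norm_num
  · refine Finset.sum_congr rfl fun U _ => ?_
    rw [show T.card + 1 + U.card = T.card + U.card + 1 by ring, pow_succ]
    ring

theorem sum_mob (U : Finset V) : ∀ F : Finset V → ℝ, ∑ T ∈ U.powerset, mob F T = F U := by
  induction U using Finset.induction_on with
  | empty => intro F; simp [mob]
  | insert x U hx ih =>
    intro F
    rw [Finset.sum_powerset_insert hx, ← Finset.sum_add_distrib,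
      ← ih (fun U => F (insert x U))]
    refine Finset.sum_congr rfl fun T hT => ?_
    rw [mob_insert F fun h => hx (Finset.mem_powerset.1 hT h)]
    ring

theorem abs_mob_le {F : Finset V → ℝ} (hF : ∀ U, |F U| ≤ 1) (T : Finset V) :
    |mob F T| ≤ 2 ^ T.card := by
  refine (Finset.abs_sum_le_sum_abs _ _).trans ?_
  have : ∀ U ∈ T.powerset, |(-1 : ℝ) ^ (T.card + U.card) * F U| ≤ 1 := fun U _ => by
    rw [abs_mul, abs_pow, abs_neg, abs_one, one_pow, one_mul]
    exact hF U
  refine (Finset.sum_le_card_nsmul _ _ _ this).trans ?_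
  rw [Finset.card_powerset, nsmul_eq_mul, mul_one]
  norm_num

theorem mob_eq_zero {F : Finset V → ℝ} {T : Finset V} {x : V} (hx : x ∈ T)
    (h : ∀ U ⊆ T.erase x, F (insert x U) = F U) : mob F T = 0 := by
  rw [← Finset.insert_erase hx, mob_insert F (Finset.notMem_erase x T), sub_eq_zero]
  exact mob_congr h

theorem mob_image {e : V → V'} (he : Function.Injective e) (F : Finset V' → ℝ) (T : Finset V) :
    mob F (T.image e) = mob (fun U => F (U.image e)) T := by
  simp only [mob]
  rw [Finset.powerset_image, Finset.sum_image fun U _ U' _ h => Finset.image_injective he h]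
  refine Finset.sum_congr rfl fun U _ => ?_
  rw [Finset.card_image_of_injective _ he, Finset.card_image_of_injective _ he]

end Moebius

/-- A finite pattern: a graph on `K ⊆ Fin b`, prescribed degrees in the ambient graph, and a
root. -/
structure Pat (b d : ℕ) where
  /-- the adjacency relation -/
  H : SimpleGraph (Fin b)
  /-- the vertex set -/
  K : Finset (Fin b)
  /-- the prescribed degrees -/
  D : Fin b → Fin (d + 1)
  /-- the root -/
  i : Fin b

instance instFinitePat (b d : ℕ) : Finite (Pat b d) := by
  refine Finite.of_injective (β := (SimpleGraph (Fin b) × Finset (Fin b)) ×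
    (Fin b → Fin (d + 1)) × Fin b) (fun P => ((P.H, P.K), P.D, P.i)) ?_
  rintro ⟨⟩ ⟨⟩ h
  simp only [Prod.mk.injEq] at h
  obtain ⟨⟨rfl, rfl⟩, rfl, rfl⟩ := h
  rfl

noncomputable instance instFintypePat (b d : ℕ) : Fintype (Pat b d) := Fintype.ofFinite _

section Occurrences

variable {V V' : Type*} {b d m : ℕ}

/-- `f` is an occurrence of `P` in the graph `H` with degree function `D`, inside `U`. -/
structure IsOcc (P : Pat b d) (H : SimpleGraph V) (D : V → ℕ) (U : Finset V)
    (f : Fin b → V) : Prop where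
  mem : ∀ v ∈ P.K, f v ∈ U
  inj : Set.InjOn f P.K
  adj : ∀ u ∈ P.K, ∀ v ∈ P.K, (P.H.Adj u v ↔ H.Adj (f u) (f v))
  deg : ∀ v ∈ P.K, D (f v) = P.D v

theorem IsOcc.mono {P : Pat b d} {H : SimpleGraph V} {D : V → ℕ} {U U' : Finset V}
    {f : Fin b → V} (h : IsOcc P H D U f) (hU : ∀ v ∈ P.K, f v ∈ U') : IsOcc P H D U' f :=
  ⟨hU, h.inj, h.adj, h.deg⟩

open Classical in
/-- The roots of the occurrences of `P` inside `U`. -/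
noncomputable def roots (P : Pat b d) (H : SimpleGraph V) (D : V → ℕ) (U : Finset V) : Finset V :=
  U.filter (fun x => ∃ f, IsOcc P H D U f ∧ f P.i = x)

/-- The pattern is connected and contains its root. -/
def Pat.Connected (P : Pat b d) : Prop :=
  P.i ∈ P.K ∧ ∀ u ∈ P.K, ∀ w ∈ P.K, Conn P.H P.K u w

/-- The pattern is connected, has an unsaturated vertex, and is not abundant. -/
def Pat.IsRare (m : ℕ) (P : Pat b d) : Prop :=
  P.Connected ∧ (∃ v ∈ P.K, (P.D v : ℕ) < d) ∧ ¬ Ab m d P.H P.K (fun v => P.D v)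

theorem mem_roots {P : Pat b d} (hP : P.i ∈ P.K) {H : SimpleGraph V} {D : V → ℕ}
    {U : Finset V} {x : V} : x ∈ roots P H D U ↔ ∃ f, IsOcc P H D U f ∧ f P.i = x := by
  classical
  rw [roots, Finset.mem_filter, and_iff_right_of_imp]
  rintro ⟨f, hf, rfl⟩
  exact hf.mem _ hP

theorem roots_image [DecidableEq V'] {P : Pat b d} (hP : P.i ∈ P.K) {e : V → V'}
    (he : Function.Injective e)
    {H : SimpleGraph V} {H' : SimpleGraph V'} {D : V → ℕ} {D' : V' → ℕ}
    (hH : ∀ u v, H.Adj u v ↔ H'.Adj (e u) (e v)) (hD : ∀ v, D v = D' (e v)) (T : Finset V) :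
    (roots P H' D' (T.image e)).card = (roots P H D T).card := by
  rw [← Finset.card_image_of_injective (roots P H D T) he]
  congr 1
  ext y
  simp only [Finset.mem_image, mem_roots hP]
  constructor
  · rintro ⟨f, hf, rfl⟩
    obtain ⟨x, -, hx⟩ := Finset.mem_image.1 (hf.mem _ hP)
    have : Nonempty V := ⟨x⟩
    have hinv : ∀ v ∈ P.K, Function.invFun e (f v) ∈ T ∧ e (Function.invFun e (f v)) = f v := by
      intro v hv
      obtain ⟨z, hz, hzv⟩ := Finset.mem_image.1 (hf.mem _ hv)
      rw [← hzv, Function.leftInverse_invFun he z]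
      exact ⟨hz, rfl⟩
    refine ⟨_, ⟨fun v => Function.invFun e (f v), ⟨fun v hv => (hinv v hv).1, ?_, ?_, ?_⟩, rfl⟩,
      (hinv _ hP).2⟩
    · intro u hu v hv huv
      refine hf.inj hu hv ?_
      rw [← (hinv u hu).2, ← (hinv v hv).2]
      exact congrArg e huv
    · intro u hu v hv
      rw [hf.adj u hu v hv, hH, (hinv u hu).2, (hinv v hv).2]
    · intro v hv
      rw [hD, (hinv v hv).2, hf.deg v hv]
  · rintro ⟨x, ⟨f, hf, rfl⟩, rfl⟩
    refine ⟨fun v => e (f v), ⟨fun v hv => Finset.mem_image_of_mem e (hf.mem v hv), ?_, ?_, ?_⟩,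
      rfl⟩
    · intro u hu v hv huv
      exact hf.inj hu hv (he huv)
    · intro u hu v hv
      rw [hf.adj u hu v hv, hH]
    · intro v hv
      rw [← hD, hf.deg v hv]

open Classical in
/-- The numbers of roots of the rare patterns. -/
noncomputable def rareVec (m : ℕ) (H : SimpleGraph V) (D : V → ℕ) (U : Finset V)
    (P : Pat b d) : ℕ :=
  if P.IsRare m then (roots P H D U).card else 0

variable [DecidableEq V]

/-- A set on which the Möbius transform does not vanish is covered by rare occurrences. -/
theorem exists_occ_of_mob_ne_zero {H : SimpleGraph V} {D : V → ℕ} {Ψ : (Pat b d → ℕ) → ℝ}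
    {T : Finset V} (h : mob (fun U => Ψ (rareVec m H D U)) T ≠ 0) {x : V} (hx : x ∈ T) :
    ∃ P : Pat b d, P.IsRare m ∧ ∃ f, IsOcc P H D T f ∧ ∃ v ∈ P.K, f v = x := by
  by_contra hcon
  push Not at hcon
  refine h (mob_eq_zero hx fun U hU => ?_)
  congr 1
  funext P
  simp only [rareVec]
  split_ifs with hP
  · have hPi := hP.1.1
    congr 1
    have hxU : insert x U ⊆ T := Finset.insert_subset hx (hU.trans (Finset.erase_subset _ _))
    ext y
    rw [mem_roots hPi, mem_roots hPi]
    constructor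
    · rintro ⟨f, hf, rfl⟩
      refine ⟨f, hf.mono fun v hv => ?_, rfl⟩
      exact (Finset.mem_insert.1 (hf.mem v hv)).resolve_left
        (hcon P hP f (hf.mono fun v hv => hxU (hf.mem v hv)) v hv)
    · rintro ⟨f, hf, rfl⟩
      exact ⟨f, hf.mono fun v hv => Finset.mem_insert_of_mem (hf.mem v hv), rfl⟩
  · rfl

end Occurrences

variable {b m d n n0 : ℕ} {g g0 : SimpleGraph ℕ}

theorem IsOcc.image_mem_rares {P : Pat b d} (hP : P.IsRare m) {f : Fin b → ℕ}
    (hf : IsOcc P g (graphDeg g) (Finset.Icc 1 n) f) : P.K.image f ∈ rares m d b g n := by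
  rw [mem_rares]
  refine ⟨Finset.image_subset_iff.2 hf.mem, ?_, ?_, ?_, ?_⟩
  · refine Finset.card_image_le.trans ?_
    simpa using Finset.card_le_univ P.K
  · obtain ⟨v, hv, hlt⟩ := hP.2.1
    exact ⟨f v, Finset.mem_image_of_mem f hv, by rw [hf.deg v hv]; exact hlt⟩
  · intro u hu w hw
    obtain ⟨u, hu', rfl⟩ := Finset.mem_image.1 hu
    obtain ⟨w, hw', rfl⟩ := Finset.mem_image.1 hw
    exact (hP.1.2 u hu' w hw').map (fun v hv => Finset.mem_image_of_mem f hv)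
      fun a ha c hc => (hf.adj a ha c hc).1
  · intro hab
    exact hP.2.2 (hab.pullback hf.inj (fun v hv => Finset.mem_image_of_mem f hv) hf.adj
      (fun v hv => (hf.deg v hv).symm) fun v _ => Nat.lt_succ_iff.1 (P.D v).2)

theorem subset_rareVerts_of_mob_ne_zero {Ψ : (Pat b d → ℕ) → ℝ} {T : Finset ℕ}
    (hT : T ⊆ Finset.Icc 1 n)
    (h : mob (fun U => Ψ (rareVec m g (graphDeg g) U)) T ≠ 0) : T ⊆ rareVerts m d b g n := by
  intro x hx
  obtain ⟨P, hP, f, hf, v, hv, rfl⟩ := exists_occ_of_mob_ne_zero h hx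
  exact mem_rareVerts.2 ⟨_, (hf.mono fun v hv => hT (hf.mem v hv)).image_mem_rares hP,
    Finset.mem_image_of_mem f hv⟩

/-- The large sets contribute little to the Möbius expansion. -/
theorem abs_sum_mob_large_le {Ψ : (Pat b d → ℕ) → ℝ} (hΨ : ∀ x, |Ψ x| ≤ 1) (J n : ℕ)
    (g : SimpleGraph ℕ) :
    |∑ T ∈ (Finset.Icc 1 n).powerset.filter (J < ·.card),
      mob (fun U => Ψ (rareVec m g (graphDeg g) U)) T| ≤
      (1 / 2) ^ J * 5 ^ (rareVerts m d b g n).card := by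
  classical
  set F := fun U => Ψ (rareVec m g (graphDeg g) U)
  refine (Finset.abs_sum_le_sum_abs _ _).trans ?_
  have h5 : (5 : ℝ) ^ (rareVerts m d b g n).card =
      ∑ T ∈ (rareVerts m d b g n).powerset, 4 ^ T.card := by
    have := Finset.sum_pow_mul_eq_add_pow (4 : ℝ) 1 (rareVerts m d b g n)
    simp only [one_pow, mul_one] at this
    rw [this]
    norm_num
  rw [h5, Finset.mul_sum]
  have h1 : ∑ T ∈ (Finset.Icc 1 n).powerset.filter (J < ·.card), |mob F T| =
      ∑ T ∈ ((Finset.Icc 1 n).powerset.filter (J < ·.card)).filter (mob F · ≠ 0), |mob F T| := by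
    refine (Finset.sum_filter_of_ne ?_).symm
    intro T _ hT
    exact abs_ne_zero.1 hT
  rw [h1]
  calc ∑ T ∈ ((Finset.Icc 1 n).powerset.filter (J < ·.card)).filter (mob F · ≠ 0), |mob F T|
      ≤ ∑ T ∈ ((Finset.Icc 1 n).powerset.filter (J < ·.card)).filter (mob F · ≠ 0),
        (1 / 2 : ℝ) ^ J * 4 ^ T.card := by
        refine Finset.sum_le_sum fun T hT => ?_
        have hJ : J ≤ T.card := (Finset.mem_filter.1 (Finset.mem_filter.1 hT).1).2.le
        refine (abs_mob_le (fun U => hΨ _) T).trans ?_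
        have h2 : (1 / 2 : ℝ) ^ T.card ≤ (1 / 2) ^ J :=
          pow_le_pow_of_le_one (by norm_num) (by norm_num) hJ
        calc (2 : ℝ) ^ T.card = (1 / 2) ^ T.card * 4 ^ T.card := by
              rw [← mul_pow]
              norm_num
          _ ≤ _ := by gcongr
    _ ≤ _ := by
        refine Finset.sum_le_sum_of_subset_of_nonneg ?_ fun _ _ _ => by positivity
        intro T hT
        rw [Finset.mem_filter, Finset.mem_filter, Finset.mem_powerset] at hT
        exact Finset.mem_powerset.2 (subset_rareVerts_of_mob_ne_zero hT.1.1 hT.2)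

theorem card_injections_onto {j : ℕ} {T : Finset ℕ} (hT : T.card = j) {I : Finset (Fin j → ℕ)}
    (hI : ∀ f, f ∈ I ↔ Function.Injective f ∧ Finset.univ.image f = T) :
    I.card = j.factorial := by
  have h1 : I = Finset.univ.image
      (fun σ : Equiv.Perm (Fin j) => fun x => (T.orderIsoOfFin hT (σ x) : ℕ)) := by
    ext f
    rw [hI, Finset.mem_image]
    constructor
    · rintro ⟨hinj, him⟩
      have hmem : ∀ x, f x ∈ T := fun x => him ▸ Finset.mem_image_of_mem f (Finset.mem_univ x)
      let f' : Fin j → T := fun x => ⟨f x, hmem x⟩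
      have hf' : Function.Bijective f' := by
        rw [Fintype.bijective_iff_injective_and_card]
        refine ⟨fun x y hxy => hinj (congrArg Subtype.val hxy), ?_⟩
        simp [hT]
      refine ⟨(Equiv.ofBijective f' hf').trans (T.orderIsoOfFin hT).toEquiv.symm,
        Finset.mem_univ _, ?_⟩
      funext x
      simp [f']
    · rintro ⟨σ, -, rfl⟩
      have hinj : Function.Injective (fun x => (T.orderIsoOfFin hT (σ x) : ℕ)) := fun x y hxy =>
        σ.injective ((T.orderIsoOfFin hT).injective (Subtype.ext hxy))
      refine ⟨hinj, Finset.eq_of_subset_of_card_le ?_ ?_⟩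
      · intro y hy
        obtain ⟨x, -, rfl⟩ := Finset.mem_image.1 hy
        exact (T.orderIsoOfFin hT (σ x)).2
      · rw [Finset.card_image_of_injective _ hinj]
        simp [hT]
  rw [h1, Finset.card_image_of_injective]
  · rw [Finset.card_univ, Fintype.card_perm, Fintype.card_fin]
  · intro σ τ h
    refine Equiv.ext fun x => ?_
    have := congrFun h x
    exact (T.orderIsoOfFin hT).injective (Subtype.ext this)

theorem rareVec_image {V : Type*} {f : V → ℕ} (hf : Function.Injective f)
    {H : SimpleGraph V} {D : V → ℕ} (hH : ∀ u v, H.Adj u v ↔ g.Adj (f u) (f v))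
    (hD : ∀ v, D v = graphDeg g (f v)) (T : Finset V) :
    (rareVec m g (graphDeg g) (T.image f) : Pat b d → ℕ) = rareVec m H D T := by
  funext P
  simp only [rareVec]
  split_ifs with hP
  · exact roots_image hP.1.1 hf hH hD T
  · rfl

/-- The terms of order `j` in the Möbius expansion are a combination of pattern counts. -/
theorem factorial_mul_sum_mob (hg : Good m d n g) (Ψ : (Pat b d → ℕ) → ℝ) (j : ℕ) :
    (j.factorial : ℝ) * ∑ T ∈ (Finset.Icc 1 n).powersetCard j,
      mob (fun U => Ψ (rareVec m g (graphDeg g) U)) T =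
    ∑ Q : SimpleGraph (Fin j) × (Fin j → Fin (d + 1)),
      mob (fun U => Ψ (rareVec m Q.1 (fun v => Q.2 v) U)) Finset.univ *
        cnt Q.1 Finset.univ (fun v => (Q.2 v : ℕ)) g n := by
  classical
  set F := fun U => Ψ (rareVec m g (graphDeg g) U) with hF
  set I : Finset (Fin j → ℕ) := (Fintype.piFinset fun _ => Finset.Icc 1 n).filter
    Function.Injective with hIdef
  have hI : ∀ f, f ∈ I ↔ (∀ v, f v ∈ Finset.Icc 1 n) ∧ Function.Injective f := fun f => by
    rw [hIdef, Finset.mem_filter, Fintype.mem_piFinset]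
  have hL : (j.factorial : ℝ) * ∑ T ∈ (Finset.Icc 1 n).powersetCard j, mob F T =
      ∑ f ∈ I, mob F (Finset.univ.image f) := by
    rw [Finset.mul_sum, ← Finset.sum_fiberwise_of_maps_to (s := I)
      (t := (Finset.Icc 1 n).powersetCard j) (g := fun f => Finset.univ.image f)]
    · refine Finset.sum_congr rfl fun T hT => ?_
      rw [Finset.mem_powersetCard] at hT
      rw [Finset.sum_congr rfl (g := fun _ => mob F T), Finset.sum_const, nsmul_eq_mul,
        card_injections_onto hT.2]
      · intro f
        rw [Finset.mem_filter, hI]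
        refine ⟨fun h => ⟨h.1.2, h.2⟩, fun h => ⟨⟨fun v => hT.1 ?_, h.1⟩, h.2⟩⟩
        rw [← h.2]
        exact Finset.mem_image_of_mem f (Finset.mem_univ v)
      · intro f hf
        rw [(Finset.mem_filter.1 hf).2]
    · intro f hf
      rw [hI] at hf
      rw [Finset.mem_powersetCard, Finset.card_image_of_injective _ hf.2]
      refine ⟨Finset.image_subset_iff.2 fun v _ => hf.1 v, by simp⟩
  have hemb : ∀ Q : SimpleGraph (Fin j) × (Fin j → Fin (d + 1)), ∀ f,
      f ∈ emb Q.1 Finset.univ (fun v => (Q.2 v : ℕ)) g n ↔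
        f ∈ I ∧ (∀ u v, Q.1.Adj u v ↔ g.Adj (f u) (f v)) ∧ ∀ v, graphDeg g (f v) = Q.2 v := by
    intro Q f
    rw [mem_emb, hI]
    constructor
    · intro h
      exact ⟨⟨fun v => h.mem v (Finset.mem_univ v),
        fun u v huv => h.inj (by simp) (by simp) huv⟩,
        fun u v => h.adj u (Finset.mem_univ u) v (Finset.mem_univ v),
        fun v => h.deg v (Finset.mem_univ v)⟩
    · rintro ⟨⟨h1, h2⟩, h3, h4⟩
      exact ⟨fun v _ => h1 v, fun v hv => absurd (Finset.mem_univ v) hv, h2.injOn,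
        fun u _ v _ => h3 u v, fun v _ => h4 v⟩
  have hR : ∀ Q : SimpleGraph (Fin j) × (Fin j → Fin (d + 1)),
      mob (fun U => Ψ (rareVec m Q.1 (fun v => Q.2 v) U)) Finset.univ *
        cnt Q.1 Finset.univ (fun v => (Q.2 v : ℕ)) g n =
      ∑ f ∈ I, if f ∈ emb Q.1 Finset.univ (fun v => (Q.2 v : ℕ)) g n then
        mob F (Finset.univ.image f) else 0 := by
    intro Q
    have hsub : I.filter (· ∈ emb Q.1 Finset.univ (fun v => (Q.2 v : ℕ)) g n) =
        emb Q.1 Finset.univ (fun v => (Q.2 v : ℕ)) g n := by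
      ext f
      rw [Finset.mem_filter, hemb]
      tauto
    rw [← Finset.sum_filter, hsub, Finset.sum_congr rfl
      (g := fun _ => mob (fun U => Ψ (rareVec m Q.1 (fun v => Q.2 v) U)) Finset.univ),
      Finset.sum_const, nsmul_eq_mul, mul_comm, cnt]
    intro f hf
    rw [hemb, hI] at hf
    rw [mob_image hf.1.2]
    refine mob_congr fun U _ => ?_
    rw [hF]
    simp only
    rw [rareVec_image hf.1.2 hf.2.1 fun v => (hf.2.2 v).symm]
  rw [hL, Finset.sum_congr rfl fun Q _ => hR Q, Finset.sum_comm]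
  refine Finset.sum_congr rfl fun f hf => ?_
  have hf' := (hI f).1 hf
  let Q0 : SimpleGraph (Fin j) × (Fin j → Fin (d + 1)) :=
    (g.comap f, fun v => ⟨graphDeg g (f v), Nat.lt_succ_iff.2 (hg.deg_le _ (hf'.1 v))⟩)
  rw [Finset.sum_eq_single Q0]
  · rw [if_pos]
    rw [hemb]
    exact ⟨hf, fun u v => Iff.rfl, fun v => rfl⟩
  · intro Q _ hQ
    rw [if_neg]
    rw [hemb]
    rintro ⟨-, h1, h2⟩
    refine hQ (Prod.ext ?_ ?_)
    · ext u v
      exact h1 u v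
    · funext v
      exact Fin.ext (h2 v).symm
  · intro h
    exact absurd (Finset.mem_univ _) h

theorem exists_tendsto_mul_cnt (hm : 1 ≤ m) (hd : 2 * m < d) (hg : Good m d n0 g0) {j : ℕ}
    (Ψ : (Pat b d → ℕ) → ℝ) (Q : SimpleGraph (Fin j) × (Fin j → Fin (d + 1))) :
    ∃ c, Tendsto (fun k => mob (fun U => Ψ (rareVec m Q.1 (fun v => Q.2 v) U)) Finset.univ *
      iter m d n0 k (fun g => (cnt Q.1 Finset.univ (fun v => (Q.2 v : ℕ)) g (n0 + k) : ℝ)) g0)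
      atTop (𝓝 c) := by
  classical
  by_cases hz : mob (fun U => Ψ (rareVec m Q.1 (fun v => (Q.2 v : ℕ)) U)) Finset.univ = 0
  · refine ⟨0, ?_⟩
    simp only [hz, zero_mul]
    exact tendsto_const_nhds
  have hQd : ∀ v, (Q.2 v : ℕ) ≤ d := fun v => Nat.lt_succ_iff.1 (Q.2 v).2
  have hcov := fun x => exists_occ_of_mob_ne_zero hz (Finset.mem_univ x)
  have hconn : ∀ {P : Pat b d}, P.IsRare m → ∀ {f : Fin b → Fin j},
      IsOcc P Q.1 (fun v => (Q.2 v : ℕ)) Finset.univ f → ∀ u ∈ P.K, ∀ v ∈ P.K,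
      Conn Q.1 Finset.univ (f u) (f v) := by
    intro P hP f hf u hu v hv
    exact (hP.1.2 u hu v hv).map (fun v _ => Finset.mem_univ _)
      fun a ha c hc => (hf.adj a ha c hc).1
  have hU : Unsat d Q.1 Finset.univ (fun v => (Q.2 v : ℕ)) := by
    intro x _
    obtain ⟨P, hP, f, hf, v, hv, rfl⟩ := hcov x
    obtain ⟨u, hu, hlt⟩ := hP.2.1
    exact ⟨f u, Finset.mem_univ _, hconn hP hf v hv u hu, (hf.deg u hu).trans_lt hlt⟩
  have hab : abComps m d Q.1 Finset.univ (fun v => (Q.2 v : ℕ)) = 0 := by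
    rw [abComps, Finset.card_eq_zero, Finset.filter_eq_empty_iff]
    intro C hC hCab
    obtain ⟨x, -, rfl⟩ := Finset.mem_image.1 hC
    obtain ⟨P, hP, f, hf, v, hv, rfl⟩ := hcov x
    exact hP.2.2 (hCab.pullback hf.inj
      (fun u hu => mem_compOf.2 ⟨Finset.mem_univ _, hconn hP hf v hv u hu⟩) hf.adj
      (fun u hu => (hf.deg u hu).symm) fun u _ => Nat.lt_succ_iff.1 (P.D u).2)
  obtain ⟨c, hc⟩ := tendsto_cnt (H := Q.1) (K := Finset.univ) (D := fun v => (Q.2 v : ℕ))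
    hm hd hg (fun v _ => hQd v) hU
  rw [hab] at hc
  simp only [pow_zero, div_one] at hc
  exact ⟨_, hc.const_mul _⟩

/-- The law of the rare pattern counts converges. -/
theorem exists_tendsto_rareVec (hm : 1 ≤ m) (hd : 2 * m < d) (hg : Good m d n0 g0)
    {Ψ : (Pat b d → ℕ) → ℝ} (hΨ : ∀ x, |Ψ x| ≤ 1) :
    ∃ c, Tendsto (fun k => iter m d n0 k
      (fun g => Ψ (rareVec m g (graphDeg g) (Finset.Icc 1 (n0 + k)))) g0) atTop (𝓝 c) := by
  classical
  obtain ⟨C, hC⟩ := exists_iter_pow_rareVerts_le hm hd hg b (b := 5) (by norm_num)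
  refine exists_tendsto_of_approx fun ε hε => ?_
  obtain ⟨J, hJ⟩ : ∃ J : ℕ, (1 / 2 : ℝ) ^ J * C < ε := by
    have h1 : Tendsto (fun J : ℕ => (1 / 2 : ℝ) ^ J * C) atTop (𝓝 (0 * C)) :=
      (tendsto_pow_atTop_nhds_zero_of_lt_one (by norm_num) (by norm_num)).mul_const C
    rw [zero_mul] at h1
    exact (h1.eventually_lt_const hε).exists
  set A : ℕ → ℕ → SimpleGraph ℕ → ℝ := fun j k g =>
    ∑ T ∈ (Finset.Icc 1 (n0 + k)).powersetCard j,
      mob (fun U => Ψ (rareVec m g (graphDeg g) U)) T with hA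
  refine ⟨fun k => iter m d n0 k (fun g => ∑ j ∈ Finset.range (J + 1), A j k g) g0, ?_,
    Eventually.of_forall fun k => ?_⟩
  · have h1 : ∀ j, ∃ c, Tendsto (fun k => iter m d n0 k (A j k) g0) atTop (𝓝 c) := by
      intro j
      choose c hc using fun Q => exists_tendsto_mul_cnt (j := j) hm hd hg Ψ Q
      refine ⟨(1 / (j.factorial : ℝ)) * ∑ Q, c Q, ?_⟩
      refine ((tendsto_finsetSum Finset.univ fun Q _ => hc Q).const_mul _).congr fun k => ?_
      have h2 : iter m d n0 k (A j k) g0 = iter m d n0 k (fun g => (1 / (j.factorial : ℝ)) *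
          ∑ Q : SimpleGraph (Fin j) × (Fin j → Fin (d + 1)),
          mob (fun U => Ψ (rareVec m Q.1 (fun v => Q.2 v) U)) Finset.univ *
            cnt Q.1 Finset.univ (fun v => (Q.2 v : ℕ)) g (n0 + k)) g0 := by
        refine iter_congr hd hg fun g hg' => ?_
        rw [← factorial_mul_sum_mob hg' Ψ j, ← mul_assoc, one_div_mul_cancel, one_mul]
        exact_mod_cast j.factorial_ne_zero
      rw [h2, iter_mul, iter_sum]
      simp only [iter_mul]
    choose c hc using h1
    refine ⟨∑ j ∈ Finset.range (J + 1), c j, ?_⟩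
    refine (tendsto_finsetSum (Finset.range (J + 1)) fun j _ => hc j).congr fun k => ?_
    rw [iter_sum]
  · simp only
    rw [← iter_sub]
    refine (iter_abs_le hd hg).trans ?_
    have h2 : iter m d n0 k (fun g =>
        |Ψ (rareVec m g (graphDeg g) (Finset.Icc 1 (n0 + k))) -
          ∑ j ∈ Finset.range (J + 1), A j k g|) g0 ≤
        iter m d n0 k (fun g => (1 / 2) ^ J * 5 ^ (rareVerts m d b g (n0 + k)).card) g0 := by
      refine iter_mono hd hg fun g _ => ?_
      have h3 := sum_mob (Finset.Icc 1 (n0 + k)) (fun U => Ψ (rareVec m g (graphDeg g) U))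
      rw [← Finset.sum_filter_not_add_sum_filter _ (fun T => J < T.card)] at h3
      have h4 : ∑ T ∈ (Finset.Icc 1 (n0 + k)).powerset.filter (fun T => ¬ J < T.card),
          mob (fun U => Ψ (rareVec m g (graphDeg g) U)) T =
          ∑ j ∈ Finset.range (J + 1), A j k g := by
        rw [← Finset.sum_fiberwise_of_maps_to (t := Finset.range (J + 1)) (g := Finset.card)]
        · refine Finset.sum_congr rfl fun j hj => ?_
          rw [hA]
          refine Finset.sum_congr ?_ fun _ _ => rfl
          ext T
          rw [Finset.mem_filter, Finset.mem_filter, Finset.mem_powerset, Finset.mem_powersetCard]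
          have := Finset.mem_range.1 hj
          constructor
          · exact fun h => ⟨h.1.1, h.2⟩
          · exact fun h => ⟨⟨h.1, by omega⟩, h.2⟩
        · intro T hT
          have := (Finset.mem_filter.1 hT).2
          exact Finset.mem_range.2 (by omega)
      rw [← h3, h4, add_sub_cancel_left]
      exact abs_sum_mob_large_le hΨ J (n0 + k) g
    refine h2.trans ?_
    rw [iter_mul]
    have := hC k
    calc (1 / 2 : ℝ) ^ J * iter m d n0 k (fun g => 5 ^ (rareVerts m d b g (n0 + k)).card) g0
        ≤ (1 / 2) ^ J * C := by gcongr
      _ ≤ ε := hJ.le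

end UA

namespace UA

variable {b m d n n' n'' r : ℕ} {g g' g'' : SimpleGraph ℕ} {A A' : Finset ℕ} {θ θ' : ℕ → ℕ}

theorem ball_mono_set (hg : Good m d n g) (r : ℕ) (h : A ⊆ A') : ball g n r A ⊆ ball g n r A' := by
  induction r with
  | zero => exact h
  | succ r ih =>
    rw [ball_succ, ball_succ]
    intro x hx
    rw [mem_nbh hg] at hx ⊢
    rcases hx with hx | ⟨a, ha, hax⟩
    exacts [Or.inl (ih hx), Or.inr ⟨a, ih ha, hax⟩]

theorem ball_insert (hg : Good m d n g) (r c : ℕ) (A : Finset ℕ) :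
    ball g n r (insert c A) = ball g n r {c} ∪ ball g n r A := by
  refine subset_antisymm ?_ (Finset.union_subset
    (ball_mono_set hg r (by simp)) (ball_mono_set hg r (Finset.subset_insert _ _)))
  induction r with
  | zero => simp only [ball_zero]; rw [Finset.insert_eq]
  | succ r ih =>
    simp only [ball_succ]
    intro x hx
    rw [mem_nbh hg] at hx
    rw [Finset.mem_union, mem_nbh hg, mem_nbh hg]
    rcases hx with hx | ⟨a, ha, hax⟩
    · rcases Finset.mem_union.1 (ih hx) with h | h
      exacts [Or.inl (Or.inl h), Or.inr (Or.inl h)]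
    · rcases Finset.mem_union.1 (ih ha) with h | h
      exacts [Or.inl (Or.inr ⟨a, h, hax⟩), Or.inr (Or.inr ⟨a, h, hax⟩)]

theorem mem_ball_symm (hg : Good m d n g) {u v : ℕ} (h : u ∈ ball g n r {v}) :
    v ∈ ball g n r {u} := by
  induction r generalizing u with
  | zero => simpa [ball_zero, eq_comm] using h
  | succ r ih =>
    rw [ball_succ, mem_nbh hg] at h
    rcases h with h | ⟨a, ha, hau⟩
    · exact ball_mono_radius _ _ _ (Nat.le_succ r) (ih h)
    · rw [← ball_ball]
      refine ball_mono_set hg r ?_ (ih ha)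
      rw [Finset.singleton_subset_iff, ball_succ, mem_nbh hg]
      exact Or.inr ⟨u, by simp [ball_zero], hau.symm⟩

theorem ball_subset_Icc (hg : Good m d n g) (hA : A ⊆ Finset.Icc 1 n) (r : ℕ) :
    ball g n r A ⊆ Finset.Icc 1 n := by
  induction r with
  | zero => exact hA
  | succ r ih =>
    rw [ball_succ]
    intro x hx
    rcases (mem_nbh hg).1 hx with hx | ⟨a, -, hax⟩
    exacts [ih hx, hg.mem_of_adj' hax]

theorem conn_ball (hg : Good m d n g) (c r : ℕ) {w : ℕ} (hw : w ∈ ball g n r {c}) :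
    Conn g (ball g n r {c}) c w := by
  induction r generalizing w with
  | zero =>
    rw [ball_zero, Finset.mem_singleton] at hw
    rw [hw]
    exact Conn.refl _
  | succ r ih =>
    have hw' := hw
    rw [ball_succ, mem_nbh hg] at hw'
    have hsub := ball_mono_radius g n {c} (Nat.le_succ r)
    rcases hw' with h | ⟨a, ha, haw⟩
    · exact (ih h).mono hsub
    · exact ((ih ha).mono hsub).trans (Conn.of_adj (hsub ha) hw haw)

/-- Balls around points at large distance are disjoint and span no edges between them. -/
theorem ball_separated (hg : Good m d n g) {c u v : ℕ} (hc : c ∉ ball g n (2 * r + 1) A)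
    (hu : u ∈ ball g n r {c}) (hv : v ∈ ball g n r A) : u ≠ v ∧ ¬ g.Adj u v := by
  have key : u ∉ ball g n (r + 1) A := by
    intro h
    refine hc ?_
    rw [show 2 * r + 1 = r + (r + 1) by ring, ← ball_ball]
    exact ball_mono_set hg r (Finset.singleton_subset_iff.2 h) (mem_ball_symm hg hu)
  constructor
  · rintro rfl
    exact key (ball_mono_radius _ _ _ (Nat.le_succ r) hv)
  · intro h
    refine key ?_
    rw [ball_succ, mem_nbh hg]
    exact Or.inr ⟨v, hv, h.symm⟩

/-- `θ` restricts to a degree preserving isomorphism from the `r`-ball around `A` to its image. -/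
structure BallIso (r : ℕ) (g : SimpleGraph ℕ) (n : ℕ) (g' : SimpleGraph ℕ) (n' : ℕ)
    (A : Finset ℕ) (θ : ℕ → ℕ) : Prop where
  mem : ∀ u ∈ ball g n r A, θ u ∈ Finset.Icc 1 n'
  inj : Set.InjOn θ (ball g n r A)
  adj : ∀ u ∈ ball g n r A, ∀ v ∈ ball g n r A, (g.Adj u v ↔ g'.Adj (θ u) (θ v))
  deg : ∀ u ∈ ball g n r A, graphDeg g' (θ u) = graphDeg g u

theorem BallIso.restrict (h : BallIso r g n g' n' A θ) {s : ℕ} (hs : ball g n s A' ⊆ ball g n r A) :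
    BallIso s g n g' n' A' θ :=
  ⟨fun u hu => h.mem u (hs hu), h.inj.mono (by exact_mod_cast hs),
    fun u hu v hv => h.adj u (hs hu) v (hs hv), fun u hu => h.deg u (hs hu)⟩

theorem BallIso.image_ball (hg : Good m d n g) (hg' : Good m d n' g')
    (h : BallIso r g n g' n' A θ) : ∀ {j : ℕ}, j ≤ r →
    (ball g n j A).image θ = ball g' n' j (A.image θ) := by
  intro j
  induction j with
  | zero => intro _; rfl
  | succ j ih =>
    intro hj
    have ih := ih (Nat.le_of_succ_le hj)
    have hsub : ball g n (j + 1) A ⊆ ball g n r A := ball_mono_radius _ _ _ hj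
    have hsub' : ball g n j A ⊆ ball g n r A := ball_mono_radius _ _ _ (Nat.le_of_succ_le hj)
    ext y
    rw [ball_succ g', mem_nbh hg', ← ih, Finset.mem_image]
    constructor
    · rintro ⟨x, hx, rfl⟩
      have hx' := hx
      rw [ball_succ, mem_nbh hg] at hx'
      rcases hx' with hx' | ⟨a, ha, hax⟩
      · exact Or.inl (Finset.mem_image_of_mem θ hx')
      · exact Or.inr ⟨θ a, Finset.mem_image_of_mem θ ha,
          (h.adj a (hsub' ha) x (hsub hx)).1 hax⟩
    · rintro (hy | ⟨a', ha', hay⟩)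
      · obtain ⟨x, hx, rfl⟩ := Finset.mem_image.1 hy
        exact ⟨x, ball_mono_radius _ _ _ (Nat.le_succ j) hx, rfl⟩
      · obtain ⟨a, ha, rfl⟩ := Finset.mem_image.1 ha'
        have hnb : ∀ x ∈ g.neighborSet a, x ∈ ball g n (j + 1) A := fun x hx => by
          rw [ball_succ, mem_nbh hg]
          exact Or.inr ⟨a, ha, hx⟩
        have heq : Set.image θ (g.neighborSet a) = g'.neighborSet (θ a) := by
          refine Set.eq_of_subset_of_ncard_le ?_ ?_ (hg'.finite_nbr _)
          · rintro _ ⟨x, hx, rfl⟩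
            exact (h.adj a (hsub' ha) x (hsub (hnb x hx))).1 hx
          · rw [Set.InjOn.ncard_image (h.inj.mono fun x hx => hsub (hnb x hx))]
            exact (h.deg a (hsub' ha)).le
        have hy : y ∈ Set.image θ (g.neighborSet a) := by
          rw [heq]
          exact hay
        obtain ⟨x, hx, rfl⟩ := hy
        exact ⟨x, hnb x hx, rfl⟩

theorem BallIso.comp (hg : Good m d n g) (hg' : Good m d n' g')
    (h : BallIso r g n g' n' A θ) (h' : BallIso r g' n' g'' n'' (A.image θ) θ') :
    BallIso r g n g'' n'' A (θ' ∘ θ) := by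
  have hmem : ∀ u ∈ ball g n r A, θ u ∈ ball g' n' r (A.image θ) := fun u hu => by
    rw [← h.image_ball hg hg' le_rfl]
    exact Finset.mem_image_of_mem θ hu
  refine ⟨fun u hu => h'.mem _ (hmem u hu), fun u hu v hv huv =>
    h.inj hu hv (h'.inj (hmem u hu) (hmem v hv) huv), fun u hu v hv => ?_, fun u hu => ?_⟩
  · rw [h.adj u hu v hv, h'.adj _ (hmem u hu) _ (hmem v hv)]
    rfl
  · rw [← h.deg u hu]
    exact h'.deg _ (hmem u hu)

theorem BallIso.symm (hg : Good m d n g) (hg' : Good m d n' g') (hA : A ⊆ Finset.Icc 1 n)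
    (h : BallIso r g n g' n' A θ) : ∃ θ', BallIso r g' n' g n (A.image θ) θ' ∧
      ∀ u ∈ ball g n r A, θ' (θ u) = u := by
  have hinv : ∀ u ∈ ball g n r A, Function.invFunOn θ (ball g n r A) (θ u) = u :=
    fun u hu => h.inj.leftInvOn_invFunOn hu
  refine ⟨Function.invFunOn θ (ball g n r A), ?_, hinv⟩
  have hpre : ∀ y ∈ ball g' n' r (A.image θ), ∃ u ∈ ball g n r A, θ u = y := fun y hy => by
    rw [← h.image_ball hg hg' le_rfl] at hy
    exact Finset.mem_image.1 hy
  refine ⟨fun y hy => ?_, fun y hy z hz hyz => ?_, fun y hy z hz => ?_, fun y hy => ?_⟩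
  · obtain ⟨u, hu, rfl⟩ := hpre y hy
    rw [hinv u hu]
    exact ball_subset_Icc hg hA r hu
  · obtain ⟨u, hu, rfl⟩ := hpre y hy
    obtain ⟨v, hv, rfl⟩ := hpre z hz
    rw [hinv u hu, hinv v hv] at hyz
    rw [hyz]
  · obtain ⟨u, hu, rfl⟩ := hpre y hy
    obtain ⟨v, hv, rfl⟩ := hpre z hz
    rw [hinv u hu, hinv v hv]
    exact (h.adj u hu v hv).symm
  · obtain ⟨u, hu, rfl⟩ := hpre y hy
    rw [hinv u hu]
    exact (h.deg u hu).symm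

/-- `c` and `x` have isomorphic rooted `r`-balls. -/
def SameType (r : ℕ) (g : SimpleGraph ℕ) (n c : ℕ) (g' : SimpleGraph ℕ) (n' x : ℕ) : Prop :=
  ∃ θ, BallIso r g n g' n' {c} θ ∧ θ c = x

theorem SameType.trans (hg : Good m d n g) (hg' : Good m d n' g') {x y z : ℕ}
    (h : SameType r g n x g' n' y) (h' : SameType r g' n' y g'' n'' z) :
    SameType r g n x g'' n'' z := by
  obtain ⟨θ, hθ, rfl⟩ := h
  obtain ⟨θ', hθ', rfl⟩ := h'
  exact ⟨θ' ∘ θ, hθ.comp hg hg' (by simpa using hθ'), rfl⟩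

theorem SameType.symm (hg : Good m d n g) (hg' : Good m d n' g') {x y : ℕ}
    (hx : x ∈ Finset.Icc 1 n) (h : SameType r g n x g' n' y) : SameType r g' n' y g n x := by
  obtain ⟨θ, hθ, rfl⟩ := h
  obtain ⟨θ', hθ', hinv⟩ := hθ.symm hg hg' (Finset.singleton_subset_iff.2 hx)
  exact ⟨θ', by simpa using hθ', hinv x (subset_ball _ _ _ _ (by simp))⟩

/-- Rooted balls are described by patterns. -/
theorem exists_pat (hg : Good m d n g) {c : ℕ} (hb : (d + 1) ^ r ≤ b) :
    ∃ P : Pat b d, P.Connected ∧ ∀ n' g', Good m d n' g' → ∀ x,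
      x ∈ roots P g' (graphDeg g') (Finset.Icc 1 n') ↔ SameType r g n c g' n' x := by
  classical
  set B := ball g n r {c} with hB
  have hBc : B.card ≤ b := by
    have := card_ball_le hg r {c}
    rw [Finset.card_singleton, mul_one] at this
    exact this.trans hb
  have hcB : c ∈ B := subset_ball _ _ _ _ (by simp)
  have hemb : Nonempty (B ↪ Fin b) :=
    Function.Embedding.nonempty_of_card_le (by simpa using hBc)
  obtain ⟨e⟩ := hemb
  have hBne : Nonempty B := ⟨⟨c, hcB⟩⟩
  set f0 : Fin b → ℕ := fun v => (Function.invFun e v : B) with hf0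
  have hf0e : ∀ x : B, f0 (e x) = x := fun x => by
    simp only [hf0, Function.leftInverse_invFun e.injective x]
  set K : Finset (Fin b) := Finset.univ.image e with hK
  have hKB : ∀ v ∈ K, f0 v ∈ B := fun v hv => (Function.invFun e v).2
  have hef0 : ∀ v ∈ K, ∀ h : f0 v ∈ B, e ⟨f0 v, h⟩ = v := by
    intro v hv h
    obtain ⟨x, -, rfl⟩ := Finset.mem_image.1 hv
    congr 1
    exact Subtype.ext (hf0e x)
  have hinj : Set.InjOn f0 K := by
    intro u hu v hv huv
    rw [← hef0 u hu (hKB u hu), ← hef0 v hv (hKB v hv)]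
    congr 1
    exact Subtype.ext huv
  let P : Pat b d := ⟨g.comap f0, K, fun v => ⟨graphDeg g (f0 v),
    Nat.lt_succ_iff.2 (hg.graphDeg_le _)⟩, e ⟨c, hcB⟩⟩
  have hPi : P.i ∈ P.K := Finset.mem_image_of_mem e (Finset.mem_univ _)
  refine ⟨P, ⟨hPi, ?_⟩, ?_⟩
  · have hfrom : ∀ v ∈ K, Conn P.H P.K (e ⟨c, hcB⟩) v := by
      intro v hv
      have h1 := (conn_ball hg c r (hKB v hv)).map (H' := P.H) (L := P.K)
        (f := fun x => if h : x ∈ B then e ⟨x, h⟩ else e ⟨c, hcB⟩) ?_ ?_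
      · rw [dif_pos hcB, dif_pos (hKB v hv), hef0 v hv] at h1
        exact h1
      · intro x hx
        simp only [dif_pos (show x ∈ B from hx)]
        exact Finset.mem_image_of_mem e (Finset.mem_univ _)
      · intro x hx y hy hxy
        simp only [dif_pos (show x ∈ B from hx), dif_pos (show y ∈ B from hy)]
        change g.Adj (f0 _) (f0 _)
        rw [hf0e, hf0e]
        exact hxy
    exact fun u hu w hw => (hfrom u hu).symm.trans (hfrom w hw)
  · intro n' g' hg' x
    rw [mem_roots hPi]
    constructor
    · rintro ⟨f, hf, rfl⟩
      refine ⟨fun x => if h : x ∈ B then f (e ⟨x, h⟩) else 0, ?_, by simp only [dif_pos hcB]; rfl⟩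
      have hKe : ∀ z : B, e z ∈ P.K := fun z => Finset.mem_image_of_mem e (Finset.mem_univ _)
      refine ⟨fun u hu => ?_, fun u hu v hv huv => ?_, fun u hu v hv => ?_, fun u hu => ?_⟩
      · simp only [dif_pos (show u ∈ B from hu)]
        exact hf.mem _ (hKe _)
      · simp only [dif_pos (show u ∈ B from hu), dif_pos (show v ∈ B from hv)] at huv
        exact congrArg Subtype.val (e.injective (hf.inj (hKe _) (hKe _) huv))
      · simp only [dif_pos (show u ∈ B from hu), dif_pos (show v ∈ B from hv)]
        rw [← hf.adj _ (hKe _) _ (hKe _)]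
        change _ ↔ g.Adj (f0 _) (f0 _)
        rw [hf0e, hf0e]
      · simp only [dif_pos (show u ∈ B from hu)]
        rw [hf.deg _ (hKe _)]
        change graphDeg g (f0 _) = _
        rw [hf0e]
    · rintro ⟨θ, hθ, rfl⟩
      refine ⟨fun v => θ (f0 v), ⟨fun v hv => hθ.mem _ (hKB v hv), ?_, ?_, ?_⟩, ?_⟩
      · exact fun u hu v hv huv => hinj hu hv (hθ.inj (hKB u hu) (hKB v hv) huv)
      · exact fun u hu v hv => hθ.adj _ (hKB u hu) _ (hKB v hv)
      · exact fun v hv => hθ.deg _ (hKB v hv)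
      · change θ (f0 (e ⟨c, hcB⟩)) = θ c
        rw [hf0e]

/-- The two graphs have the same numbers of roots of connected patterns, up to threshold `t`. -/
def Agree (d b t : ℕ) (g : SimpleGraph ℕ) (n : ℕ) (g' : SimpleGraph ℕ) (n' : ℕ) : Prop :=
  ∀ P : Pat b d, P.Connected → min t (roots P g (graphDeg g) (Finset.Icc 1 n)).card =
    min t (roots P g' (graphDeg g') (Finset.Icc 1 n')).card

theorem Agree.symm {t : ℕ} (h : Agree d b t g n g' n') : Agree d b t g' n' g n :=
  fun P hP => (h P hP).symm

/-- In graphs with the same pattern counts, a vertex far from `A` has a counterpart of the same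
type far from the image of `A`. -/
theorem exists_far (hg : Good m d n g) (hg' : Good m d n' g') (hA : A ⊆ Finset.Icc 1 n)
    (h : BallIso (3 * r + 2) g n g' n' A θ) {t : ℕ} (hag : Agree d b t g n g' n')
    (hb : (d + 1) ^ r ≤ b) (ht : (d + 1) ^ (2 * r + 1) * A.card < t) {c : ℕ}
    (hc : c ∈ Finset.Icc 1 n) (hfar : c ∉ ball g n (2 * r + 1) A) :
    ∃ c', SameType r g n c g' n' c' ∧ c' ∉ ball g' n' (2 * r + 1) (A.image θ) := by
  classical
  obtain ⟨P, hP, hroots⟩ := exists_pat hg (c := c) hb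
  set R := roots P g (graphDeg g) (Finset.Icc 1 n)
  set R' := roots P g' (graphDeg g') (Finset.Icc 1 n')
  set B := ball g n (2 * r + 1) A with hB
  set B' := ball g' n' (2 * r + 1) (A.image θ) with hB'
  have himB : B.image θ = B' := h.image_ball hg hg' (by omega)
  have hsubB : B ⊆ ball g n (3 * r + 2) A := ball_mono_radius _ _ _ (by omega)
  have hballB : ∀ x ∈ B, ball g n r {x} ⊆ ball g n (3 * r + 2) A := fun x hx => by
    have h1 := ball_mono_set hg r (Finset.singleton_subset_iff.2 hx)
    rw [hB, ball_ball] at h1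
    exact h1.trans (ball_mono_radius _ _ _ (by omega))
  have htype : ∀ x ∈ B, SameType r g n x g' n' (θ x) := fun x hx =>
    ⟨θ, h.restrict (hballB x hx), rfl⟩
  have hBIcc : B ⊆ Finset.Icc 1 n := ball_subset_Icc hg hA _
  have hRB : (R ∩ B).image θ = R' ∩ B' := by
    ext y
    rw [Finset.mem_inter, ← himB, Finset.mem_image, Finset.mem_image]
    constructor
    · rintro ⟨x, hx, rfl⟩
      rw [Finset.mem_inter] at hx
      exact ⟨(hroots _ _ hg' _).2 (((hroots _ _ hg _).1 hx.1).trans hg hg (htype x hx.2)),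
        x, hx.2, rfl⟩
    · rintro ⟨hy, x, hx, rfl⟩
      refine ⟨x, Finset.mem_inter.2 ⟨(hroots _ _ hg _).2 ?_, hx⟩, rfl⟩
      exact ((hroots _ _ hg' _).1 hy).trans hg hg' ((htype x hx).symm hg hg' (hBIcc hx))
  have hcard : (R ∩ B).card = (R' ∩ B').card := by
    rw [← hRB, Finset.card_image_of_injOn]
    exact h.inj.mono fun x hx => hsubB (Finset.mem_inter.1 hx).2
  have hcR : c ∈ R := (hroots _ _ hg _).2 ⟨id, ⟨fun u hu =>
    ball_subset_Icc hg (Finset.singleton_subset_iff.2 hc) r hu, Function.injective_id.injOn,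
    fun u _ v _ => Iff.rfl, fun u _ => rfl⟩, rfl⟩
  have hlt : (R ∩ B).card < R.card := Finset.card_lt_card
    ⟨Finset.inter_subset_left, fun hsub => hfar (Finset.mem_inter.1 (hsub hcR)).2⟩
  have hBt : (R ∩ B).card < t :=
    ((Finset.card_le_card Finset.inter_subset_right).trans (card_ball_le hg _ _)).trans_lt ht
  have hmin := hag P hP
  have hlt' : (R' ∩ B').card < R'.card := by
    change min t R.card = min t R'.card at hmin
    omega
  obtain ⟨c', hc', hc'B⟩ : ∃ c' ∈ R', c' ∉ R' ∩ B' := by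
    by_contra hcon
    push Not at hcon
    exact absurd (Finset.card_le_card hcon) (not_le.2 hlt')
  exact ⟨c', (hroots _ _ hg' _).1 hc', fun hmem => hc'B (Finset.mem_inter.2 ⟨hc', hmem⟩)⟩

/-- The back-and-forth step. -/
theorem exists_extend (hg : Good m d n g) (hg' : Good m d n' g') (hA : A ⊆ Finset.Icc 1 n)
    (h : BallIso (3 * r + 2) g n g' n' A θ) {t : ℕ} (hag : Agree d b t g n g' n')
    (hb : (d + 1) ^ r ≤ b) (ht : (d + 1) ^ (2 * r + 1) * A.card < t) {c : ℕ}
    (hc : c ∈ Finset.Icc 1 n) :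
    ∃ θ', BallIso r g n g' n' (insert c A) θ' ∧ ∀ a ∈ A, θ' a = θ a := by
  classical
  by_cases hnear : c ∈ ball g n (2 * r + 1) A
  · refine ⟨θ, h.restrict ?_, fun a _ => rfl⟩
    have h1 : insert c A ⊆ ball g n (2 * r + 1) A :=
      Finset.insert_subset hnear (subset_ball _ _ _ _)
    have h2 := ball_mono_set hg r h1
    rw [ball_ball] at h2
    exact h2.trans (ball_mono_radius _ _ _ (by omega))
  obtain ⟨c', ⟨φ, hφ, rfl⟩, hfar'⟩ := exists_far hg hg' hA h hag hb ht hc hnear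
  have hr : ball g n r A ⊆ ball g n (3 * r + 2) A := ball_mono_radius _ _ _ (by omega)
  have hθr : BallIso r g n g' n' A θ := h.restrict hr
  have hφim : ∀ u ∈ ball g n r {c}, φ u ∈ ball g' n' r {φ c} := fun u hu => by
    have := hφ.image_ball hg hg' le_rfl
    rw [Finset.image_singleton] at this
    rw [← this]
    exact Finset.mem_image_of_mem φ hu
  have hθim : ∀ u ∈ ball g n r A, θ u ∈ ball g' n' r (A.image θ) := fun u hu => by
    rw [← hθr.image_ball hg hg' le_rfl]
    exact Finset.mem_image_of_mem θ hu
  have hsep : ∀ u ∈ ball g n r {c}, ∀ v ∈ ball g n r A, u ≠ v ∧ ¬ g.Adj u v :=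
    fun u hu v hv => ball_separated hg hnear hu hv
  have hsep' : ∀ u ∈ ball g n r {c}, ∀ v ∈ ball g n r A, φ u ≠ θ v ∧ ¬ g'.Adj (φ u) (θ v) :=
    fun u hu v hv => ball_separated hg' hfar' (hφim u hu) (hθim v hv)
  set ψ : ℕ → ℕ := fun u => if u ∈ ball g n r {c} then φ u else θ u with hψ
  have hψ1 : ∀ u ∈ ball g n r {c}, ψ u = φ u := fun u hu => if_pos hu
  have hψ2 : ∀ u ∈ ball g n r A, ψ u = θ u := fun u hu =>
    if_neg fun hu' => (hsep u hu' u hu).1 rfl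
  refine ⟨ψ, ⟨?_, ?_, ?_, ?_⟩, fun a ha => hψ2 a (subset_ball _ _ _ _ ha)⟩
  · intro u hu
    rw [ball_insert hg, Finset.mem_union] at hu
    rcases hu with hu | hu
    · rw [hψ1 u hu]
      exact hφ.mem u hu
    · rw [hψ2 u hu]
      exact hθr.mem u hu
  · intro u hu v hv huv
    rw [Finset.mem_coe, ball_insert hg, Finset.mem_union] at hu hv
    rcases hu with hu | hu <;> rcases hv with hv | hv
    · rw [hψ1 u hu, hψ1 v hv] at huv
      exact hφ.inj hu hv huv
    · rw [hψ1 u hu, hψ2 v hv] at huv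
      exact absurd huv (hsep' u hu v hv).1
    · rw [hψ2 u hu, hψ1 v hv] at huv
      exact absurd huv.symm (hsep' v hv u hu).1
    · rw [hψ2 u hu, hψ2 v hv] at huv
      exact hθr.inj hu hv huv
  · intro u hu v hv
    rw [ball_insert hg, Finset.mem_union] at hu hv
    rcases hu with hu | hu <;> rcases hv with hv | hv
    · rw [hψ1 u hu, hψ1 v hv]
      exact hφ.adj u hu v hv
    · rw [hψ1 u hu, hψ2 v hv]
      exact iff_of_false (hsep u hu v hv).2 (hsep' u hu v hv).2
    · rw [hψ2 u hu, hψ1 v hv]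
      exact iff_of_false (fun h => (hsep v hv u hu).2 h.symm) fun h => (hsep' v hv u hu).2 h.symm
    · rw [hψ2 u hu, hψ2 v hv]
      exact hθr.adj u hu v hv
  · intro u hu
    rw [ball_insert hg, Finset.mem_union] at hu
    rcases hu with hu | hu
    · rw [hψ1 u hu]
      exact hφ.deg u hu
    · rw [hψ2 u hu]
      exact hθr.deg u hu

end UA

namespace UA

open FirstOrder

/-- Satisfaction of a formula in the graph induced by `g` on `[n]`. -/
def Sat (g : SimpleGraph ℕ) (n : ℕ) {l : ℕ} (φ : Language.graph.BoundedFormula Empty l)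
    (a : Fin l → Set.Icc 1 n) : Prop :=
  @Language.BoundedFormula.Realize Language.graph (Set.Icc 1 n)
    (SimpleGraph.structure (g.induce (Set.Icc 1 n))) Empty l φ default a

theorem exists_eq_var {l : ℕ} (t : Language.graph.Term (Empty ⊕ Fin l)) :
    ∃ j : Fin l, t = Language.Term.var (Sum.inr j) := by
  cases t with
  | var x =>
    cases x with
    | inl e => exact e.elim
    | inr j => exact ⟨j, rfl⟩
  | func f => exact isEmptyElim f

variable {m d n n' r : ℕ} {g g' : SimpleGraph ℕ}

theorem sat_equal {l : ℕ} (i j : Fin l) (a : Fin l → Set.Icc 1 n) :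
    Sat g n (.equal (.var (Sum.inr i)) (.var (Sum.inr j))) a ↔ (a i : ℕ) = a j := by
  rw [← Subtype.ext_iff]
  exact Iff.rfl

theorem sat_rel {l : ℕ} (ts : Fin 2 → Language.graph.Term (Empty ⊕ Fin l)) {i j : Fin l}
    (hi : ts 0 = .var (Sum.inr i)) (hj : ts 1 = .var (Sum.inr j)) (a : Fin l → Set.Icc 1 n) :
    Sat g n (.rel (Language.graphRel.adj : Language.graph.Relations 2) ts) a ↔
      g.Adj (a i) (a j) := by
  let := SimpleGraph.structure (g.induce (Set.Icc 1 n))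
  change (g.induce (Set.Icc 1 n)).Adj ((ts 0).realize (Sum.elim default a))
    ((ts 1).realize (Sum.elim default a)) ↔ _
  rw [hi, hj]
  exact Iff.rfl

theorem sat_imp {l : ℕ} (φ ψ : Language.graph.BoundedFormula Empty l) (a : Fin l → Set.Icc 1 n) :
    Sat g n (φ.imp ψ) a ↔ (Sat g n φ a → Sat g n ψ a) := Iff.rfl

/-- The set of values of a tuple of vertices of `[n]`. -/
def vals {l : ℕ} (a : Fin l → Set.Icc 1 n) : Finset ℕ := Finset.univ.image fun j => (a j : ℕ)

theorem mem_vals {l : ℕ} (a : Fin l → Set.Icc 1 n) (j : Fin l) : (a j : ℕ) ∈ vals a :=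
  Finset.mem_image_of_mem _ (Finset.mem_univ j)

theorem vals_subset {l : ℕ} (a : Fin l → Set.Icc 1 n) : vals a ⊆ Finset.Icc 1 n := by
  intro x hx
  obtain ⟨j, -, rfl⟩ := Finset.mem_image.1 hx
  exact Finset.mem_Icc.2 (a j).2

theorem card_vals_le {l : ℕ} (a : Fin l → Set.Icc 1 n) : (vals a).card ≤ l := by
  simpa [vals] using Finset.card_image_le (s := Finset.univ) (f := fun j => (a j : ℕ))

theorem vals_snoc {l : ℕ} (a : Fin l → Set.Icc 1 n) (x : Set.Icc 1 n) :
    vals (Fin.snoc a x : Fin (l + 1) → Set.Icc 1 n) = insert (x : ℕ) (vals a) := by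
  ext y
  simp only [vals, Finset.mem_image, Finset.mem_univ, true_and, Finset.mem_insert]
  constructor
  · rintro ⟨j, rfl⟩
    refine Fin.lastCases ?_ (fun i => ?_) j
    · left; simp
    · right; exact ⟨i, by simp⟩
  · rintro (rfl | ⟨i, rfl⟩)
    · exact ⟨Fin.last l, by simp⟩
    · exact ⟨i.castSucc, by simp⟩

theorem image_vals {l : ℕ} {a : Fin l → Set.Icc 1 n} {a' : Fin l → Set.Icc 1 n'} {θ : ℕ → ℕ}
    (h : ∀ j, θ (a j) = a' j) : (vals a).image θ = vals a' := by
  unfold vals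
  rw [Finset.image_image]
  exact Finset.image_congr fun j _ => h j

/-- If the balls of radius `r` around two tuples are isomorphic and the graphs have the same numbers
of small connected patterns up to a threshold, the tuples satisfy the same formulas. -/
theorem exists_sat_iff (m d : ℕ) {l : ℕ} (φ : Language.graph.BoundedFormula Empty l) :
    ∃ r b₀ t₀ : ℕ, ∀ b ≥ b₀, ∀ t ≥ t₀, ∀ n g n' g', Good m d n g → Good m d n' g' →
      Agree d b t g n g' n' → ∀ (a : Fin l → Set.Icc 1 n) (a' : Fin l → Set.Icc 1 n') θ,
      BallIso r g n g' n' (vals a) θ → (∀ j, θ (a j) = a' j) → (Sat g n φ a ↔ Sat g' n' φ a') := by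
  induction φ with
  | falsum => exact ⟨0, 0, 0, fun _ _ _ _ _ _ _ _ _ _ _ _ _ _ _ _ => Iff.rfl⟩
  | equal t₁ t₂ =>
    obtain ⟨i, rfl⟩ := exists_eq_var t₁
    obtain ⟨j, rfl⟩ := exists_eq_var t₂
    refine ⟨0, 0, 0, fun _ _ _ _ n g n' g' _ _ _ a a' θ h hθ => ?_⟩
    rw [sat_equal, sat_equal, ← hθ, ← hθ]
    exact ⟨fun h => by rw [h], fun e => h.inj (mem_vals a i) (mem_vals a j) e⟩
  | rel R ts =>
    cases R
    obtain ⟨i, hi⟩ := exists_eq_var (ts 0)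
    obtain ⟨j, hj⟩ := exists_eq_var (ts 1)
    refine ⟨0, 0, 0, fun _ _ _ _ n g n' g' _ _ _ a a' θ h hθ => ?_⟩
    rw [sat_rel ts hi hj, sat_rel ts hi hj, ← hθ, ← hθ]
    exact h.adj _ (mem_vals a i) _ (mem_vals a j)
  | imp φ ψ ihφ ihψ =>
    obtain ⟨r, b₀, t₀, h⟩ := ihφ
    obtain ⟨r', b₀', t₀', h'⟩ := ihψ
    refine ⟨max r r', max b₀ b₀', max t₀ t₀', fun b hb t ht n g n' g' hg hg' hag a a' θ hθ ha => ?_⟩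
    rw [sat_imp, sat_imp,
      h b (le_of_max_le_left hb) t (le_of_max_le_left ht) n g n' g' hg hg' hag a a' θ
        (hθ.restrict (ball_mono_radius g n _ (le_max_left _ _))) ha,
      h' b (le_of_max_le_right hb) t (le_of_max_le_right ht) n g n' g' hg hg' hag a a' θ
        (hθ.restrict (ball_mono_radius g n _ (le_max_right _ _))) ha]
  | @all l φ ih =>
    obtain ⟨r, b₀, t₀, h⟩ := ih
    refine ⟨3 * r + 2, max b₀ ((d + 1) ^ r), max t₀ ((d + 1) ^ (2 * r + 1) * l + 1), ?_⟩
    intro b hb t ht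
    have key : ∀ n g n' g', Good m d n g → Good m d n' g' → Agree d b t g n g' n' →
        ∀ (a : Fin l → Set.Icc 1 n) (a' : Fin l → Set.Icc 1 n') θ,
        BallIso (3 * r + 2) g n g' n' (vals a) θ → (∀ j, θ (a j) = a' j) →
        (Sat g' n' φ.all a' → Sat g n φ.all a) := by
      intro n g n' g' hg hg' hag a a' θ hθ ha hsat x
      obtain ⟨θ', hθ', heq⟩ := exists_extend hg hg' (vals_subset a) hθ hag
        (le_of_max_le_right hb)
        (lt_of_le_of_lt (Nat.mul_le_mul_left _ (card_vals_le a)) (le_of_max_le_right ht))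
        (Finset.mem_Icc.2 x.2)
      have hmem : θ' x ∈ Set.Icc 1 n' := Finset.mem_Icc.1
        (hθ'.mem x (subset_ball g n r _ (Finset.mem_insert_self _ _)))
      rw [← vals_snoc] at hθ'
      refine (h b (le_of_max_le_left hb) t (le_of_max_le_left ht) n g n' g' hg hg' hag
        (Fin.snoc a x) (Fin.snoc a' ⟨θ' x, hmem⟩) θ' hθ' fun j => ?_).2 (hsat ⟨θ' x, hmem⟩)
      refine Fin.lastCases ?_ (fun i => ?_) j
      · simp
      · simp only [Fin.snoc_castSucc]
        rw [heq _ (mem_vals a i), ha]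
    intro n g n' g' hg hg' hag a a' θ hθ ha
    refine ⟨?_, key n g n' g' hg hg' hag a a' θ hθ ha⟩
    obtain ⟨θ', hθ', hinv⟩ := hθ.symm hg hg' (vals_subset a)
    rw [image_vals ha] at hθ'
    refine key n' g' n g hg' hg hag.symm a' a θ' hθ' fun j => ?_
    rw [← ha, hinv _ (subset_ball g n _ _ (mem_vals a j))]

/-- The graph induced by `g` on `[n]` satisfies the sentence `φ`. -/
def Models (φ : Language.graph.Sentence) (n : ℕ) (g : SimpleGraph ℕ) : Prop :=
  @Language.Sentence.Realize Language.graph (Set.Icc 1 n)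
    (SimpleGraph.structure (g.induce (Set.Icc 1 n))) φ

theorem exists_models_iff (m d : ℕ) (φ : Language.graph.Sentence) :
    ∃ b t : ℕ, ∀ n g n' g', Good m d n g → Good m d n' g' →
      Agree d b t g n g' n' → (Models φ n g ↔ Models φ n' g') := by
  obtain ⟨r, b, t, h⟩ := exists_sat_iff m d φ
  refine ⟨b, t, fun n g n' g' hg hg' hag => ?_⟩
  have := h b le_rfl t le_rfl n g n' g' hg hg' hag default default id
  have hball : ball g n r (vals (default : Fin 0 → Set.Icc 1 n)) = ∅ := by
    have h0 := card_ball_le hg r (vals (default : Fin 0 → Set.Icc 1 n))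
    rw [Nat.le_zero.1 (card_vals_le (default : Fin 0 → Set.Icc 1 n))] at h0
    exact Finset.card_eq_zero.1 (Nat.le_zero.1 h0)
  refine this ⟨?_, ?_, ?_, ?_⟩ fun j => j.elim0 <;> rw [hball] <;> simp

end UA

namespace UA

open FirstOrder

variable {b m d n n' n0 t : ℕ} {g g' g0 : SimpleGraph ℕ}

theorem iter_mono_of_invariant (hd : 2 * m < d) (hg : Good m d n0 g)
    {Q : ℕ → SimpleGraph ℕ → Prop} (h0 : Q n0 g)
    (hQ : ∀ n g S, Good m d n g → S ⊆ lowDegSet d g n → S.card = m → Q n g →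
      Q (n + 1) (attachStep g (n + 1) S)) {k : ℕ} :
    ∀ {f f' : SimpleGraph ℕ → ℝ},
      (∀ g', Good m d (n0 + k) g' → Q (n0 + k) g' → f g' ≤ f' g') →
      iter m d n0 k f g ≤ iter m d n0 k f' g := by
  induction k with
  | zero => intro f f' h; exact h g hg h0
  | succ k ih =>
    intro f f' h
    exact ih fun g' hg' hq => step_mono hg' hd fun S h1 h2 =>
      h _ (hg'.attach (by omega) h1 h2) (hQ _ _ _ hg' h1 h2 hq)

theorem tendsto_iter (hd : 2 * m < d) (hg : Good m d n0 g0) (k : ℕ) :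
    ∀ {h : ℕ → SimpleGraph ℕ → ℝ},
      (∀ g, Good m d (n0 + k) g → ∃ c, Tendsto (fun l => h l g) atTop (𝓝 c)) →
      ∃ c, Tendsto (fun l => iter m d n0 k (h l) g0) atTop (𝓝 c) := by
  induction k with
  | zero => intro h hh; exact hh g0 hg
  | succ k ih =>
    intro h hh
    refine ih fun g hg' => ?_
    have : ∀ S, ∃ c, S ∈ (lowDegSet d g (n0 + k)).powersetCard m →
        Tendsto (fun l => h l (attachStep g (n0 + k + 1) S)) atTop (𝓝 c) := by
      intro S
      by_cases hS : S ∈ (lowDegSet d g (n0 + k)).powersetCard m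
      · rw [Finset.mem_powersetCard] at hS
        obtain ⟨c, hc⟩ := hh _ (hg'.attach (by omega) hS.1 hS.2)
        exact ⟨c, fun _ => hc⟩
      · exact ⟨0, fun h => absurd h hS⟩
    choose c hc using this
    exact ⟨_, (tendsto_finsetSum _ fun S hS => hc S hS).div_const _⟩

/-- The pattern is connected and all its vertices are saturated. -/
def Pat.IsSaturated (P : Pat b d) : Prop := P.Connected ∧ ∀ v ∈ P.K, (P.D v : ℕ) = d

theorem roots_subset_attach (hg : Good m d n g) {S : Finset ℕ} (hS : S ⊆ lowDegSet d g n)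
    {P : Pat b d} (hP : P.IsSaturated) : roots P g (graphDeg g) (Finset.Icc 1 n) ⊆
      roots P (attachStep g (n + 1) S) (graphDeg (attachStep g (n + 1) S))
        (Finset.Icc 1 (n + 1)) := by
  intro x hx
  rw [mem_roots hP.1.1] at hx ⊢
  obtain ⟨f, hf, rfl⟩ := hx
  have hne : ∀ v ∈ P.K, f v ≠ n + 1 := fun v hv h => by
    have := Finset.mem_Icc.1 (hf.mem v hv)
    omega
  refine ⟨f, ⟨fun v hv => ?_, hf.inj, fun u hu v hv => ?_, fun v hv => ?_⟩, rfl⟩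
  · have := Finset.mem_Icc.1 (hf.mem v hv)
    exact Finset.mem_Icc.2 ⟨this.1, by omega⟩
  · rw [hf.adj u hu v hv, attach_adj_old g (hne u hu) (hne v hv)]
  · have hdeg := hf.deg v hv
    rw [deg_attach_old hg (hne v hv), if_neg, hdeg, add_zero]
    intro h
    have := (mem_lowDegSet.1 (hS h)).2
    rw [hdeg, hP.2 v hv] at this
    omega

open Classical in
/-- The numbers of occurrences of connected patterns, truncated at `t`. -/
noncomputable def capVec (t n : ℕ) (g : SimpleGraph ℕ) (P : Pat b d) : ℕ :=
  if P.Connected then min t (roots P g (graphDeg g) (Finset.Icc 1 n)).card else 0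

open Classical in
/-- The total truncated number of occurrences of saturated patterns. -/
noncomputable def satCount (b d t n : ℕ) (g : SimpleGraph ℕ) : ℝ :=
  ∑ P : Pat b d with P.IsSaturated, (capVec t n g P : ℝ)

theorem capVec_le (P : Pat b d) : capVec t n g P ≤ t := by
  unfold capVec
  split_ifs
  exacts [min_le_left _ _, Nat.zero_le _]

theorem capVec_le_attach (hg : Good m d n g) {S : Finset ℕ} (hS : S ⊆ lowDegSet d g n)
    {P : Pat b d} (hP : P.IsSaturated) :
    capVec t n g P ≤ capVec t (n + 1) (attachStep g (n + 1) S) P := by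
  unfold capVec
  rw [if_pos hP.1, if_pos hP.1]
  exact min_le_min le_rfl (Finset.card_le_card (roots_subset_attach hg hS hP))

theorem satCount_le : satCount b d t n g ≤ Fintype.card (Pat b d) * t := by
  classical
  unfold satCount
  refine (Finset.sum_le_card_nsmul _ _ (t : ℝ) fun P _ => ?_).trans ?_
  · exact_mod_cast capVec_le P
  · rw [nsmul_eq_mul]
    gcongr
    exact Finset.card_le_univ _

theorem satCount_le_attach (hg : Good m d n g) {S : Finset ℕ} (hS : S ⊆ lowDegSet d g n) :
    satCount b d t n g ≤ satCount b d t (n + 1) (attachStep g (n + 1) S) := by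
  classical
  refine Finset.sum_le_sum fun P hP => ?_
  exact_mod_cast capVec_le_attach hg hS (Finset.mem_filter.1 hP).2

theorem one_le_satCount_sub
    (h : ∀ P : Pat b d, P.IsSaturated → capVec t n' g' P ≤ capVec t n g P)
    {P : Pat b d} (hP : P.IsSaturated) (hne : capVec t n g P ≠ capVec t n' g' P) :
    1 ≤ satCount b d t n g - satCount b d t n' g' := by
  classical
  unfold satCount
  rw [← Finset.sum_sub_distrib]
  have h1 : (1 : ℝ) ≤ (capVec t n g P : ℝ) - capVec t n' g' P := by
    have : capVec t n' g' P + 1 ≤ capVec t n g P := lt_of_le_of_ne (h P hP) hne.symm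
    have : (capVec t n' g' P : ℝ) + 1 ≤ capVec t n g P := by exact_mod_cast this
    linarith
  refine h1.trans (Finset.single_le_sum
    (f := fun P : Pat b d => (capVec t n g P : ℝ) - capVec t n' g' P) (fun Q hQ => ?_)
    (Finset.mem_filter.2 ⟨Finset.mem_univ P, hP⟩))
  exact sub_nonneg.2 (by exact_mod_cast h Q (Finset.mem_filter.1 hQ).2)

/-- The pattern is connected, not saturated and not rare. -/
def Pat.IsCommon (m : ℕ) (P : Pat b d) : Prop :=
  P.Connected ∧ ¬ P.IsSaturated ∧ ¬ P.IsRare m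

theorem Pat.IsCommon.ab {P : Pat b d} (hP : P.IsCommon m) :
    Ab m d P.H P.K (fun v => P.D v) := by
  by_contra h
  refine hP.2.2 ⟨hP.1, ?_, h⟩
  by_contra! hsat
  exact hP.2.1 ⟨hP.1, fun v hv => le_antisymm (Nat.lt_succ_iff.1 (P.D v).2) (hsat v hv)⟩

theorem cnt_le_fib_mul_roots (hg : Good m d n g) {P : Pat b d} (hP : P.Connected) :
    cnt P.H P.K (fun v => P.D v) g n ≤
      fib d b * (roots P g (graphDeg g) (Finset.Icc 1 n)).card := by
  unfold cnt
  refine (Finset.card_le_mul_card_image_of_maps_to (f := fun f : Fin b → ℕ => f P.i)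
    (fun f hf => ?_) (fib d b) fun x _ => ?_)
  · rw [mem_emb] at hf
    rw [mem_roots hP.1]
    exact ⟨f, ⟨hf.mem, hf.inj, hf.adj, hf.deg⟩, rfl⟩
  · simpa using card_fiber_le (D := fun v => (P.D v : ℕ)) hg hP.1 (hP.2 _ hP.1) x

theorem Pat.IsCommon.expSmall (hm : 1 ≤ m) (hd : 2 * m < d) (hg : Good m d n0 g0) (t : ℕ)
    {P : Pat b d} (hP : P.IsCommon m) : ExpSmall m d n0 g0
      (fun n g => (roots P g (graphDeg g) (Finset.Icc 1 n)).card < t) := by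
  obtain ⟨β, hβ, h⟩ := hP.ab.linear hm hd hg P.K
    (by rw [comps_of_conn hP.1.1 (hP.1.2 _ hP.1.1)]; simp)
  refine h.mono hd hg ?_
  have hlim : Tendsto (fun n : ℕ => β * (n : ℝ)) atTop atTop :=
    tendsto_natCast_atTop_atTop.const_mul_atTop hβ
  filter_upwards [hlim.eventually_gt_atTop ((fib d b * t : ℕ) : ℝ)] with n hn g hgn hlt
  refine lt_of_le_of_lt ?_ hn
  exact_mod_cast (cnt_le_fib_mul_roots hgn hP.1).trans (Nat.mul_le_mul_left _ hlt.le)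

theorem ExpSmall.exists_finset (hd : 2 * m < d) (hg : Good m d n0 g0) {ι : Type*} (s : Finset ι)
    {B : ι → ℕ → SimpleGraph ℕ → Prop} (h : ∀ i ∈ s, ExpSmall m d n0 g0 (B i)) :
    ExpSmall m d n0 g0 (fun n g => ∃ i ∈ s, B i n g) := by
  classical
  induction s using Finset.induction_on with
  | empty => exact expSmall_false hd hg fun n g _ => by simp
  | insert i s _ ih =>
    refine ((h i (by simp)).or hd hg (ih fun j hj => h j (by simp [hj]))).mono hd hg ?_
    filter_upwards with n g _ hex
    simpa using hex

/-- Some common pattern has fewer than `t` occurrences. -/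
def Deficient (m b d t n : ℕ) (g : SimpleGraph ℕ) : Prop :=
  ∃ P : Pat b d, P.IsCommon m ∧ (roots P g (graphDeg g) (Finset.Icc 1 n)).card < t

theorem expSmall_deficient (hm : 1 ≤ m) (hd : 2 * m < d) (hg : Good m d n0 g0) (b t : ℕ) :
    ExpSmall m d n0 g0 (fun n g => Deficient m b d t n g) := by
  classical
  refine (ExpSmall.exists_finset hd hg (Finset.univ.filter fun P : Pat b d => P.IsCommon m)
    fun P hP => (Finset.mem_filter.1 hP).2.expSmall hm hd hg t).mono hd hg ?_
  filter_upwards with n g _ ⟨P, hP, hlt⟩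
  exact ⟨P, by simpa using hP, hlt⟩

open Classical in
/-- The vector of truncated counts with entries `v` at saturated patterns, computed from `x` at rare
patterns, and maximal at common patterns. -/
noncomputable def frozenVec (m t : ℕ) (v x : Pat b d → ℕ) (P : Pat b d) : ℕ :=
  if P.IsSaturated then v P else if P.IsRare m then min t (x P) else
    if P.Connected then t else 0

theorem capVec_eq_frozenVec {v : Pat b d → ℕ}
    (hv : ∀ P : Pat b d, P.IsSaturated → capVec t n g P = v P) (h : ¬ Deficient m b d t n g) :
    capVec t n g = frozenVec m t v (rareVec m g (graphDeg g) (Finset.Icc 1 n)) := by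
  classical
  funext P
  unfold frozenVec
  by_cases hs : P.IsSaturated
  · rw [if_pos hs, hv P hs]
  by_cases hr : P.IsRare m
  · rw [if_neg hs, if_pos hr, rareVec, if_pos hr, capVec, if_pos hr.1]
  by_cases hc : P.Connected
  · rw [if_neg hs, if_neg hr, if_pos hc, capVec, if_pos hc]
    refine min_eq_left (not_lt.1 fun hlt => h ⟨P, ⟨hc, hs, hr⟩, hlt⟩)
  · rw [if_neg hs, if_neg hr, if_neg hc, capVec, if_neg hc]

/-- The indicator of the truncated count vectors of graphs satisfying `φ`. -/
noncomputable def modelsVec (m t : ℕ) (φ : Language.graph.Sentence) (v : Pat b d → ℕ) : ℝ :=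
  ind (∃ n g, Good m d n g ∧ capVec t n g = v ∧ Models φ n g)

theorem abs_sub_ind_le_one (p q : Prop) : |ind p - ind q| ≤ 1 :=
  abs_sub_le_iff.2 ⟨by linarith [ind_le_one p, ind_nonneg q],
    by linarith [ind_le_one q, ind_nonneg p]⟩

theorem abs_modelsVec_le {φ : Language.graph.Sentence} (v : Pat b d → ℕ) :
    |modelsVec m t φ v| ≤ 1 := by
  unfold modelsVec
  rw [abs_of_nonneg (ind_nonneg _)]
  exact ind_le_one _

theorem modelsVec_capVec {φ : Language.graph.Sentence}
    (hφ : ∀ n g n' g', Good m d n g → Good m d n' g' →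
      Agree d b t g n g' n' → (Models φ n g ↔ Models φ n' g')) (hg : Good m d n g) :
    modelsVec m t φ (capVec t n g : Pat b d → ℕ) = ind (Models φ n g) := by
  unfold modelsVec
  congr 1
  refine propext ⟨?_, fun h => ⟨n, g, hg, rfl, h⟩⟩
  rintro ⟨n', g', hg', he, hM⟩
  refine (hφ n' g' n g hg' hg fun P hP => ?_).1 hM
  have := congrFun he P
  rwa [capVec, capVec, if_pos hP, if_pos hP] at this

theorem abs_ind_models_sub_le {φ : Language.graph.Sentence}
    (hφ : ∀ n g n' g', Good m d n g → Good m d n' g' →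
      Agree d b t g n g' n' → (Models φ n g ↔ Models φ n' g')) (hg : Good m d n g)
    (h : ∀ P : Pat b d, P.IsSaturated → capVec t n' g' P ≤ capVec t n g P) :
    |ind (Models φ n g) - modelsVec m t φ (frozenVec m t (capVec t n' g' : Pat b d → ℕ)
      (rareVec m g (graphDeg g) (Finset.Icc 1 n)))| ≤
      satCount b d t n g - satCount b d t n' g' + ind (Deficient m b d t n g) := by
  classical
  have h0 : 0 ≤ satCount b d t n g - satCount b d t n' g' := sub_nonneg.2
    (Finset.sum_le_sum fun P hP => by exact_mod_cast h P (Finset.mem_filter.1 hP).2)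
  by_cases hs : ∀ P : Pat b d, P.IsSaturated → capVec t n g P = capVec t n' g' P
  · by_cases hdef : Deficient m b d t n g
    · rw [ind_of hdef]
      exact (abs_sub_ind_le_one _ _).trans (by linarith)
    · rw [← capVec_eq_frozenVec hs hdef, modelsVec_capVec hφ hg, sub_self, abs_zero]
      exact add_nonneg h0 (ind_nonneg _)
  · push Not at hs
    obtain ⟨P, hP, hne⟩ := hs
    exact (abs_sub_ind_le_one _ _).trans
      (by linarith [one_le_satCount_sub h hP hne, ind_nonneg (Deficient m b d t n g)])

theorem monotone_iter_satCount (hd : 2 * m < d) (hg : Good m d n0 g0) :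
    Monotone fun k => iter m d n0 k (satCount b d t (n0 + k)) g0 := by
  refine monotone_nat_of_le_succ fun k => ?_
  rw [iter_succ]
  refine iter_mono hd hg fun g hg' => ?_
  rw [← step_const hg' hd (satCount b d t (n0 + k) g)]
  exact step_mono hg' hd fun S hS _ => satCount_le_attach hg' hS

/-- The probability that the chain satisfies a sentence converges. -/
theorem exists_tendsto_iter_models (hm : 1 ≤ m) (hd : 2 * m < d) (hg : Good m d n0 g0)
    (φ : Language.graph.Sentence) :
    ∃ c, Tendsto (fun k => iter m d n0 k (fun g => ind (Models φ (n0 + k) g)) g0)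
      atTop (𝓝 c) := by
  obtain ⟨b, t, hφ⟩ := exists_models_iff m d φ
  obtain ⟨L, hL⟩ : ∃ L, Tendsto (fun k => iter m d n0 k (satCount b d t (n0 + k)) g0)
      atTop (𝓝 L) := by
    refine ⟨_, tendsto_atTop_ciSup (monotone_iter_satCount hd hg)
      ⟨Fintype.card (Pat b d) * t, ?_⟩⟩
    rintro _ ⟨k, rfl⟩
    rw [← iter_const hd hg k (Fintype.card (Pat b d) * t : ℝ)]
    exact iter_mono hd hg fun g _ => satCount_le
  refine exists_tendsto_of_approx fun ε hε => ?_
  obtain ⟨K, hK⟩ := (hL.eventually_const_lt (show L - ε / 2 < L by linarith)).exists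
  let F : ℕ → SimpleGraph ℕ → SimpleGraph ℕ → ℝ := fun l g' g =>
    modelsVec m t φ (frozenVec m t (capVec t (n0 + K) g' : Pat b d → ℕ)
      (rareVec m g (graphDeg g) (Finset.Icc 1 (n0 + K + l))))
  refine ⟨fun k => iter m d n0 K (fun g' => iter m d (n0 + K) (k - K) (F (k - K) g') g') g0, ?_, ?_⟩
  · obtain ⟨c, hc⟩ := tendsto_iter hd hg K
      (h := fun l g' => iter m d (n0 + K) l (F l g') g') fun g' hg' =>
        exists_tendsto_rareVec hm hd hg' (Ψ := fun x =>
          modelsVec m t φ (frozenVec m t (capVec t (n0 + K) g' : Pat b d → ℕ) x))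
          fun x => abs_modelsVec_le _
    exact ⟨c, hc.comp (tendsto_sub_atTop_nat K)⟩
  have hdef := (expSmall_deficient hm hd hg b t).tendsto hd hg 0
  simp only [pow_zero, one_mul] at hdef
  filter_upwards [hdef.eventually_lt_const (half_pos hε), eventually_ge_atTop K] with k hk hKk
  obtain ⟨l, rfl⟩ := Nat.exists_eq_add_of_le hKk
  rw [Nat.add_sub_cancel_left, iter_iter, ← iter_sub]
  have hpoint : ∀ g', Good m d (n0 + K) g' →
      |iter m d (n0 + K) l (fun g => ind (Models φ (n0 + (K + l)) g)) g' -
        iter m d (n0 + K) l (F l g') g'| ≤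
      iter m d (n0 + K) l (satCount b d t (n0 + (K + l))) g' - satCount b d t (n0 + K) g' +
        iter m d (n0 + K) l (fun g => ind (Deficient m b d t (n0 + (K + l)) g)) g' := by
    intro g' hg'
    rw [← iter_sub, ← iter_const hd hg' l (satCount b d t (n0 + K) g'), ← iter_sub, ← iter_add,
      ← Nat.add_assoc]
    refine (iter_abs_le hd hg').trans (iter_mono_of_invariant hd hg'
      (Q := fun n g => ∀ P : Pat b d, P.IsSaturated → capVec t (n0 + K) g' P ≤ capVec t n g P)
      (fun P _ => le_rfl) (fun n g S hgn hS _ hq P hP =>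
        (hq P hP).trans (capVec_le_attach hgn hS hP)) fun g hgn hq => ?_)
    exact abs_ind_models_sub_le hφ hgn hq
  refine ((iter_abs_le hd hg).trans (iter_mono hd hg hpoint)).trans ?_
  rw [iter_add, iter_sub, ← iter_iter, ← iter_iter]
  have := (monotone_iter_satCount (b := b) (t := t) hd hg).ge_of_tendsto hL (K + l)
  linarith

end UA

namespace UA

open FirstOrder

variable {m d n : ℕ} {g g' : SimpleGraph ℕ}

theorem attachStep_initGraph_adj (m a b : ℕ) :
    (attachStep (initGraph m) (m + 1) (Finset.Icc 1 m)).Adj a b ↔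
      a ≠ b ∧ a ∈ Finset.Icc 1 (m + 1) ∧ b ∈ Finset.Icc 1 (m + 1) := by
  rw [attach_adj, initGraph, SimpleGraph.fromRel_adj]
  simp only [Finset.mem_Icc]
  omega

theorem graphDeg_initGraph_lt (hm : 1 ≤ m) (hd : 2 * m < d) (v : ℕ) :
    graphDeg (initGraph m) v < d := by
  have h : (initGraph m).neighborSet v ⊆ (Finset.Icc 1 m : Finset ℕ) := by
    intro w hw
    rw [SimpleGraph.mem_neighborSet, initGraph, SimpleGraph.fromRel_adj] at hw
    rcases hw.2 with h | h
    exacts [h.2, h.1]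
  have := Set.ncard_le_ncard h (Finset.finite_toSet _)
  rw [Set.ncard_coe_finset, Nat.card_Icc] at this
  unfold graphDeg
  omega

theorem good_attachStep_initGraph (hm : 1 ≤ m) (hd : 2 * m < d) :
    Good m d (m + 1) (attachStep (initGraph m) (m + 1) (Finset.Icc 1 m)) := by
  have hdeg : ∀ v ∈ Finset.Icc 1 (m + 1),
      graphDeg (attachStep (initGraph m) (m + 1) (Finset.Icc 1 m)) v = m := by
    intro v hv
    have : (attachStep (initGraph m) (m + 1) (Finset.Icc 1 m)).neighborSet v =
        ((Finset.Icc 1 (m + 1)).erase v : Finset ℕ) := by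
      ext w
      rw [SimpleGraph.mem_neighborSet, attachStep_initGraph_adj, Finset.mem_coe,
        Finset.mem_erase]
      exact ⟨fun h => ⟨h.1.symm, h.2.2⟩, fun h => ⟨h.1.symm, hv, h.2⟩⟩
    rw [graphDeg, this, Set.ncard_coe_finset, Finset.card_erase_of_mem hv, Nat.card_Icc]
    omega
  refine ⟨le_rfl, fun a b h => ((attachStep_initGraph_adj m a b).1 h).2.1,
    fun v hv => (hdeg v hv).ge, fun v hv => (hdeg v hv).trans_le (by omega), ?_⟩
  rw [Finset.sum_congr rfl hdeg, Finset.sum_const, Nat.card_Icc, smul_eq_mul]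
  apply le_of_eq
  rw [Nat.add_sub_cancel]
  ring

theorem attachStep_injective (hg : Good m d n g) (hg' : Good m d n g') {S S' : Finset ℕ}
    (hS : S ⊆ Finset.Icc 1 n) (hS' : S' ⊆ Finset.Icc 1 n)
    (h : attachStep g (n + 1) S = attachStep g' (n + 1) S') : g = g' ∧ S = S' := by
  constructor
  · ext a b
    by_cases ha : a = n + 1
    · subst ha
      exact iff_of_false (hg.not_adj_succ' b) (hg'.not_adj_succ' b)
    by_cases hb : b = n + 1
    · subst hb
      exact iff_of_false (hg.not_adj_succ a) (hg'.not_adj_succ a)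
    rw [← attach_adj_old g (S := S) ha hb, h, attach_adj_old g' ha hb]
  · ext a
    rw [← attach_adj_new hg hS, h, attach_adj_new hg' hS']

variable {Ω : Type*} [MeasurableSpace Ω] {μ : Measure Ω} [IsProbabilityMeasure μ]
  {G : ℕ → Ω → SimpleGraph ℕ}

theorem ae_exists_mem_of_sum_eq_one {ι : Type*} {s : Finset ι} {E : ι → Set Ω}
    (hE : ∀ i ∈ s, MeasurableSet (E i)) (hdis : (s : Set ι).PairwiseDisjoint E)
    (hsum : ∑ i ∈ s, μ.real (E i) = 1) : ∀ᵐ ω ∂μ, ∃ i ∈ s, ω ∈ E i := by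
  rw [← measureReal_biUnion_finset hdis hE] at hsum
  have h1 : μ (⋃ i ∈ s, E i) = 1 := by
    rw [← ENNReal.toReal_eq_one_iff]
    exact hsum
  filter_upwards [(mem_ae_iff_prob_eq_one (s.measurableSet_biUnion hE)).2 h1] with ω hω
  simpa using hω

/-- `G n` is almost surely one of finitely many good graphs, and its law is that of the chain. -/
def HasChainLaw (m d : ℕ) (μ : Measure Ω) (G : ℕ → Ω → SimpleGraph ℕ) (k : ℕ) : Prop :=
  ∃ F : Finset (SimpleGraph ℕ), (∀ g ∈ F, Good m d (m + 1 + k) g) ∧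
    (∀ᵐ ω ∂μ, G (m + 1 + k) ω ∈ F) ∧
    ∀ f : SimpleGraph ℕ → ℝ, ∑ g ∈ F, μ.real {ω | G (m + 1 + k) ω = g} * f g =
      iter m d (m + 1) k f (attachStep (initGraph m) (m + 1) (Finset.Icc 1 m))

theorem hasChainLaw_zero (hm : 1 ≤ m) (hd : 2 * m < d) (hG : IsUAProcess m d μ G) :
    HasChainLaw m d μ G 0 := by
  have hlow : lowDegSet d (initGraph m) m = Finset.Icc 1 m :=
    Finset.filter_true_of_mem fun v _ => graphDeg_initGraph_lt hm hd v
  have h := hG.2.2 m le_rfl (initGraph m) (Finset.Icc 1 m) hlow.ge (by simp)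
  have huniv : {ω | G m ω = initGraph m} = Set.univ := Set.eq_univ_of_forall hG.2.1
  rw [hlow, huniv, Set.inter_univ, measure_univ, Nat.card_Icc, Nat.add_sub_cancel,
    Nat.choose_self, Nat.cast_one, div_one] at h
  refine ⟨{attachStep (initGraph m) (m + 1) (Finset.Icc 1 m)}, ?_, ?_, fun f => ?_⟩
  · intro g hg
    rw [Finset.mem_singleton.1 hg]
    exact good_attachStep_initGraph hm hd
  · filter_upwards [(mem_ae_iff_prob_eq_one (hG.1 _ _)).2 h] with ω hω
    exact Finset.mem_singleton.2 hω
  · rw [Finset.sum_singleton, measureReal_def, add_zero, h, ENNReal.toReal_one, one_mul]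
    rfl

theorem HasChainLaw.succ (hd : 2 * m < d)
    (hG : IsUAProcess m d μ G) {k : ℕ} (h : HasChainLaw m d μ G k)
    (hg1 : Good m d (m + 1) (attachStep (initGraph m) (m + 1) (Finset.Icc 1 m))) :
    HasChainLaw m d μ G (k + 1) := by
  classical
  obtain ⟨F, hgood, -, hlaw⟩ := h
  unfold HasChainLaw
  rw [← Nat.add_assoc]
  set n := m + 1 + k with hn
  let s : Finset (Σ _ : SimpleGraph ℕ, Finset ℕ) :=
    F.sigma fun g => (lowDegSet d g n).powersetCard m
  let a : (Σ _ : SimpleGraph ℕ, Finset ℕ) → SimpleGraph ℕ := fun x => attachStep x.1 (n + 1) x.2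
  let E : (Σ _ : SimpleGraph ℕ, Finset ℕ) → Set Ω := fun x =>
    {ω | G (n + 1) ω = a x} ∩ {ω | G n ω = x.1}
  have hs : ∀ x ∈ s, Good m d n x.1 ∧ x.2 ⊆ lowDegSet d x.1 n ∧ x.2.card = m := by
    intro x hx
    rw [Finset.mem_sigma, Finset.mem_powersetCard] at hx
    exact ⟨hgood _ hx.1, hx.2⟩
  have hinj : Set.InjOn a s := by
    intro x hx y hy hxy
    obtain ⟨hx1, hx2, -⟩ := hs x hx
    obtain ⟨hy1, hy2, -⟩ := hs y hy
    obtain ⟨h1, h2⟩ := attachStep_injective hx1 hy1 (hx2.trans (lowDegSet_subset _ _ _))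
      (hy2.trans (lowDegSet_subset _ _ _)) hxy
    exact Sigma.ext h1 (heq_of_eq h2)
  have hE : ∀ x ∈ s, μ.real (E x) =
      μ.real {ω | G n ω = x.1} / ((lowDegSet d x.1 n).card.choose m : ℝ) := by
    intro x hx
    obtain ⟨-, hx2, hx3⟩ := hs x hx
    rw [measureReal_def, hG.2.2 n (by omega) x.1 x.2 hx2 hx3, ENNReal.toReal_div,
      ENNReal.toReal_natCast, measureReal_def]
  have hsum : ∀ f : SimpleGraph ℕ → ℝ, ∑ x ∈ s, μ.real (E x) * f (a x) =
      iter m d (m + 1) (k + 1) f (attachStep (initGraph m) (m + 1) (Finset.Icc 1 m)) := by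
    intro f
    rw [iter_succ, ← hlaw, Finset.sum_sigma]
    refine Finset.sum_congr rfl fun g hg => ?_
    rw [step, mul_div_assoc', Finset.mul_sum, Finset.sum_div]
    refine Finset.sum_congr rfl fun S hS => ?_
    rw [hE ⟨g, S⟩ (Finset.mem_sigma.2 ⟨hg, hS⟩)]
    exact div_mul_eq_mul_div _ _ _
  have hcover : ∀ᵐ ω ∂μ, ∃ x ∈ s, ω ∈ E x := by
    refine ae_exists_mem_of_sum_eq_one (fun x _ => (hG.1 _ _).inter (hG.1 _ _)) ?_ ?_
    · intro x hx y hy hxy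
      refine Set.disjoint_left.2 fun ω hω hω' => hxy (hinj hx hy ?_)
      exact hω.1.symm.trans hω'.1
    · have := hsum fun _ => 1
      simpa only [mul_one, iter_const hd hg1] using this
  refine ⟨s.image a, ?_, ?_, fun f => ?_⟩
  · intro g hg
    obtain ⟨x, hx, rfl⟩ := Finset.mem_image.1 hg
    obtain ⟨hx1, hx2, hx3⟩ := hs x hx
    exact hx1.attach (by omega) hx2 hx3
  · filter_upwards [hcover] with ω ⟨x, hx, hω⟩
    exact Finset.mem_image.2 ⟨x, hx, hω.1.symm⟩
  · rw [Finset.sum_image hinj, ← hsum]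
    refine Finset.sum_congr rfl fun x hx => ?_
    congr 1
    refine measureReal_congr ?_
    filter_upwards [hcover] with ω ⟨y, hy, hω⟩
    refine propext ⟨fun h => ?_, fun h => h.1⟩
    rwa [hinj hx hy (h.symm.trans hω.1)]

theorem hasChainLaw (hm : 1 ≤ m) (hd : 2 * m < d) (hG : IsUAProcess m d μ G) (k : ℕ) :
    HasChainLaw m d μ G k := by
  induction k with
  | zero => exact hasChainLaw_zero hm hd hG
  | succ k ih => exact ih.succ hd hG (good_attachStep_initGraph hm hd)

theorem measureReal_eq_iter (hm : 1 ≤ m) (hd : 2 * m < d) (hG : IsUAProcess m d μ G) (k : ℕ)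
    (A : SimpleGraph ℕ → Prop) : μ.real {ω | A (G (m + 1 + k) ω)} =
      iter m d (m + 1) k (fun g => ind (A g))
        (attachStep (initGraph m) (m + 1) (Finset.Icc 1 m)) := by
  classical
  obtain ⟨F, -, hF, hlaw⟩ := hasChainLaw hm hd hG k
  rw [← hlaw]
  have h1 : μ.real {ω | A (G (m + 1 + k) ω)} =
      μ.real (⋃ g ∈ F.filter A, {ω | G (m + 1 + k) ω = g}) := by
    refine measureReal_congr ?_
    filter_upwards [hF] with ω hω
    refine propext ⟨fun h => ?_, fun h => ?_⟩
    · exact Set.mem_biUnion (Finset.mem_coe.2 (Finset.mem_filter.2 ⟨hω, h⟩)) rfl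
    · obtain ⟨g, hg, hωg⟩ := Set.mem_iUnion₂.1 h
      have := (Finset.mem_filter.1 hg).2
      rw [← show G (m + 1 + k) ω = g from hωg] at this
      exact this
  rw [h1, measureReal_biUnion_finset (fun x _ y _ hxy => Set.disjoint_left.2 fun ω hx hy =>
    hxy (hx.symm.trans hy)) (fun g _ => hG.1 _ _), Finset.sum_filter]
  refine Finset.sum_congr rfl fun g _ => ?_
  by_cases h : A g
  · rw [if_pos h, ind_of h, mul_one]
  · rw [if_neg h, ind_of_not h, mul_zero]

end UA

/-- The bounded-degree uniform attachment random graph `G_n(m,d)` with `d > 2m` obeys the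
first-order convergence law: for every first-order sentence `φ` in the language of graphs,
`lim_{n→∞} P(G_n ⊨ φ)` exists (satisfaction is evaluated in the graph induced on the vertex
set `[n] = {1,…,n}`). -/
theorem uniform_attachment_fo_convergence_law
    (m d : ℕ) (hm : 1 ≤ m) (hd : 2 * m < d)
    {Ω : Type*} [MeasurableSpace Ω] (μ : Measure Ω) [IsProbabilityMeasure μ]
    (G : ℕ → Ω → SimpleGraph ℕ) (hG : IsUAProcess m d μ G)
    (φ : FirstOrder.Language.graph.Sentence) :
    ∃ c : ℝ,
      Tendsto (fun n : ℕ =>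
          (μ {ω | @FirstOrder.Language.Sentence.Realize FirstOrder.Language.graph
              (Set.Icc 1 n) (SimpleGraph.structure ((G n ω).induce (Set.Icc 1 n))) φ}).toReal)
        atTop (𝓝 c) := by
  obtain ⟨c, hc⟩ := UA.exists_tendsto_iter_models hm hd (UA.good_attachStep_initGraph hm hd) φ
  refine ⟨c, (tendsto_add_atTop_iff_nat (m + 1)).1 (hc.congr fun k => ?_)⟩
  rw [Nat.add_comm k (m + 1)]
  exact (UA.measureReal_eq_iter hm hd hG k (UA.Models φ (m + 1 + k))).symm
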